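/- The proportion of matrices γ in Γ_T which are hyperbolic with u_γ = 1 and f_γ = 1 (equivalently, for which ℤ[γ] is isomorphic to the full ring of integers O_K of ℚ(√(Tr(γ)²−4)), hence a Dedekind ring) converges as T → ∞ to (7/12)·∏_{p odd prime} (1 − 2(p²+p−1)/(p²(p²−1))) ≈ 0.3267. -/

import Mathlib

noncomputable section

open Matrix Filter Topology

/-- `Γ = SL(2,ℤ)`. -/
abbrev SL2Z := Matrix.SpecialLinearGroup (Fin 2) ℤ

/-- Frobenius norm of a matrix in `SL(2,ℤ)`. -/
noncomputable def frobNorm (γ : SL2Z) : ℝ :=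
  Real.sqrt ((γ 0 0 ^ 2 + γ 0 1 ^ 2 + γ 1 0 ^ 2 + γ 1 1 ^ 2 : ℤ) : ℝ)

/-- Trace of a matrix in `SL(2,ℤ)`. -/
def trZ (γ : SL2Z) : ℤ := γ 0 0 + γ 1 1

/-- `u_γ = gcd(c, d-a, b)` for `γ = (a b; c d)`. -/
def uGamma (γ : SL2Z) : ℕ :=
  Int.gcd (γ 1 0) (Int.gcd (γ 1 1 - γ 0 0) (γ 0 1))

/-- `u_γ = 1` and `f_γ = 1`, i.e. `ℤ[γ]` is the full ring of integers of
`ℚ(√(Tr(γ)²-4))`: with `Tr(γ)² - 4 = m_γ² D_γ` (`m_γ ≥ 1`, `D_γ > 1` squarefree) one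
has `u_γ = 1` and `m_γ = 1` if `D_γ ≡ 1 (mod 4)`, `m_γ = 2` otherwise. -/
def IsMaximalZGamma (γ : SL2Z) : Prop :=
  uGamma γ = 1 ∧
    ∃ mm D : ℤ, 1 ≤ mm ∧ 1 < D ∧ Squarefree D ∧
      (trZ γ) ^ 2 - 4 = mm ^ 2 * D ∧
      (if D % 4 = 1 then mm = 1 else mm = 2)

/-- The divisor bound: `d(n) ≪ n ^ ε`. -/
theorem exists_card_divisors_le (ε : ℝ) (hε : 0 < ε) :
    ∃ C : ℝ, 1 ≤ C ∧ ∀ n : ℕ, n ≠ 0 → (n.divisors.card : ℝ) ≤ C * (n : ℝ) ^ ε := by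
  set K : ℕ := ⌈(2 : ℝ) ^ (1 / ε)⌉₊ with hK
  have hlog : 0 < Real.log 2 := Real.log_pos (by norm_num)
  set C₀ : ℝ := 1 + 1 / (ε * Real.log 2) with hC₀
  have hel : 0 < ε * Real.log 2 := by positivity
  have hC₀1 : 1 ≤ C₀ := by
    have : 0 < 1 / (ε * Real.log 2) := by positivity
    linarith
  have hsmall (p e : ℕ) (hp : 2 ≤ p) : ((e : ℝ) + 1) ≤ C₀ * ((p : ℝ) ^ e) ^ ε := by
    have h1 : (2 : ℝ) ^ (ε * e) ≤ ((p : ℝ) ^ e) ^ ε := by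
      rw [← Real.rpow_natCast, ← Real.rpow_mul (by positivity), mul_comm ε]
      exact Real.rpow_le_rpow (by norm_num) (by exact_mod_cast hp) (by positivity)
    have h2 : 1 + ε * Real.log 2 * e ≤ (2 : ℝ) ^ (ε * e) := by
      rw [Real.rpow_def_of_pos (by norm_num)]
      have := Real.add_one_le_exp (Real.log 2 * (ε * e))
      linarith
    have h3 : (e : ℝ) + 1 ≤ C₀ * (1 + ε * Real.log 2 * e) := by
      have : C₀ * (1 + ε * Real.log 2 * e)
          = 1 + e + ε * Real.log 2 * e + 1 / (ε * Real.log 2) := by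
        rw [hC₀]; field_simp; ring
      rw [this]
      have : 0 < 1 / (ε * Real.log 2) := by positivity
      have : 0 ≤ ε * Real.log 2 * e := by positivity
      linarith
    calc (e : ℝ) + 1 ≤ C₀ * (1 + ε * Real.log 2 * e) := h3
      _ ≤ C₀ * ((p : ℝ) ^ e) ^ ε := by gcongr; exact h2.trans h1
  have hbig (p e : ℕ) (hp : K ≤ p) : ((e : ℝ) + 1) ≤ ((p : ℝ) ^ e) ^ ε := by
    have h1 : (2 : ℝ) ^ (1 / ε) ≤ p := (Nat.le_ceil _).trans (by exact_mod_cast hp)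
    have h2 : (2 : ℝ) ≤ (p : ℝ) ^ ε := by
      calc (2 : ℝ) = ((2 : ℝ) ^ (1 / ε)) ^ ε := by
            rw [← Real.rpow_mul (by norm_num)]; field_simp; simp
        _ ≤ (p : ℝ) ^ ε := Real.rpow_le_rpow (by positivity) h1 hε.le
    have h3 : ((p : ℝ) ^ e) ^ ε = ((p : ℝ) ^ ε) ^ e := by
      rw [← Real.rpow_natCast, ← Real.rpow_natCast, ← Real.rpow_mul (by positivity),
        ← Real.rpow_mul (by positivity), mul_comm]
    rw [h3]
    have h4 : ((e : ℝ) + 1) ≤ 2 ^ e := by exact_mod_cast Nat.lt_two_pow_self (n := e)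
    exact h4.trans (pow_le_pow_left₀ (by norm_num) h2 e)
  refine ⟨C₀ ^ K, one_le_pow₀ hC₀1, fun n hn => ?_⟩
  have hcard := Nat.card_divisors hn
  have hn' : (n : ℝ) ^ ε = ∏ p ∈ n.primeFactors, ((p : ℝ) ^ n.factorization p) ^ ε := by
    conv_lhs => rw [← Nat.prod_factorization_pow_eq_self hn]
    rw [Finsupp.prod, Nat.support_factorization, Nat.cast_prod,
      ← Real.finsetProd_rpow _ _ (fun i _ => by positivity)]
    simp
  rw [hcard, hn']
  push_cast
  calc ∏ p ∈ n.primeFactors, ((n.factorization p : ℝ) + 1)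
      ≤ ∏ p ∈ n.primeFactors, ((if p < K then C₀ else 1) *
          ((p : ℝ) ^ n.factorization p) ^ ε) := by
        apply Finset.prod_le_prod
        · intro i _; positivity
        · intro p hp
          split_ifs with h
          · exact hsmall _ _ (Nat.prime_of_mem_primeFactors hp).two_le
          · rw [one_mul]; exact hbig _ _ (not_lt.mp h)
    _ = (∏ p ∈ n.primeFactors, (if p < K then C₀ else 1)) *
          ∏ p ∈ n.primeFactors, ((p : ℝ) ^ n.factorization p) ^ ε := Finset.prod_mul_distrib
    _ ≤ C₀ ^ K * ∏ p ∈ n.primeFactors, ((p : ℝ) ^ n.factorization p) ^ ε := by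
        gcongr
        rw [Finset.prod_ite, Finset.prod_const, Finset.prod_const_one, mul_one]
        apply pow_le_pow_right₀ hC₀1
        calc _ ≤ (Finset.range K).card := by
              apply Finset.card_le_card
              intro p hp
              simp only [Finset.mem_filter] at hp
              exact Finset.mem_range.mpr hp.2
          _ = K := Finset.card_range K

/-- The number of solutions `x` of `m x = 0` in `ZMod c`. -/
def annCard (c : ℕ) [NeZero c] (m : ZMod c) : ℕ := (Finset.univ.filter fun x : ZMod c => m * x = 0).card

section Kloosterman

variable {c : ℕ} [NeZero c]

theorem card_filter_mul_eq_le (m t : ZMod c) :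
    (Finset.univ.filter fun x : ZMod c => m * x = t).card ≤ annCard c m := by
  rcases (Finset.univ.filter fun x : ZMod c => m * x = t).eq_empty_or_nonempty with h | ⟨x₀, hx₀⟩
  · simp [h]
  · apply Finset.card_le_card_of_injOn (fun x => x - x₀)
    · intro x hx
      simp only [Finset.coe_filter, Finset.mem_univ, true_and, Set.mem_ofPred_eq,
        Finset.mem_filter] at hx hx₀ ⊢
      rw [mul_sub, hx, hx₀, sub_self]
    · intro x _ y _ h
      simpa using h

theorem annCard_mul_le (a b : ZMod c) : annCard c (a * b) ≤ annCard c b * annCard c a := by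
  apply Finset.card_le_mul_card_image_of_maps_to (f := fun x => b * x)
  · intro x hx
    simp only [Finset.mem_filter, Finset.mem_univ, true_and] at hx ⊢
    rw [← mul_assoc]; exact hx
  · intro y _
    refine le_trans (Finset.card_le_card ?_) (card_filter_mul_eq_le b y)
    intro x hx
    simp only [Finset.mem_filter, Finset.mem_univ, true_and] at hx ⊢
    exact hx.2

theorem annCard_mul_addOrderOf (m : ZMod c) : annCard c m * addOrderOf m = c := by
  have h1 := AddSubgroup.card_eq_card_quotient_mul_card_addSubgroup (AddMonoidHom.mulLeft m).ker
  have h2 : Nat.card (AddMonoidHom.mulLeft m).ker = annCard c m := by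
    rw [annCard, ← Fintype.card_subtype, ← Nat.card_eq_fintype_card]
    exact Nat.card_congr (Equiv.subtypeEquivRight fun x => by simp [AddMonoidHom.mem_ker])
  have h3 : Nat.card (ZMod c ⧸ (AddMonoidHom.mulLeft m).ker) = addOrderOf m := by
    rw [Nat.card_congr (QuotientAddGroup.quotientKerEquivRange (AddMonoidHom.mulLeft m)).toEquiv,
      ← Nat.card_zmultiples]
    apply Nat.card_congr
    apply Equiv.setCongr
    ext x
    simp only [SetLike.mem_coe, AddMonoidHom.mem_range, AddSubgroup.mem_zmultiples_iff]
    constructor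
    · rintro ⟨y, rfl⟩
      exact ⟨(y.val : ℤ), by simp [mul_comm]⟩
    · rintro ⟨k, rfl⟩
      exact ⟨(k : ZMod c), by simp [mul_comm]⟩
  rw [h2, h3, Nat.card_zmod] at h1
  rw [mul_comm]; exact h1.symm

theorem annCard_eq_gcd (m : ℕ) : annCard c (m : ZMod c) = c.gcd m := by
  have h := annCard_mul_addOrderOf (c := c) (m : ZMod c)
  have hc : 0 < c := NeZero.pos c
  have hg : 0 < c.gcd m := Nat.gcd_pos_of_pos_left _ hc
  rw [ZMod.addOrderOf_coe _ hc.ne'] at h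
  have h2 : c.gcd m * (c / c.gcd m) = c := Nat.mul_div_cancel' (Nat.gcd_dvd_left _ _)
  have h3 : 0 < c / c.gcd m := Nat.div_pos (Nat.le_of_dvd hc (Nat.gcd_dvd_left _ _)) hg
  exact Nat.eq_of_mul_eq_mul_right h3 (h.trans h2.symm)

theorem sum_annCard_le : ∑ m : ZMod c, annCard c m ≤ c * c.divisors.card := by
  have hmaps : ∀ m ∈ (Finset.univ : Finset (ZMod c)), addOrderOf m ∈ c.divisors := by
    intro m _
    rw [Nat.mem_divisors]
    exact ⟨⟨annCard c m, by rw [mul_comm]; exact (annCard_mul_addOrderOf m).symm⟩, NeZero.ne c⟩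
  rw [← Finset.sum_fiberwise_of_maps_to hmaps]
  calc _ ≤ ∑ _e ∈ c.divisors, c := by
        apply Finset.sum_le_sum
        intro e he
        have hdvd := (Nat.mem_divisors.mp he).1
        have he0 : 0 < e := Nat.pos_of_mem_divisors he
        have h1 : ∀ m ∈ Finset.univ.filter (fun m : ZMod c => addOrderOf m = e),
            annCard c m = c / e := by
          intro m hm
          simp only [Finset.mem_filter, Finset.mem_univ, true_and] at hm
          have := annCard_mul_addOrderOf m
          rw [hm] at this
          exact (Nat.div_eq_of_eq_mul_left he0 this.symm).symm
        rw [Finset.sum_congr rfl h1, Finset.sum_const, smul_eq_mul,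
          IsAddCyclic.card_addOrderOf_eq_totient (by simpa [Nat.card_zmod] using hdvd)]
        calc _ ≤ e * (c / e) := Nat.mul_le_mul_right _ (Nat.totient_le e)
          _ = c := Nat.mul_div_cancel' hdvd
    _ = _ := by simp [mul_comm]

/-- The Kloosterman sum `∑ ψ (m u + n u⁻¹)` modulo `c`. -/
def kloosterman (m n : ZMod c) : ℂ :=
  ∑ u : (ZMod c)ˣ, ZMod.stdAddChar (m * (u : ZMod c) + n * ((u⁻¹ : (ZMod c)ˣ) : ZMod c))

theorem conj_kloosterman (m n : ZMod c) :
    (starRingEnd ℂ) (kloosterman m n) = kloosterman (-m) (-n) := by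
  unfold kloosterman
  rw [map_sum]
  refine Finset.sum_congr rfl fun u _ => ?_
  rw [← AddChar.map_neg_eq_conj]
  congr 1; ring

theorem sum_stdAddChar_mul (x : ZMod c) :
    ∑ m : ZMod c, (ZMod.stdAddChar (m * x) : ℂ) = if x = 0 then (c : ℂ) else 0 := by
  have := AddChar.sum_mulShift (R := ZMod c) (R' := ℂ) x (ZMod.isPrimitive_stdAddChar c)
  rw [this]; simp [ZMod.card]

/-- Quadruples of units governing the fourth moment of Kloosterman sums. -/
def fourthMomentSet (c : ℕ) [NeZero c] : Finset ((ZMod c)ˣ × (ZMod c)ˣ × (ZMod c)ˣ × (ZMod c)ˣ) :=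
  Finset.univ.filter fun u =>
    ((u.1 : ZMod c) + (u.2.1 : ZMod c) - (u.2.2.1 : ZMod c) - (u.2.2.2 : ZMod c) = 0) ∧
    (((u.1⁻¹ : (ZMod c)ˣ) : ZMod c) + ((u.2.1⁻¹ : (ZMod c)ˣ) : ZMod c)
      - ((u.2.2.1⁻¹ : (ZMod c)ˣ) : ZMod c) - ((u.2.2.2⁻¹ : (ZMod c)ˣ) : ZMod c) = 0)

theorem sum_norm_kloosterman_pow_four :
    ∑ m : ZMod c, ∑ n : ZMod c, ‖kloosterman m n‖ ^ 4
      = (c : ℝ) ^ 2 * (fourthMomentSet c).card := by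
  have key : ∀ m n : ZMod c, ((‖kloosterman m n‖ ^ 4 : ℝ) : ℂ) =
      ∑ u : (ZMod c)ˣ × (ZMod c)ˣ × (ZMod c)ˣ × (ZMod c)ˣ,
        (ZMod.stdAddChar (m * ((u.1 : ZMod c) + (u.2.1 : ZMod c) - (u.2.2.1 : ZMod c) - (u.2.2.2 : ZMod c))) : ℂ) *
        ZMod.stdAddChar (n * (((u.1⁻¹ : (ZMod c)ˣ) : ZMod c) + ((u.2.1⁻¹ : (ZMod c)ˣ) : ZMod c)
      - ((u.2.2.1⁻¹ : (ZMod c)ˣ) : ZMod c) - ((u.2.2.2⁻¹ : (ZMod c)ˣ) : ZMod c))) := by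
    intro m n
    have h1 : ((‖kloosterman m n‖ ^ 4 : ℝ) : ℂ) =
        kloosterman m n * (kloosterman m n * (kloosterman (-m) (-n) * kloosterman (-m) (-n))) := by
      rw [← conj_kloosterman]
      have := Complex.mul_conj' (kloosterman m n)
      push_cast
      calc (‖kloosterman m n‖ : ℂ) ^ 4 = ((‖kloosterman m n‖ : ℂ) ^ 2) ^ 2 := by ring
        _ = _ := by rw [← this]; ring
    rw [h1]
    unfold kloosterman
    rw [Finset.sum_mul_sum, Finset.sum_mul_sum, Finset.sum_mul_sum]
    simp_rw [Fintype.sum_prod_type]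
    refine Finset.sum_congr rfl fun u1 _ => ?_
    simp_rw [Finset.mul_sum]
    refine Finset.sum_congr rfl fun u2 _ => ?_
    refine Finset.sum_congr rfl fun u3 _ => ?_
    refine Finset.sum_congr rfl fun u4 _ => ?_
    simp_rw [← AddChar.map_add_eq_mul]
    congr 1; ring
  have h : ((∑ m : ZMod c, ∑ n : ZMod c, ‖kloosterman m n‖ ^ 4 : ℝ) : ℂ)
      = ((c : ℝ) ^ 2 * (fourthMomentSet c).card : ℝ) := by
    rw [Complex.ofReal_sum]
    simp_rw [Complex.ofReal_sum, key]
    have : ∀ m : ZMod c, (∑ n : ZMod c, ∑ u : (ZMod c)ˣ × (ZMod c)ˣ × (ZMod c)ˣ × (ZMod c)ˣ,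
        (ZMod.stdAddChar (m * ((u.1 : ZMod c) + (u.2.1 : ZMod c) - (u.2.2.1 : ZMod c) - (u.2.2.2 : ZMod c))) : ℂ) *
        ZMod.stdAddChar (n * (((u.1⁻¹ : (ZMod c)ˣ) : ZMod c) + ((u.2.1⁻¹ : (ZMod c)ˣ) : ZMod c)
      - ((u.2.2.1⁻¹ : (ZMod c)ˣ) : ZMod c) - ((u.2.2.2⁻¹ : (ZMod c)ˣ) : ZMod c)))) = _ :=
      fun m => Finset.sum_comm
    simp_rw [this]
    rw [Finset.sum_comm]
    simp_rw [← Finset.mul_sum, ← Finset.sum_mul, sum_stdAddChar_mul]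
    rw [fourthMomentSet, Finset.card_filter]
    push_cast
    rw [Finset.mul_sum]
    refine Finset.sum_congr rfl fun u _ => ?_
    by_cases h1 : ((u.1 : ZMod c) + (u.2.1 : ZMod c) - (u.2.2.1 : ZMod c) - (u.2.2.2 : ZMod c) = 0) <;>
    by_cases h2 : (((u.1⁻¹ : (ZMod c)ˣ) : ZMod c) + ((u.2.1⁻¹ : (ZMod c)ˣ) : ZMod c)
      - ((u.2.2.1⁻¹ : (ZMod c)ˣ) : ZMod c) - ((u.2.2.2⁻¹ : (ZMod c)ˣ) : ZMod c) = 0) <;>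
    simp [h1, h2, sq]
  exact_mod_cast h

theorem card_fourthMomentSet_le :
    (fourthMomentSet c).card ≤ 2 * (c * c.divisors.card) ^ 2 := by
  have h2 : annCard c (2 : ZMod c) ≤ 2 := by
    have := annCard_eq_gcd (c := c) 2
    push_cast at this
    rw [this]; exact Nat.gcd_le_right _ (by norm_num)
  let S : Finset (ZMod c × ZMod c × ZMod c) :=
    Finset.univ.filter fun t => (2 * (t.1 * t.2.1)) * t.2.2 = t.1 * t.2.1 * (t.1 + t.2.1)
  have hS : (fourthMomentSet c).card ≤ S.card := by
    apply Finset.card_le_card_of_injOn (fun u => ((u.2.2.1 : ZMod c) - u.1,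
      (u.2.2.1 : ZMod c) - u.2.1, (u.2.2.1 : ZMod c)))
    · rintro ⟨u1, u2, u3, u4⟩ hu
      simp only [fourthMomentSet, Finset.coe_filter, Finset.mem_univ, true_and,
        Set.mem_ofPred_eq] at hu
      obtain ⟨hs, hr⟩ := hu
      simp only [S, Finset.coe_filter, Finset.mem_univ, true_and, Set.mem_ofPred_eq]
      have e1 : (u1 : ZMod c) * ((u1⁻¹ : (ZMod c)ˣ) : ZMod c) = 1 := by simp
      have e2 : (u2 : ZMod c) * ((u2⁻¹ : (ZMod c)ˣ) : ZMod c) = 1 := by simp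
      have e3 : (u3 : ZMod c) * ((u3⁻¹ : (ZMod c)ˣ) : ZMod c) = 1 := by simp
      have e4 : (u4 : ZMod c) * ((u4⁻¹ : (ZMod c)ˣ) : ZMod c) = 1 := by simp
      generalize ((u1⁻¹ : (ZMod c)ˣ) : ZMod c) = v1 at *
      generalize ((u2⁻¹ : (ZMod c)ˣ) : ZMod c) = v2 at *
      generalize ((u3⁻¹ : (ZMod c)ˣ) : ZMod c) = v3 at *
      generalize ((u4⁻¹ : (ZMod c)ˣ) : ZMod c) = v4 at *
      generalize (u1 : ZMod c) = x1 at *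
      generalize (u2 : ZMod c) = x2 at *
      generalize (u3 : ZMod c) = x3 at *
      generalize (u4 : ZMod c) = x4 at *
      have h4 : x4 = x1 + x2 - x3 := by linear_combination -hs
      have hk : (x1 + x2) * x3 * x4 - (x3 + x4) * x1 * x2 = 0 := by
        linear_combination (x1 * x2 * x3 * x4) * hr - x2 * x3 * x4 * e1 - x1 * x3 * x4 * e2
          + x1 * x2 * x4 * e3 + x1 * x2 * x3 * e4
      subst h4
      linear_combination -hk
    · rintro ⟨u1, u2, u3, u4⟩ hu ⟨w1, w2, w3, w4⟩ hw h
      simp only [fourthMomentSet, Finset.coe_filter, Finset.mem_univ, true_and,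
        Set.mem_ofPred_eq] at hu hw
      simp only [Prod.mk.injEq] at h ⊢
      obtain ⟨ha, hb, hc⟩ := h
      have h1 : (u1 : ZMod c) = w1 := by linear_combination hc - ha
      have h2 : (u2 : ZMod c) = w2 := by linear_combination hc - hb
      have h4 : (u4 : ZMod c) = w4 := by linear_combination h1 + h2 - hc - hu.1 + hw.1
      exact ⟨Units.ext h1, Units.ext h2, Units.ext hc, Units.ext h4⟩
  refine hS.trans ?_
  have hS2 : S.card = ∑ a : ZMod c, ∑ b : ZMod c, (Finset.univ.filter fun x : ZMod c =>
      (2 * (a * b)) * x = a * b * (a + b)).card := by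
    simp only [S, Finset.card_filter, Fintype.sum_prod_type]
  rw [hS2]
  calc _ ≤ ∑ a : ZMod c, ∑ b : ZMod c, 2 * (annCard c a * annCard c b) := by
        refine Finset.sum_le_sum fun a _ => Finset.sum_le_sum fun b _ => ?_
        calc _ ≤ annCard c (2 * (a * b)) := card_filter_mul_eq_le _ _
          _ ≤ annCard c (a * b) * annCard c 2 := annCard_mul_le _ _
          _ ≤ (annCard c b * annCard c a) * 2 := Nat.mul_le_mul (annCard_mul_le _ _) h2
          _ = _ := by ring
    _ = 2 * (∑ a : ZMod c, annCard c a) ^ 2 := by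
        simp_rw [← Finset.mul_sum, ← Finset.sum_mul]; ring
    _ ≤ _ := by gcongr; exact sum_annCard_le

theorem le_totient_mul_card_divisors : c ≤ c.totient * c.divisors.card := by
  calc c = ∑ e ∈ c.divisors, e.totient := (Nat.sum_totient c).symm
    _ ≤ ∑ _e ∈ c.divisors, c.totient := by
        apply Finset.sum_le_sum
        intro e he
        exact Nat.le_of_dvd (Nat.totient_pos.mpr (NeZero.pos c))
          (Nat.totient_dvd_of_dvd (Nat.mem_divisors.mp he).1)
    _ = _ := by simp [mul_comm]

theorem kloosterman_swap (m n : ZMod c) : kloosterman m n = kloosterman n m := by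
  unfold kloosterman
  rw [← Equiv.sum_comp (Equiv.inv (ZMod c)ˣ)]
  refine Finset.sum_congr rfl fun u _ => ?_
  simp [add_comm]

theorem kloosterman_mul_unit (m n : ZMod c) (w : (ZMod c)ˣ) :
    kloosterman (m * (w : ZMod c)) (n * ((w⁻¹ : (ZMod c)ˣ) : ZMod c)) = kloosterman m n := by
  unfold kloosterman
  rw [← Equiv.sum_comp (Equiv.mulLeft w⁻¹)]
  refine Finset.sum_congr rfl fun u _ => ?_
  congr 1
  have : (w : ZMod c) * ((w⁻¹ : (ZMod c)ˣ) : ZMod c) = 1 := by simp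
  simp only [Equiv.coe_mulLeft, Units.val_mul, _root_.mul_inv_rev, inv_inv]
  linear_combination (m * u + n * ((u⁻¹ : (ZMod c)ˣ) : ZMod c)) * this

/-- Kloosterman's fourth moment bound. -/
theorem norm_kloosterman_pow_four_le (m n : ZMod c) :
    ‖kloosterman m n‖ ^ 4 ≤ 2 * (c : ℝ) ^ 3 * (c.divisors.card : ℝ) ^ 3 * annCard c m := by
  have hc : (0 : ℝ) < c := by exact_mod_cast NeZero.pos c
  have h1 : (c.totient : ℝ) * ‖kloosterman m n‖ ^ 4 ≤
      annCard c m * ((c : ℝ) ^ 2 * (fourthMomentSet c).card) := by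
    rw [← sum_norm_kloosterman_pow_four]
    calc (c.totient : ℝ) * ‖kloosterman m n‖ ^ 4
        = ∑ w : (ZMod c)ˣ, ‖kloosterman (m * (w : ZMod c)) (n * ((w⁻¹ : (ZMod c)ˣ) : ZMod c))‖ ^ 4 := by
          simp_rw [kloosterman_mul_unit]
          rw [Finset.sum_const, Finset.card_univ, ZMod.card_units_eq_totient, nsmul_eq_mul]
      _ ≤ ∑ w : (ZMod c)ˣ, ∑ k : ZMod c, ‖kloosterman (m * (w : ZMod c)) k‖ ^ 4 := by
          refine Finset.sum_le_sum fun w _ => ?_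
          exact Finset.single_le_sum (f := fun k => ‖kloosterman (m * (w : ZMod c)) k‖ ^ 4)
            (fun k _ => by positivity) (Finset.mem_univ _)
      _ = ∑ l : ZMod c, ∑ w ∈ Finset.univ.filter (fun w : (ZMod c)ˣ => m * w = l),
            ∑ k : ZMod c, ‖kloosterman (m * (w : ZMod c)) k‖ ^ 4 :=
          (Finset.sum_fiberwise _ _ _).symm
      _ ≤ ∑ l : ZMod c, annCard c m * ∑ k : ZMod c, ‖kloosterman l k‖ ^ 4 := by
          refine Finset.sum_le_sum fun l _ => ?_
          have : ∀ w ∈ Finset.univ.filter (fun w : (ZMod c)ˣ => m * w = l),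
              ∑ k : ZMod c, ‖kloosterman (m * (w : ZMod c)) k‖ ^ 4 = ∑ k : ZMod c, ‖kloosterman l k‖ ^ 4 := by
            intro w hw
            rw [(Finset.mem_filter.mp hw).2]
          rw [Finset.sum_congr rfl this, Finset.sum_const, nsmul_eq_mul]
          have hcard : (Finset.univ.filter (fun w : (ZMod c)ˣ => m * w = l)).card
              ≤ annCard c m := by
            refine le_trans ?_ (card_filter_mul_eq_le m l)
            apply Finset.card_le_card_of_injOn (fun w : (ZMod c)ˣ => (w : ZMod c))
            · intro w hw
              simpa using hw
            · intro w _ v _ h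
              exact Units.ext h
          gcongr
      _ = _ := by rw [Finset.mul_sum]
  have h2 : ((fourthMomentSet c).card : ℝ) ≤ 2 * ((c : ℝ) * c.divisors.card) ^ 2 := by
    exact_mod_cast card_fourthMomentSet_le
  have h3 : (c : ℝ) ≤ c.totient * c.divisors.card := by
    exact_mod_cast le_totient_mul_card_divisors
  have h4 : (c : ℝ) * ‖kloosterman m n‖ ^ 4 ≤
      c * (2 * (c : ℝ) ^ 3 * (c.divisors.card : ℝ) ^ 3 * annCard c m) := by
    calc (c : ℝ) * ‖kloosterman m n‖ ^ 4
        ≤ (c.totient * c.divisors.card) * ‖kloosterman m n‖ ^ 4 := by gcongr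
      _ = c.divisors.card * (c.totient * ‖kloosterman m n‖ ^ 4) := by ring
      _ ≤ c.divisors.card * (annCard c m * ((c : ℝ) ^ 2 * (fourthMomentSet c).card)) := by gcongr
      _ ≤ c.divisors.card * (annCard c m * ((c : ℝ) ^ 2 * (2 * ((c : ℝ) * c.divisors.card) ^ 2))) := by
          gcongr
      _ = _ := by ring
  exact le_of_mul_le_mul_left h4 hc

end Kloosterman

section Equidistribution

variable {c : ℕ} [NeZero c]

/-- The exponential sum over an interval of length `L` starting at `x`. -/
def intervalSum (x : ZMod c) (L : ℕ) (m : ZMod c) : ℂ :=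
  ∑ i ∈ Finset.range L, (ZMod.stdAddChar (m * (x + (i : ZMod c))) : ℂ)

/-- The number of solutions of `(x + i) (y + j) = κ` in `ZMod c` with `i < L`, `j < M`. -/
def hyperbolaCount (κ x y : ZMod c) (L M : ℕ) : ℕ :=
  ((Finset.range L ×ˢ Finset.range M).filter
    fun p : ℕ × ℕ => (x + (p.1 : ZMod c)) * (y + (p.2 : ZMod c)) = κ).card

theorem sum_zmod_eq_sum_range {R : Type*} [AddCommMonoid R] (F : ZMod c → R) :
    ∑ m : ZMod c, F m = ∑ k ∈ Finset.range c, F (k : ZMod c) := by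
  refine Finset.sum_nbij' (fun m => m.val) (fun k => (k : ZMod c)) ?_ ?_ ?_ ?_ ?_
  · intro m _; exact Finset.mem_range.mpr (ZMod.val_lt m)
  · intro k _; exact Finset.mem_univ _
  · intro m _; simp
  · intro k hk; exact ZMod.val_cast_of_lt (Finset.mem_range.mp hk)
  · intro m _; simp

theorem hyperbolaCount_eq_sum (κ : (ZMod c)ˣ) (x y : ZMod c) (L M : ℕ) :
    (c : ℂ) ^ 2 * hyperbolaCount (κ : ZMod c) x y L M =
      ∑ m : ZMod c, ∑ n : ZMod c,
        intervalSum x L m * intervalSum y M n * kloosterman (-m * (κ : ZMod c)) (-n) := by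
  have hind : ∀ X Y : ZMod c, ((if X * Y = (κ : ZMod c) then 1 else 0 : ℂ)) * (c : ℂ) ^ 2 =
      ∑ u : (ZMod c)ˣ, (∑ m : ZMod c, (ZMod.stdAddChar (m * (X - (κ : ZMod c) * (u : ZMod c))) : ℂ)) *
        (∑ n : ZMod c, (ZMod.stdAddChar (n * (Y - ((u⁻¹ : (ZMod c)ˣ) : ZMod c))) : ℂ)) := by
    intro X Y
    simp_rw [sum_stdAddChar_mul, sub_eq_zero]
    by_cases h : X * Y = (κ : ZMod c)
    · have hY : IsUnit Y := by
        have : IsUnit (X * Y) := h ▸ κ.isUnit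
        exact isUnit_of_mul_isUnit_right this
      obtain ⟨v, rfl⟩ := hY
      have hX : X = (κ : ZMod c) * ((v⁻¹ : (ZMod c)ˣ) : ZMod c) := by
        rw [← h, mul_assoc]; simp
      rw [Finset.sum_eq_single v⁻¹]
      · simp [hX, sq]
      · intro u _ hu
        have : (v : ZMod c) ≠ ((u⁻¹ : (ZMod c)ˣ) : ZMod c) := by
          intro h'
          apply hu
          rw [Units.ext h', inv_inv]
        simp [this]
      · simp
    · rw [if_neg h, zero_mul]
      symm
      apply Finset.sum_eq_zero
      intro u _
      by_cases h1 : X = (κ : ZMod c) * (u : ZMod c)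
      · by_cases h2 : Y = ((u⁻¹ : (ZMod c)ˣ) : ZMod c)
        · exfalso; apply h; rw [h1, h2, mul_assoc]; simp
        · simp [h2]
      · simp [h1]
  rw [hyperbolaCount, Finset.card_filter]
  push_cast
  rw [mul_comm, Finset.sum_mul]
  simp_rw [hind]
  have hR : ∀ m n : ZMod c,
      intervalSum x L m * intervalSum y M n * kloosterman (-m * (κ : ZMod c)) (-n) =
      ∑ p ∈ Finset.range L ×ˢ Finset.range M, ∑ u : (ZMod c)ˣ,
        (ZMod.stdAddChar (m * (x + (p.1 : ZMod c) - (κ : ZMod c) * (u : ZMod c))) : ℂ) *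
        (ZMod.stdAddChar (n * (y + (p.2 : ZMod c) - ((u⁻¹ : (ZMod c)ˣ) : ZMod c))) : ℂ) := by
    intro m n
    unfold intervalSum kloosterman
    rw [Finset.sum_mul_sum, ← Finset.sum_product', Finset.sum_mul]
    refine Finset.sum_congr rfl fun p _ => ?_
    rw [Finset.mul_sum]
    refine Finset.sum_congr rfl fun u _ => ?_
    simp_rw [← AddChar.map_add_eq_mul]
    congr 1; ring
  simp_rw [hR, Finset.sum_mul_sum]
  rw [Finset.sum_comm]
  conv_rhs =>
    enter [2, m]
    rw [Finset.sum_comm]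
  rw [Finset.sum_comm]
  conv_rhs => rw [Finset.sum_comm]
  refine Finset.sum_congr rfl fun p _ => ?_
  conv_rhs =>
    enter [2, m]
    rw [Finset.sum_comm]
  rw [Finset.sum_comm]

theorem norm_intervalSum_le_of_ne_zero (x : ZMod c) (L k : ℕ) (hk : 0 < k) (hkc : k < c) :
    ‖intervalSum x L (k : ZMod c)‖ ≤ (c : ℝ) / (2 * k) + (c : ℝ) / (2 * (c - k : ℕ)) := by
  have hc : (0 : ℝ) < c := by exact_mod_cast NeZero.pos c
  have hk' : (0 : ℝ) < k := by exact_mod_cast hk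
  have hck : (0 : ℝ) < (c - k : ℕ) := by exact_mod_cast Nat.sub_pos_of_lt hkc
  have hck' : ((c - k : ℕ) : ℝ) = c - k := by rw [Nat.cast_sub hkc.le]
  set z : ℂ := ZMod.stdAddChar (k : ZMod c) with hz
  have hzn : ‖z‖ = 1 := by
    rw [hz, ZMod.stdAddChar_apply]; exact Circle.norm_coe _
  have hz1 : ‖z - 1‖ = 2 * Real.sin (Real.pi * k / c) := by
    have h := ZMod.stdAddChar_coe (N := c) (k : ℤ)
    push_cast at h
    have h' : z = Complex.exp (Complex.I * ((2 * Real.pi * k / c : ℝ) : ℂ)) := by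
      rw [hz, h]; congr 1; push_cast; ring
    rw [h', Complex.norm_exp_I_mul_ofReal_sub_one, Real.norm_of_nonneg]
    · congr 2; ring
    · have : 0 ≤ Real.sin (2 * Real.pi * k / c / 2) := by
        apply Real.sin_nonneg_of_nonneg_of_le_pi
        · positivity
        · rw [show 2 * Real.pi * k / c / 2 = Real.pi * (k / c) by ring]
          have : (k : ℝ) / c ≤ 1 := by
            rw [div_le_one hc]; exact_mod_cast hkc.le
          nlinarith [Real.pi_pos]
      positivity
  have hsin : min (2 * (k : ℝ) / c) (2 * (c - k : ℕ) / c) ≤ Real.sin (Real.pi * k / c) := by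
    rcases le_total (2 * k) c with h | h
    · refine (min_le_left _ _).trans ?_
      have := Real.mul_le_sin (x := Real.pi * k / c) (by positivity) (by
        rw [div_le_div_iff₀ hc (by norm_num)]
        have : (2 * k : ℝ) ≤ c := by exact_mod_cast h
        nlinarith [Real.pi_pos])
      calc _ = 2 / Real.pi * (Real.pi * k / c) := by field_simp
        _ ≤ _ := this
    · refine (min_le_right _ _).trans ?_
      have := Real.mul_le_sin (x := Real.pi * (c - k : ℕ) / c) (by positivity) (by
        rw [div_le_div_iff₀ hc (by norm_num), hck']
        have : (c : ℝ) ≤ 2 * k := by exact_mod_cast h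
        nlinarith [Real.pi_pos])
      calc _ = 2 / Real.pi * (Real.pi * (c - k : ℕ) / c) := by field_simp
        _ ≤ _ := this
        _ = Real.sin (Real.pi - Real.pi * k / c) := by
            rw [hck']; congr 1; field_simp
        _ = _ := Real.sin_pi_sub _
  have hpos : 0 < min (2 * (k : ℝ) / c) (2 * (c - k : ℕ) / c) := by positivity
  have hsinpos := hpos.trans_le hsin
  have hz0 : z ≠ 1 := by
    intro h
    rw [h, sub_self, norm_zero] at hz1
    linarith
  have hsum : intervalSum x L (k : ZMod c)
      = (ZMod.stdAddChar ((k : ZMod c) * x) : ℂ) * ((z ^ L - 1) / (z - 1)) := by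
    rw [← geom_sum_eq hz0, intervalSum, Finset.mul_sum]
    refine Finset.sum_congr rfl fun i _ => ?_
    rw [mul_add, AddChar.map_add_eq_mul, hz, ← AddChar.map_nsmul_eq_pow]
    congr 2
    rw [nsmul_eq_mul, mul_comm]
  have hn1 : ‖(ZMod.stdAddChar ((k : ZMod c) * x) : ℂ)‖ = 1 := by
    rw [ZMod.stdAddChar_apply]; exact Circle.norm_coe _
  rw [hsum, norm_mul, hn1, one_mul, norm_div, hz1]
  have hnum : ‖z ^ L - 1‖ ≤ 2 := by
    calc _ ≤ ‖z ^ L‖ + ‖(1 : ℂ)‖ := norm_sub_le _ _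
      _ = 2 := by rw [norm_pow, hzn]; norm_num
  calc ‖z ^ L - 1‖ / (2 * Real.sin (Real.pi * k / c))
      ≤ 2 / (2 * min (2 * (k : ℝ) / c) (2 * (c - k : ℕ) / c)) := by gcongr
    _ = (min (2 * (k : ℝ) / c) (2 * (c - k : ℕ) / c))⁻¹ := by field_simp
    _ ≤ (c : ℝ) / (2 * k) + (c : ℝ) / (2 * (c - k : ℕ)) := by
        rcases min_choice (2 * (k : ℝ) / c) (2 * (c - k : ℕ) / c) with h | h <;> rw [h, inv_div]
        · have : 0 ≤ (c : ℝ) / (2 * (c - k : ℕ)) := by positivity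
          linarith
        · have : 0 ≤ (c : ℝ) / (2 * k) := by positivity
          linarith

theorem sum_gcd_div_le :
    ∑ k ∈ Finset.Ioo 0 c, ((c.gcd k : ℝ) / k) ≤ c.divisors.card * (1 + Real.log c) := by
  have hH : ((harmonic c : ℚ) : ℝ) ≤ 1 + Real.log c := harmonic_le_one_add_log c
  calc ∑ k ∈ Finset.Ioo 0 c, ((c.gcd k : ℝ) / k)
      ≤ ∑ k ∈ Finset.Ioo 0 c, ∑ e ∈ c.divisors, (if e ∣ k then (e : ℝ) / k else 0) := by
        refine Finset.sum_le_sum fun k _ => ?_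
        have h := Finset.single_le_sum (s := c.divisors)
          (f := fun e => (if e ∣ k then (e : ℝ) / k else 0))
          (fun e _ => by split_ifs <;> positivity)
          (Nat.mem_divisors.mpr ⟨Nat.gcd_dvd_left c k, NeZero.ne c⟩)
        simpa [Nat.gcd_dvd_right] using h
    _ = ∑ e ∈ c.divisors, ∑ k ∈ Finset.Ioo 0 c, (if e ∣ k then (e : ℝ) / k else 0) :=
        Finset.sum_comm
    _ ≤ ∑ e ∈ c.divisors, ((harmonic c : ℚ) : ℝ) := by
        refine Finset.sum_le_sum fun e he => ?_
        have he0 : 0 < e := Nat.pos_of_mem_divisors he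
        rw [← Finset.sum_filter, harmonic]
        push_cast
        calc _ = ∑ k ∈ (Finset.Ioo 0 c).filter (fun k => e ∣ k), (((k / e - 1 : ℕ) : ℝ) + 1)⁻¹ := by
              refine Finset.sum_congr rfl fun k hk => ?_
              obtain ⟨hk1, r, rfl⟩ := Finset.mem_filter.mp hk
              have hr : 0 < r := Nat.pos_of_mul_pos_left (Finset.mem_Ioo.mp hk1).1
              rw [Nat.mul_div_cancel_left _ he0, Nat.cast_sub hr]
              push_cast
              have : (e : ℝ) ≠ 0 := by positivity
              rw [sub_add_cancel, div_mul_cancel_left₀ this]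
          _ = ∑ i ∈ ((Finset.Ioo 0 c).filter (fun k => e ∣ k)).image (fun k => k / e - 1),
                ((i : ℝ) + 1)⁻¹ := by
              rw [Finset.sum_image]
              intro k hk l hl h
              obtain ⟨hk1, r, rfl⟩ := Finset.mem_filter.mp hk
              obtain ⟨hl1, s, rfl⟩ := Finset.mem_filter.mp hl
              have hr : 0 < r := Nat.pos_of_mul_pos_left (Finset.mem_Ioo.mp hk1).1
              have hs : 0 < s := Nat.pos_of_mul_pos_left (Finset.mem_Ioo.mp hl1).1
              simp only [Nat.mul_div_cancel_left _ he0] at h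
              congr 1; omega
          _ ≤ ∑ i ∈ Finset.range c, ((i : ℝ) + 1)⁻¹ := by
              apply Finset.sum_le_sum_of_subset_of_nonneg
              · intro i hi
                obtain ⟨k, hk, rfl⟩ := Finset.mem_image.mp hi
                have hk1 := Finset.mem_Ioo.mp (Finset.mem_filter.mp hk).1
                have := Nat.div_le_self k e
                exact Finset.mem_range.mpr (by omega)
              · intro i _ _; positivity
    _ = c.divisors.card * ((harmonic c : ℚ) : ℝ) := by simp
    _ ≤ _ := by gcongr

end Equidistribution

section Equidistribution

variable {c : ℕ} [NeZero c]

theorem one_le_annCard (m : ZMod c) : 1 ≤ annCard c m :=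
  Finset.card_pos.mpr ⟨0, by simp⟩

theorem annCard_neg_mul_unit (m : ZMod c) (u : (ZMod c)ˣ) :
    annCard c (-m * (u : ZMod c)) = annCard c m := by
  unfold annCard
  refine Finset.card_bij' (fun x _ => (u : ZMod c) * x)
    (fun x _ => ((u⁻¹ : (ZMod c)ˣ) : ZMod c) * x) ?_ ?_ ?_ ?_
  · intro x hx
    simp only [Finset.mem_filter, Finset.mem_univ, true_and] at hx ⊢
    rw [← mul_assoc, ← neg_eq_zero, ← hx]; ring
  · intro x hx
    simp only [Finset.mem_filter, Finset.mem_univ, true_and] at hx ⊢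
    rw [show -m * (u : ZMod c) * (((u⁻¹ : (ZMod c)ˣ) : ZMod c) * x)
      = -(m * x) * ((u : ZMod c) * ((u⁻¹ : (ZMod c)ˣ) : ZMod c)) by ring, hx]
    simp
  · intro x _; simp
  · intro x _; simp

/-- The weight used to dominate Kloosterman sums. -/
def klWeight (m : ZMod c) : ℝ := if m = 0 then 1 else annCard c m

theorem one_le_klWeight (m : ZMod c) : 1 ≤ klWeight m := by
  unfold klWeight
  split_ifs
  · exact le_rfl
  · exact_mod_cast one_le_annCard m

theorem norm_kloosterman_le {D : ℝ} (hD1 : 1 ≤ D) (hD : (c.divisors.card : ℝ) ≤ D)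
    (u : (ZMod c)ˣ) (m n : ZMod c) (h : m ≠ 0 ∨ n ≠ 0) :
    ‖kloosterman (-m * (u : ZMod c)) (-n)‖ ≤
      2 * D * (c : ℝ) ^ (3 / 4 : ℝ) * (klWeight m * klWeight n) := by
  have hc : (0 : ℝ) < c := by exact_mod_cast NeZero.pos c
  have key : ∀ (a b : ZMod c) (w : ℝ), 1 ≤ w → (annCard c a : ℝ) ≤ w →
      ‖kloosterman a b‖ ≤ 2 * D * (c : ℝ) ^ (3 / 4 : ℝ) * w := by
    intro a b w hw haw
    refine le_of_pow_le_pow_left₀ (n := 4) (by norm_num) (by positivity) ?_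
    have hc4 : ((c : ℝ) ^ (3 / 4 : ℝ)) ^ 4 = (c : ℝ) ^ 3 := by
      rw [← Real.rpow_natCast, ← Real.rpow_mul hc.le, ← Real.rpow_natCast]
      norm_num
    calc _ ≤ 2 * (c : ℝ) ^ 3 * (c.divisors.card : ℝ) ^ 3 * annCard c a :=
          norm_kloosterman_pow_four_le a b
      _ ≤ 2 * (c : ℝ) ^ 3 * D ^ 3 * w := by gcongr
      _ ≤ 16 * (c : ℝ) ^ 3 * D ^ 4 * w ^ 4 := by
          have h1 : D ^ 3 ≤ D ^ 4 := pow_le_pow_right₀ hD1 (by norm_num)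
          have h2 : w ≤ w ^ 4 := le_self_pow₀ hw (by norm_num)
          gcongr
          norm_num
      _ = _ := by rw [mul_pow, mul_pow, hc4]; ring
  have hm := one_le_klWeight m
  have hn := one_le_klWeight n
  by_cases h0 : m = 0
  · have hn0 : n ≠ 0 := by tauto
    rw [kloosterman_swap]
    apply key _ _ _ (by nlinarith)
    have h1 : annCard c (-n) = annCard c n := by simpa using annCard_neg_mul_unit n 1
    rw [h1]
    have : (annCard c n : ℝ) = klWeight n := by simp [klWeight, hn0]
    nlinarith
  · apply key _ _ _ (by nlinarith)
    rw [annCard_neg_mul_unit]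
    have : (annCard c m : ℝ) = klWeight m := by simp [klWeight, h0]
    nlinarith

theorem sum_norm_intervalSum_le (x : ZMod c) (L : ℕ) (hL : L ≤ c) :
    ∑ m : ZMod c, ‖intervalSum x L m‖ * klWeight m ≤
      c * (1 + c.divisors.card * (1 + Real.log c)) := by
  have hc : 0 < c := NeZero.pos c
  rw [sum_zmod_eq_sum_range (fun m => ‖intervalSum x L m‖ * klWeight m), Finset.range_eq_Ico,
    ← Finset.sum_Ioo_add_eq_sum_Ico (f := fun k : ℕ => ‖intervalSum x L (k : ZMod c)‖ * klWeight (k : ZMod c)) hc]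
  have h0 : ‖intervalSum x L ((0 : ℕ) : ZMod c)‖ * klWeight ((0 : ℕ) : ZMod c) ≤ c := by
    simp [intervalSum, klWeight]; exact_mod_cast hL
  have hrefl : ∑ k ∈ Finset.Ioo 0 c, ((c.gcd k : ℝ) / ((c - k : ℕ) : ℝ))
      = ∑ k ∈ Finset.Ioo 0 c, ((c.gcd k : ℝ) / k) := by
    refine Finset.sum_nbij' (fun k => c - k) (fun k => c - k) ?_ ?_ ?_ ?_ ?_
    · intro k hk; rw [Finset.mem_Ioo] at *; omega
    · intro k hk; rw [Finset.mem_Ioo] at *; omega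
    · intro k hk; rw [Finset.mem_Ioo] at *; omega
    · intro k hk; rw [Finset.mem_Ioo] at *; omega
    · intro k hk
      rw [Finset.mem_Ioo] at hk
      rw [Nat.gcd_self_sub_right hk.2.le]
  have h1 : ∑ k ∈ Finset.Ioo 0 c, ‖intervalSum x L (k : ZMod c)‖ * klWeight (k : ZMod c)
      ≤ c * ∑ k ∈ Finset.Ioo 0 c, ((c.gcd k : ℝ) / k) := by
    calc _ ≤ ∑ k ∈ Finset.Ioo 0 c, (c : ℝ) / 2 * ((c.gcd k : ℝ) / k + (c.gcd k : ℝ) / ((c - k : ℕ) : ℝ)) := by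
          refine Finset.sum_le_sum fun k hk => ?_
          rw [Finset.mem_Ioo] at hk
          have hk0 : (k : ZMod c) ≠ 0 := by
            rw [Ne, ZMod.natCast_eq_zero_iff]
            exact Nat.not_dvd_of_pos_of_lt hk.1 hk.2
          have hkl : klWeight (k : ZMod c) = c.gcd k := by
            simp [klWeight, hk0, annCard_eq_gcd]
          have h2 := norm_intervalSum_le_of_ne_zero x L k hk.1 hk.2
          rw [hkl]
          calc _ ≤ ((c : ℝ) / (2 * k) + (c : ℝ) / (2 * (c - k : ℕ))) * c.gcd k := by gcongr
            _ = _ := by ring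
      _ = _ := by
          rw [← Finset.mul_sum, Finset.sum_add_distrib, hrefl]; ring
  have h2 := sum_gcd_div_le (c := c)
  have h3 := mul_le_mul_of_nonneg_left h2 (Nat.cast_nonneg (α := ℝ) c)
  linarith

theorem abs_hyperbolaCount_sub_le_aux {D : ℝ} (hD1 : 1 ≤ D) (hD : (c.divisors.card : ℝ) ≤ D)
    (κ : (ZMod c)ˣ) (x y : ZMod c) (L M : ℕ) (hL : L ≤ c) (hM : M ≤ c) :
    |(hyperbolaCount (κ : ZMod c) x y L M : ℝ) - (L : ℝ) * M * c.totient / (c : ℝ) ^ 2| ≤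
      2 * D * (c : ℝ) ^ (3 / 4 : ℝ) * (1 + c.divisors.card * (1 + Real.log c)) ^ 2 := by
  have hc : (0 : ℝ) < c := by exact_mod_cast NeZero.pos c
  have hlog : 0 ≤ Real.log c := Real.log_natCast_nonneg c
  have hmain : intervalSum x L 0 * intervalSum y M 0 * kloosterman (-0 * (κ : ZMod c)) (-0)
      = (L : ℂ) * M * c.totient := by
    simp [intervalSum, kloosterman, ZMod.card_units_eq_totient]
  have hkey : (c : ℂ) ^ 2 * hyperbolaCount (κ : ZMod c) x y L M - (L : ℂ) * M * c.totient =
      ∑ m : ZMod c, ∑ n : ZMod c, if m ≠ 0 ∨ n ≠ 0 then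
        intervalSum x L m * intervalSum y M n * kloosterman (-m * (κ : ZMod c)) (-n) else 0 := by
    rw [hyperbolaCount_eq_sum, ← hmain, ← Finset.sum_product', ← Finset.sum_product',
      Finset.univ_product_univ,
      ← Finset.sum_erase_add _ _ (Finset.mem_univ ((0 : ZMod c), (0 : ZMod c))),
      add_sub_cancel_right, ← Finset.sum_erase_add (f := fun p : ZMod c × ZMod c =>
        if p.1 ≠ 0 ∨ p.2 ≠ 0 then _ else _) _ (Finset.mem_univ ((0 : ZMod c), (0 : ZMod c)))]
    simp only [ne_eq, not_true_eq_false, or_self, if_false, add_zero]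
    refine Finset.sum_congr rfl fun p hp => ?_
    rw [if_pos]
    rw [← not_and_or]
    rintro ⟨h1, h2⟩
    exact (Finset.mem_erase.mp hp).1 (Prod.ext h1 h2)
  have hbound : ‖(c : ℂ) ^ 2 * hyperbolaCount (κ : ZMod c) x y L M - (L : ℂ) * M * c.totient‖ ≤
      2 * D * (c : ℝ) ^ (3 / 4 : ℝ) * (c * (1 + c.divisors.card * (1 + Real.log c))) ^ 2 := by
    rw [hkey]
    calc _ ≤ ∑ m : ZMod c, ∑ n : ZMod c, 2 * D * (c : ℝ) ^ (3 / 4 : ℝ) *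
            ((‖intervalSum x L m‖ * klWeight m) * (‖intervalSum y M n‖ * klWeight n)) := by
          refine (norm_sum_le _ _).trans (Finset.sum_le_sum fun m _ => ?_)
          refine (norm_sum_le _ _).trans (Finset.sum_le_sum fun n _ => ?_)
          have hm := one_le_klWeight m
          have hn := one_le_klWeight n
          split_ifs with h
          · rw [norm_mul, norm_mul]
            calc _ ≤ ‖intervalSum x L m‖ * ‖intervalSum y M n‖ *
                (2 * D * (c : ℝ) ^ (3 / 4 : ℝ) * (klWeight m * klWeight n)) := by
                  gcongr
                  exact norm_kloosterman_le hD1 hD κ m n h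
              _ = _ := by ring
          · rw [norm_zero]; positivity
      _ = 2 * D * (c : ℝ) ^ (3 / 4 : ℝ) * ((∑ m : ZMod c, ‖intervalSum x L m‖ * klWeight m) *
            (∑ n : ZMod c, ‖intervalSum y M n‖ * klWeight n)) := by
          rw [Finset.sum_mul_sum, Finset.mul_sum]
          simp_rw [Finset.mul_sum]
      _ ≤ _ := by
          rw [sq (c * _ : ℝ)]
          have h1 := sum_norm_intervalSum_le x L hL
          have h2 := sum_norm_intervalSum_le y M hM
          have h3 : 0 ≤ ∑ n : ZMod c, ‖intervalSum y M n‖ * klWeight n :=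
            Finset.sum_nonneg fun n _ => mul_nonneg (norm_nonneg _)
              (zero_le_one.trans (one_le_klWeight n))
          gcongr
  have hcast : ‖(c : ℂ) ^ 2 * hyperbolaCount (κ : ZMod c) x y L M - (L : ℂ) * M * c.totient‖ =
      |(c : ℝ) ^ 2 * hyperbolaCount (κ : ZMod c) x y L M - (L : ℝ) * M * c.totient| := by
    rw [← Real.norm_eq_abs, ← Complex.norm_real]; push_cast; rfl
  rw [hcast] at hbound
  have h4 : (c : ℝ) ^ 2 * hyperbolaCount (κ : ZMod c) x y L M - (L : ℝ) * M * c.totient =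
      (c : ℝ) ^ 2 * ((hyperbolaCount (κ : ZMod c) x y L M : ℝ) - (L : ℝ) * M * c.totient / (c : ℝ) ^ 2) := by
    field_simp
  rw [h4, abs_mul, abs_of_pos (by positivity : (0 : ℝ) < (c : ℝ) ^ 2)] at hbound
  have hc2 : (0 : ℝ) < (c : ℝ) ^ 2 := by positivity
  refine le_of_mul_le_mul_left (hbound.trans (le_of_eq ?_)) hc2
  ring

end Equidistribution

theorem exists_abs_hyperbolaCount_sub_le : ∃ C : ℝ, 0 ≤ C ∧ ∀ (c : ℕ) [NeZero c] (κ : (ZMod c)ˣ)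
    (x y : ZMod c) (L M : ℕ), L ≤ c → M ≤ c →
    |(hyperbolaCount (κ : ZMod c) x y L M : ℝ) - (L : ℝ) * M * c.totient / (c : ℝ) ^ 2| ≤
      C * (c : ℝ) ^ (7 / 8 : ℝ) := by
  obtain ⟨C, hC1, hC⟩ := exists_card_divisors_le (1 / 40) (by norm_num)
  refine ⟨2 * C * (42 * C) ^ 2, by positivity, ?_⟩
  intro c _ κ x y L M hL hM
  have hc1 : (1 : ℝ) ≤ c := by exact_mod_cast NeZero.pos c
  have hc : (0 : ℝ) < c := by linarith
  have hce : (1 : ℝ) ≤ (c : ℝ) ^ (1 / 40 : ℝ) := Real.one_le_rpow hc1 (by norm_num)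
  have hD := hC c (NeZero.ne c)
  have hD1 : 1 ≤ C * (c : ℝ) ^ (1 / 40 : ℝ) := by nlinarith
  refine (abs_hyperbolaCount_sub_le_aux hD1 hD κ x y L M hL hM).trans ?_
  have hlog0 : 0 ≤ Real.log c := Real.log_natCast_nonneg c
  have hlog : Real.log c ≤ (c : ℝ) ^ (1 / 40 : ℝ) / (1 / 40) :=
    Real.log_le_rpow_div hc.le (by norm_num)
  set w := (c : ℝ) ^ (1 / 40 : ℝ) with hw
  have h1 : 1 + c.divisors.card * (1 + Real.log c) ≤ 42 * C * w ^ 2 := by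
    have : (c.divisors.card : ℝ) * (1 + Real.log c) ≤ (C * w) * (41 * w) := by
      gcongr
      linarith
    nlinarith
  calc _ ≤ 2 * (C * w) * (c : ℝ) ^ (3 / 4 : ℝ) * (42 * C * w ^ 2) ^ 2 := by gcongr
    _ = 2 * C * (42 * C) ^ 2 * ((c : ℝ) ^ (3 / 4 : ℝ) * w ^ 5) := by ring
    _ = _ := by
      congr 1
      rw [hw, ← Real.rpow_natCast, ← Real.rpow_mul hc.le, ← Real.rpow_add hc]
      norm_num

theorem exists_card_progression_box_sub_le : ∃ C : ℝ, 0 ≤ C ∧ ∀ (c : ℤ) (q l : ℕ) (a d : ℤ),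
    c ≠ 0 → IsCoprime c (q : ℤ) → l ≤ c.natAbs →
    |((((Finset.range l ×ˢ Finset.range l).filter
        fun p : ℕ × ℕ => c ∣ (a + q * p.1) * (d + q * p.2) - 1).card : ℕ) : ℝ)
      - (l : ℝ) ^ 2 * c.natAbs.totient / (c.natAbs : ℝ) ^ 2| ≤ C * (c.natAbs : ℝ) ^ (7 / 8 : ℝ) := by
  obtain ⟨C, hC0, hC⟩ := exists_abs_hyperbolaCount_sub_le
  refine ⟨C, hC0, ?_⟩
  intro c q l a d hc hq hl
  have : NeZero c.natAbs := ⟨Int.natAbs_ne_zero.mpr hc⟩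
  have hq' : Nat.Coprime q c.natAbs := by
    rw [Int.isCoprime_iff_gcd_eq_one, Int.gcd, Int.natAbs_natCast] at hq
    exact Nat.coprime_comm.mp hq
  set u : (ZMod c.natAbs)ˣ := ZMod.unitOfCoprime q hq' with hu
  have huq : (u : ZMod c.natAbs) = q := ZMod.coe_unitOfCoprime q hq'
  set v : ZMod c.natAbs := ((u⁻¹ : (ZMod c.natAbs)ˣ) : ZMod c.natAbs) with hv
  have huv : (q : ZMod c.natAbs) * v = 1 := by rw [← huq, hv]; simp
  have h := hC c.natAbs (u⁻¹ * u⁻¹) (v * a) (v * d) l l hl hl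
  rw [← sq (l : ℝ)] at h
  convert h using 4
  unfold hyperbolaCount
  congr 1
  refine Finset.filter_congr fun p _ => ?_
  rw [← Int.natAbs_dvd, ← ZMod.intCast_zmod_eq_zero_iff_dvd]
  push_cast
  rw [sub_eq_zero]
  have e1 : ∀ x i : ZMod c.natAbs, v * x + i = v * (x + q * i) := fun x i => by
    linear_combination (-i) * huv
  rw [e1, e1]
  rw [← hv]
  generalize ((a : ZMod c.natAbs) + q * p.1) = X
  generalize ((d : ZMod c.natAbs) + q * p.2) = Y
  constructor
  · intro h
    linear_combination (v * v) * h
  · intro h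
    linear_combination ((q : ZMod c.natAbs) * q) * h - (q * v + 1) * (X * Y - 1) * huv

/-- Matrices with lower left entry `c` whose diagonal lies in the box of side `H` with
indices `(i, j)` and in a fixed residue class modulo `q`. -/
def boxSet (q : ℕ) (H : ℤ) (r s : ZMod q) (c i j : ℤ) : Set SL2Z :=
  {γ | γ 1 0 = c ∧ γ 0 0 / H = i ∧ γ 1 1 / H = j ∧
    ((γ 0 0 : ℤ) : ZMod q) = r ∧ ((γ 1 1 : ℤ) : ZMod q) = s}

theorem SL2Z_det (γ : SL2Z) : γ 0 0 * γ 1 1 - γ 0 1 * γ 1 0 = 1 := by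
  rw [← Matrix.det_fin_two]; exact γ.det_coe

theorem SL2Z_ext {γ δ : SL2Z} (h00 : γ 0 0 = δ 0 0) (h01 : γ 0 1 = δ 0 1) (h10 : γ 1 0 = δ 1 0)
    (h11 : γ 1 1 = δ 1 1) : γ = δ := by
  ext i j; fin_cases i <;> fin_cases j <;> assumption

theorem SL2Z_ext_of_ne_zero {γ δ : SL2Z} (hc : γ 1 0 ≠ 0) (h00 : γ 0 0 = δ 0 0)
    (h10 : γ 1 0 = δ 1 0) (h11 : γ 1 1 = δ 1 1) : γ = δ := by
  refine SL2Z_ext h00 ?_ h10 h11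
  have h1 := SL2Z_det γ
  have h2 := SL2Z_det δ
  rw [← h00, ← h10, ← h11] at h2
  exact mul_right_cancel₀ hc (by linarith)

theorem exists_eq_residue_add {q l : ℕ} [NeZero q] (hl : 0 < l) (r : ZMod q) (a i : ℤ)
    (h1 : a / ((q * l : ℕ) : ℤ) = i) (h2 : (a : ZMod q) = r) :
    ∃ k < l, a = ((q * l : ℕ) : ℤ) * i + r.val + q * (k : ℕ) := by
  have hq : (0 : ℤ) < q := by exact_mod_cast NeZero.pos q
  have hH : (0 : ℤ) < ((q * l : ℕ) : ℤ) := by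
    push_cast; positivity
  obtain ⟨m, hm⟩ : (q : ℤ) ∣ a - r.val := by
    rw [← ZMod.intCast_zmod_eq_zero_iff_dvd]; simp [h2]
  have h3 := Int.emod_nonneg a hH.ne'
  have h4 := Int.emod_lt_of_pos a hH
  have h5 := Int.mul_ediv_add_emod a ((q * l : ℕ) : ℤ)
  have hr : (r.val : ℤ) < q := by exact_mod_cast ZMod.val_lt r
  rw [h1] at h5
  push_cast at *
  have h6 : (q : ℤ) * (m - l * i) > -q := by nlinarith
  have h7 : (q : ℤ) * (m - l * i) < q * l := by nlinarith
  have h8 : -1 < m - l * i := by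
    by_contra h; nlinarith
  have h9 : m - l * i < l := lt_of_mul_lt_mul_left h7 hq.le
  refine ⟨(m - l * i).toNat, by omega, ?_⟩
  rw [Int.toNat_of_nonneg (by omega)]
  linarith

theorem residue_add_ediv {q l : ℕ} [NeZero q] (r : ZMod q) (i : ℤ) (k : ℕ) (hk : k < l) :
    (((q * l : ℕ) : ℤ) * i + r.val + q * (k : ℕ)) / ((q * l : ℕ) : ℤ) = i := by
  have hq : 0 < q := NeZero.pos q
  have hr := ZMod.val_lt r
  have h1 : r.val + q * k < q * l := by nlinarith
  rw [add_assoc, Int.mul_add_ediv_left _ _ (by exact_mod_cast (show q * l ≠ 0 by omega))]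
  rw [Int.ediv_eq_zero_of_lt (by positivity) (by exact_mod_cast h1), add_zero]

/-- The bijection between points of the box and solutions of a congruence. -/
theorem boxSet_eq_image {q l : ℕ} [NeZero q] (hl : 0 < l) (r s : ZMod q) (c i j : ℤ) (hc : c ≠ 0) :
    (boxSet q (q * l : ℕ) r s c i j).Finite ∧ (boxSet q (q * l : ℕ) r s c i j).ncard =
      ((Finset.range l ×ˢ Finset.range l).filter fun p : ℕ × ℕ =>
        c ∣ ((((q * l : ℕ) : ℤ) * i + r.val) + q * p.1) *
          ((((q * l : ℕ) : ℤ) * j + s.val) + q * p.2) - 1).card := by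
  have hq : (0 : ℤ) < q := by exact_mod_cast NeZero.pos q
  set A : ℕ → ℤ := fun k => (((q * l : ℕ) : ℤ) * i + r.val) + q * k with hA
  set B : ℕ → ℤ := fun k => (((q * l : ℕ) : ℤ) * j + s.val) + q * k with hB
  set S := (Finset.range l ×ˢ Finset.range l).filter fun p : ℕ × ℕ => c ∣ A p.1 * B p.2 - 1 with hS
  have key : (boxSet q (q * l : ℕ) r s c i j).BijOn
      (fun γ => (((γ 0 0 - (((q * l : ℕ) : ℤ) * i + r.val)) / q).toNat,
        ((γ 1 1 - (((q * l : ℕ) : ℤ) * j + s.val)) / q).toNat)) (S : Set (ℕ × ℕ)) := by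
    refine ⟨?_, ?_, ?_⟩
    · rintro γ ⟨h1, h2, h3, h4, h5⟩
      obtain ⟨k, hk, hk'⟩ := exists_eq_residue_add hl r _ i h2 h4
      obtain ⟨m, hm, hm'⟩ := exists_eq_residue_add hl s _ j h3 h5
      have hdet := SL2Z_det γ
      rw [h1, hk', hm'] at hdet
      simp only [hk', hm', add_sub_cancel_left, Int.mul_ediv_cancel_left _ hq.ne', Int.toNat_natCast]
      simp only [hS, Finset.coe_filter, Finset.mem_product, Finset.mem_range]
      exact ⟨⟨hk, hm⟩, γ 0 1, by simp only [hA, hB]; linarith⟩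
    · rintro γ ⟨h1, h2, h3, h4, h5⟩ δ ⟨h1', h2', h3', h4', h5'⟩ h
      obtain ⟨k, hk, hk'⟩ := exists_eq_residue_add hl r _ i h2 h4
      obtain ⟨m, hm, hm'⟩ := exists_eq_residue_add hl s _ j h3 h5
      obtain ⟨k2, hk2, hk2'⟩ := exists_eq_residue_add hl r _ i h2' h4'
      obtain ⟨m2, hm2, hm2'⟩ := exists_eq_residue_add hl s _ j h3' h5'
      simp only [hk', hm', hk2', hm2', add_sub_cancel_left, Int.mul_ediv_cancel_left _ hq.ne',
        Int.toNat_natCast, Prod.mk.injEq] at h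
      refine SL2Z_ext_of_ne_zero (by rw [h1]; exact hc) ?_ (by rw [h1, h1']) ?_
      · rw [hk', hk2', h.1]
      · rw [hm', hm2', h.2]
    · rintro ⟨k, m⟩ hkm
      simp only [hS, Finset.coe_filter, Finset.mem_product, Finset.mem_range] at hkm
      obtain ⟨⟨hk, hm⟩, b, hb⟩ := hkm
      refine ⟨⟨!![A k, b; c, B m], by rw [Matrix.det_fin_two_of]; linarith⟩, ?_, ?_⟩
      · refine ⟨rfl, residue_add_ediv r i k hk, residue_add_ediv s j m hm, ?_, ?_⟩
        · simp [hA]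
        · simp [hB]
      · simp [hA, hB, Int.mul_ediv_cancel_left _ hq.ne']
  exact ⟨key.finite_iff_finite.mpr S.finite_toSet, by
    rw [← Set.ncard_coe_finset, ← key.image_eq, key.injOn.ncard_image]⟩

theorem exists_ncard_boxSet_sub_le : ∃ C : ℝ, 0 ≤ C ∧ ∀ (q l : ℕ) [NeZero q] (r s : ZMod q)
    (c i j : ℤ), 0 < l → c ≠ 0 → IsCoprime c (q : ℤ) → l ≤ c.natAbs →
    |((boxSet q (q * l : ℕ) r s c i j).ncard : ℝ)
      - (l : ℝ) ^ 2 * c.natAbs.totient / (c.natAbs : ℝ) ^ 2| ≤ C * (c.natAbs : ℝ) ^ (7 / 8 : ℝ) := by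
  obtain ⟨C, hC0, hC⟩ := exists_card_progression_box_sub_le
  refine ⟨C, hC0, ?_⟩
  intro q l _ r s c i j hl hc hq hlc
  rw [(boxSet_eq_image hl r s c i j hc).2]
  exact hC c q l _ _ hc hq hlc

/-- Upper bound for the number of points of a box. -/
theorem exists_ncard_boxSet_le : ∃ C : ℝ, 0 ≤ C ∧ ∀ (q l : ℕ) [NeZero q] (r s : ZMod q)
    (c i j : ℤ), 0 < l → c ≠ 0 → IsCoprime c (q : ℤ) → l ≤ c.natAbs →
    ((boxSet q (q * l : ℕ) r s c i j).ncard : ℝ) ≤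
      (l : ℝ) ^ 2 / (c.natAbs : ℝ) + C * (c.natAbs : ℝ) ^ (7 / 8 : ℝ) := by
  obtain ⟨C, hC0, hC⟩ := exists_ncard_boxSet_sub_le
  refine ⟨C, hC0, ?_⟩
  intro q l _ r s c i j hl hc hq hlc
  have h := (abs_le.mp (hC q l r s c i j hl hc hq hlc)).2
  have hc' : (0 : ℝ) < c.natAbs := by exact_mod_cast Int.natAbs_pos.mpr hc
  have h2 : (l : ℝ) ^ 2 * c.natAbs.totient / (c.natAbs : ℝ) ^ 2 ≤ (l : ℝ) ^ 2 / (c.natAbs : ℝ) := by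
    rw [div_le_div_iff₀ (by positivity) hc']
    have : (c.natAbs.totient : ℝ) ≤ c.natAbs := by exact_mod_cast Nat.totient_le _
    calc _ ≤ (l : ℝ) ^ 2 * c.natAbs * c.natAbs := by gcongr
      _ = _ := by ring
  linarith

theorem frobNorm_nonneg (γ : SL2Z) : 0 ≤ frobNorm γ := Real.sqrt_nonneg _

theorem frobNorm_sq (γ : SL2Z) : frobNorm γ ^ 2 =
    (γ 0 0 : ℝ) ^ 2 + (γ 0 1 : ℝ) ^ 2 + (γ 1 0 : ℝ) ^ 2 + (γ 1 1 : ℝ) ^ 2 := by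
  unfold frobNorm
  rw [Real.sq_sqrt]
  · push_cast; ring
  · have : 0 ≤ γ 0 0 ^ 2 + γ 0 1 ^ 2 + γ 1 0 ^ 2 + γ 1 1 ^ 2 := by positivity
    exact_mod_cast this

theorem abs_entry_le_frobNorm (γ : SL2Z) (i j : Fin 2) : |(γ i j : ℝ)| ≤ frobNorm γ := by
  apply abs_le_of_sq_le_sq _ (frobNorm_nonneg γ)
  rw [frobNorm_sq]
  fin_cases i <;> fin_cases j <;> simp <;> nlinarith [sq_nonneg (γ 0 0 : ℝ), sq_nonneg (γ 0 1 : ℝ),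
    sq_nonneg (γ 1 0 : ℝ), sq_nonneg (γ 1 1 : ℝ)]

theorem finite_frobNorm_le (T : ℝ) : {γ : SL2Z | frobNorm γ ≤ T}.Finite := by
  apply Set.Finite.of_finite_image (f := fun γ : SL2Z => (γ 0 0, γ 0 1, γ 1 0, γ 1 1))
  · apply Set.Finite.subset (s := (Set.Icc (-⌈T⌉) ⌈T⌉) ×ˢ (Set.Icc (-⌈T⌉) ⌈T⌉) ×ˢ
      (Set.Icc (-⌈T⌉) ⌈T⌉) ×ˢ (Set.Icc (-⌈T⌉) ⌈T⌉))
    · exact (Set.finite_Icc _ _).prod ((Set.finite_Icc _ _).prod ((Set.finite_Icc _ _).prod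
        (Set.finite_Icc _ _)))
    · rintro _ ⟨γ, hγ, rfl⟩
      have h : ∀ i j, γ i j ∈ Set.Icc (-⌈T⌉) ⌈T⌉ := by
        intro i j
        have h1 := ((abs_entry_le_frobNorm γ i j).trans hγ).trans (Int.le_ceil T)
        rw [Set.mem_Icc, ← abs_le]
        exact_mod_cast h1
      exact ⟨h _ _, h _ _, h _ _, h _ _⟩
  · intro γ _ δ _ h
    simp only [Prod.mk.injEq] at h
    exact SL2Z_ext h.1 h.2.1 h.2.2.1 h.2.2.2

/-- `Γ_T` as a finite set. -/
def frobBall (T : ℝ) : Finset SL2Z := (finite_frobNorm_le T).toFinset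

theorem mem_frobBall {T : ℝ} {γ : SL2Z} : γ ∈ frobBall T ↔ frobNorm γ ≤ T := by
  simp [frobBall]

theorem frobBall_mono {S T : ℝ} (h : S ≤ T) : frobBall S ⊆ frobBall T := fun _ hγ =>
  mem_frobBall.mpr ((mem_frobBall.mp hγ).trans h)

theorem abs_entry_le_of_mem {T : ℝ} {γ : SL2Z} (h : γ ∈ frobBall T) (i j : Fin 2) :
    |(γ i j : ℝ)| ≤ T := (abs_entry_le_frobNorm γ i j).trans (mem_frobBall.mp h)

/-- A finite set of congruent integers with bounded differences is small. -/
theorem card_le_of_dvd_sub_of_abs_sub_le (S : Finset ℤ) (m : ℤ) (hm : 0 < m) (D : ℝ) (hD0 : 0 ≤ D)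
    (hS : ∀ x ∈ S, ∀ y ∈ S, m ∣ x - y) (hD : ∀ x ∈ S, ∀ y ∈ S, |(x : ℝ) - y| ≤ D) :
    (S.card : ℝ) ≤ D / m + 1 := by
  have hm' : (0 : ℝ) < m := by exact_mod_cast hm
  rcases S.eq_empty_or_nonempty with h | h
  · rw [h]; simp; positivity
  · set x₀ := S.min' h
    have hx₀ : x₀ ∈ S := S.min'_mem h
    have h1 : S.card ≤ (Finset.range (⌊D / m⌋₊ + 1)).card := by
      apply Finset.card_le_card_of_injOn (fun x => ((x - x₀) / m).toNat)
      · intro x hx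
        obtain ⟨k, hk⟩ := hS x hx x₀ hx₀
        have hle : x₀ ≤ x := S.min'_le x hx
        have hk0 : 0 ≤ k := by
          by_contra hneg; nlinarith
        obtain ⟨n, rfl⟩ := Int.eq_ofNat_of_zero_le hk0
        simp only [hk, Int.mul_ediv_cancel_left _ hm.ne', Int.toNat_natCast, Finset.coe_range,
          Set.mem_Iio]
        rw [Nat.lt_add_one_iff, Nat.le_floor_iff (by positivity), le_div_iff₀ hm']
        have h2 := (le_abs_self _).trans (hD x hx x₀ hx₀)
        have h3 : (x : ℝ) - x₀ = m * n := by exact_mod_cast hk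
        linarith
      · intro x hx y hy hxy
        obtain ⟨k, hk⟩ := hS x hx x₀ hx₀
        obtain ⟨l, hl⟩ := hS y hy x₀ hx₀
        have hle : x₀ ≤ x := S.min'_le x hx
        have hle' : x₀ ≤ y := S.min'_le y hy
        have hk0 : 0 ≤ k := by
          by_contra hneg; nlinarith
        have hl0 : 0 ≤ l := by
          by_contra hneg; nlinarith
        simp only [hk, hl, Int.mul_ediv_cancel_left _ hm.ne'] at hxy
        have : k = l := by omega
        subst this
        linarith
    rw [Finset.card_range] at h1
    calc (S.card : ℝ) ≤ (⌊D / m⌋₊ : ℝ) + 1 := by exact_mod_cast h1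
      _ ≤ _ := by gcongr; exact Nat.floor_le (by positivity)

/-- The weight `1 / √max(1, |x|)`. -/
def colWeight (x : ℤ) : ℝ := 1 / √(max 1 |(x : ℝ)|)

theorem colWeight_pos (x : ℤ) : 0 < colWeight x := by
  unfold colWeight
  have : (0 : ℝ) < max 1 |(x : ℝ)| := lt_max_of_lt_left one_pos
  positivity

theorem colWeight_le_one (x : ℤ) : colWeight x ≤ 1 := by
  unfold colWeight
  rw [div_le_one (Real.sqrt_pos.mpr (lt_max_of_lt_left one_pos))]
  rw [Real.one_le_sqrt]
  exact le_max_left _ _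

theorem card_column_le_top {T : ℝ} (hT : 0 ≤ T) (S : Finset SL2Z) (a c : ℤ)
    (hS : ∀ γ ∈ S, γ ∈ frobBall T ∧ γ 0 0 = a ∧ γ 1 0 = c) (ha : a ≠ 0) :
    (S.card : ℝ) ≤ 2 * T / |(a : ℝ)| + 1 := by
  have hinj : Set.InjOn (fun γ : SL2Z => γ 0 1) (S : Set SL2Z) := by
    intro γ hγ δ hδ h
    obtain ⟨-, h1, h2⟩ := hS γ hγ
    obtain ⟨-, h3, h4⟩ := hS δ hδ
    have hd := SL2Z_det γ
    have hd' := SL2Z_det δ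
    simp only at h
    rw [h1, h2, h] at hd
    rw [h3, h4] at hd'
    exact SL2Z_ext (by rw [h1, h3]) h (by rw [h2, h4]) (mul_left_cancel₀ ha (by linarith))
  rw [← Finset.card_image_of_injOn hinj]
  have h := card_le_of_dvd_sub_of_abs_sub_le (S.image fun γ : SL2Z => γ 0 1) |a| (abs_pos.mpr ha)
    (2 * T) (by positivity) ?_ ?_
  · rwa [Int.cast_abs] at h
  · intro x hx y hy
    obtain ⟨γ, hγ, rfl⟩ := Finset.mem_image.mp hx
    obtain ⟨δ, hδ, rfl⟩ := Finset.mem_image.mp hy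
    obtain ⟨-, h1, h2⟩ := hS γ hγ
    obtain ⟨-, h3, h4⟩ := hS δ hδ
    have hd := SL2Z_det γ
    have hd' := SL2Z_det δ
    rw [h1, h2] at hd
    rw [h3, h4] at hd'
    rw [abs_dvd]
    have hcop : IsCoprime a c := ⟨γ 1 1, -γ 0 1, by linarith⟩
    exact hcop.dvd_of_dvd_mul_right ⟨γ 1 1 - δ 1 1, by linarith⟩
  · intro x hx y hy
    obtain ⟨γ, hγ, rfl⟩ := Finset.mem_image.mp hx
    obtain ⟨δ, hδ, rfl⟩ := Finset.mem_image.mp hy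
    have h1 := abs_entry_le_of_mem (hS γ hγ).1 0 1
    have h2 := abs_entry_le_of_mem (hS δ hδ).1 0 1
    rw [abs_le] at *
    constructor <;> linarith

theorem card_column_le_bot {T : ℝ} (hT : 0 ≤ T) (S : Finset SL2Z) (a c : ℤ)
    (hS : ∀ γ ∈ S, γ ∈ frobBall T ∧ γ 0 0 = a ∧ γ 1 0 = c) (hc : c ≠ 0) :
    (S.card : ℝ) ≤ 2 * T / |(c : ℝ)| + 1 := by
  have hinj : Set.InjOn (fun γ : SL2Z => γ 1 1) (S : Set SL2Z) := by
    intro γ hγ δ hδ h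
    obtain ⟨-, h1, h2⟩ := hS γ hγ
    obtain ⟨-, h3, h4⟩ := hS δ hδ
    exact SL2Z_ext_of_ne_zero (by rwa [h2]) (by rw [h1, h3]) (by rw [h2, h4]) h
  rw [← Finset.card_image_of_injOn hinj]
  have h := card_le_of_dvd_sub_of_abs_sub_le (S.image fun γ : SL2Z => γ 1 1) |c| (abs_pos.mpr hc)
    (2 * T) (by positivity) ?_ ?_
  · rwa [Int.cast_abs] at h
  · intro x hx y hy
    obtain ⟨γ, hγ, rfl⟩ := Finset.mem_image.mp hx
    obtain ⟨δ, hδ, rfl⟩ := Finset.mem_image.mp hy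
    obtain ⟨-, h1, h2⟩ := hS γ hγ
    obtain ⟨-, h3, h4⟩ := hS δ hδ
    have hd := SL2Z_det γ
    have hd' := SL2Z_det δ
    rw [h1, h2] at hd
    rw [h3, h4] at hd'
    rw [abs_dvd]
    have hcop : IsCoprime c a := ⟨-γ 0 1, γ 1 1, by linarith⟩
    exact hcop.dvd_of_dvd_mul_left ⟨γ 0 1 - δ 0 1, by linarith⟩
  · intro x hx y hy
    obtain ⟨γ, hγ, rfl⟩ := Finset.mem_image.mp hx
    obtain ⟨δ, hδ, rfl⟩ := Finset.mem_image.mp hy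
    have h1 := abs_entry_le_of_mem (hS γ hγ).1 1 1
    have h2 := abs_entry_le_of_mem (hS δ hδ).1 1 1
    rw [abs_le] at *
    constructor <;> linarith

/-- The number of elements of `Γ_T` with a given first column. -/
theorem card_column_le {T : ℝ} (hT : 1 ≤ T) (S : Finset SL2Z) (a c : ℤ)
    (hS : ∀ γ ∈ S, γ ∈ frobBall T ∧ γ 0 0 = a ∧ γ 1 0 = c) :
    (S.card : ℝ) ≤ 3 * T * (colWeight a * colWeight c) := by
  rcases S.eq_empty_or_nonempty with h | ⟨γ₀, hγ₀⟩
  · rw [h]; simp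
    have := colWeight_pos a
    have := colWeight_pos c
    positivity
  obtain ⟨h1, h2, h3⟩ := hS γ₀ hγ₀
  have hdet := SL2Z_det γ₀
  have ha := abs_entry_le_of_mem h1 0 0
  have hc := abs_entry_le_of_mem h1 1 0
  rw [h2] at ha hdet
  rw [h3] at hc hdet
  have hone : ∀ x : ℤ, x ≠ 0 → (1 : ℝ) ≤ |(x : ℝ)| := fun x hx => by
    exact_mod_cast Int.one_le_abs hx
  have key : ∀ m : ℝ, 1 ≤ m → m ≤ T → |(a : ℝ)| ≤ m → |(c : ℝ)| ≤ m →
      2 * T / m + 1 ≤ 3 * T * (colWeight a * colWeight c) := by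
    intro m hm hmT ham hcm
    have hw : ∀ x : ℤ, |(x : ℝ)| ≤ m → 1 / √m ≤ colWeight x := fun x hx => by
      unfold colWeight
      gcongr
      exact max_le hm hx
    have h4 := hw a ham
    have h5 := hw c hcm
    have h6 : 1 / m ≤ colWeight a * colWeight c := by
      calc 1 / m = (1 / √m) * (1 / √m) := by
            rw [div_mul_div_comm, Real.mul_self_sqrt (by linarith), one_mul]
        _ ≤ _ := by
          have := colWeight_pos a
          gcongr
    have h7 : 2 * T / m + 1 ≤ 3 * T * (1 / m) := by
      have : (1 : ℝ) ≤ T / m := by rw [one_le_div (by linarith)]; exact hmT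
      calc _ ≤ 2 * T / m + T / m := by linarith
        _ = _ := by ring
    refine h7.trans ?_
    gcongr
  rcases le_total |(a : ℝ)| |(c : ℝ)| with h | h
  · have hc0 : c ≠ 0 := by
      rintro rfl
      have : (a : ℝ) = 0 := by simpa using h
      have : a = 0 := by exact_mod_cast this
      simp [this] at hdet
    exact (card_column_le_bot (by linarith) S a c hS hc0).trans (key _ (hone c hc0) hc h le_rfl)
  · have ha0 : a ≠ 0 := by
      rintro rfl
      have : (c : ℝ) = 0 := by simpa using h
      have : c = 0 := by exact_mod_cast this
      simp [this] at hdet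
    exact (card_column_le_top (by linarith) S a c hS ha0).trans (key _ (hone a ha0) ha le_rfl h)

theorem card_le_sum_columns {T : ℝ} (hT : 1 ≤ T) (S : Finset SL2Z) (A B : Finset ℤ)
    (hS : ∀ γ ∈ S, γ ∈ frobBall T ∧ γ 0 0 ∈ A ∧ γ 1 0 ∈ B) :
    (S.card : ℝ) ≤ 3 * T * ((∑ a ∈ A, colWeight a) * ∑ c ∈ B, colWeight c) := by
  rw [Finset.card_eq_sum_card_fiberwise (f := fun γ : SL2Z => (γ 0 0, γ 1 0)) (t := A ×ˢ B)]
  · push_cast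
    rw [Finset.sum_mul_sum, ← Finset.sum_product', Finset.mul_sum]
    refine Finset.sum_le_sum fun p _ => ?_
    apply card_column_le hT
    intro γ hγ
    obtain ⟨h1, h2⟩ := Finset.mem_filter.mp hγ
    simp only [Prod.ext_iff] at h2
    exact ⟨(hS γ h1).1, h2⟩
  · intro γ hγ
    exact Finset.mem_product.mpr (hS γ hγ).2

theorem sum_Icc_natAbs (g : ℕ → ℝ) (N : ℕ) :
    ∑ k ∈ Finset.Icc (-(N : ℤ)) N, g k.natAbs = g 0 + 2 * ∑ k ∈ Finset.range N, g (k + 1) := by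
  induction N with
  | zero => simp
  | succ N ih =>
    have : Finset.Icc (-((N + 1 : ℕ) : ℤ)) ((N + 1 : ℕ) : ℤ) =
        insert ((N : ℤ) + 1) (insert (-((N : ℤ) + 1)) (Finset.Icc (-(N : ℤ)) N)) := by
      ext x
      simp only [Finset.mem_Icc, Finset.mem_insert]
      push_cast
      omega
    rw [this, Finset.sum_insert, Finset.sum_insert, ih, Finset.sum_range_succ, Int.natAbs_neg,
      show ((N : ℤ) + 1).natAbs = N + 1 by omega]
    · ring
    · simp
    · simp; omega

theorem sum_range_one_div_sqrt_le (N : ℕ) :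
    ∑ k ∈ Finset.range N, 1 / √((k + 1 : ℕ) : ℝ) ≤ 2 * √(N : ℝ) := by
  induction N with
  | zero => simp
  | succ N ih =>
    rw [Finset.sum_range_succ]
    have h1 : 0 < √((N + 1 : ℕ) : ℝ) := by positivity
    have h0 : 0 ≤ √(N : ℝ) := Real.sqrt_nonneg _
    have h2 : √((N + 1 : ℕ) : ℝ) ^ 2 = N + 1 := by rw [Real.sq_sqrt (by positivity)]; push_cast; ring
    have h3 : √(N : ℝ) ^ 2 = N := Real.sq_sqrt (by positivity)
    have h4 : 1 / √((N + 1 : ℕ) : ℝ) ≤ 2 * √((N + 1 : ℕ) : ℝ) - 2 * √(N : ℝ) := by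
      rw [div_le_iff₀ h1]
      nlinarith [sq_nonneg (√((N + 1 : ℕ) : ℝ) - √(N : ℝ))]
    linarith

/-- Sums of `colWeight` over a progression. -/
theorem sum_colWeight_le (S : Finset ℤ) (p : ℕ) (hp : 0 < p) (s : ℤ) (hs : |s| ≤ 1)
    (hps : s = 0 ∨ 2 ≤ p) (X : ℝ) (hX : 0 ≤ X) (hS : ∀ x ∈ S, (p : ℤ) ∣ x - s ∧ |(x : ℝ)| ≤ X) :
    ∑ x ∈ S, colWeight x ≤ 1 + 8 * √X / p := by
  have hp0 : (0 : ℝ) < p := by exact_mod_cast hp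
  set N := ⌊2 * X / p⌋₊ with hN
  set g : ℕ → ℝ := fun k => if k = 0 then 1 else √(2 / p) * (1 / √(k : ℝ)) with hg
  have hhalf : ∀ k : ℤ, (p : ℝ) * |(k : ℝ)| / 2 ≤ |((s + p * k : ℤ) : ℝ)| := by
    intro k
    rcases hps with rfl | h2
    · push_cast; rw [zero_add, abs_mul, abs_of_pos hp0]
      have : 0 ≤ (p : ℝ) * |(k : ℝ)| := by positivity
      linarith
    · rcases eq_or_ne k 0 with rfl | hk
      · simp
      · have h1 : (1 : ℝ) ≤ |(k : ℝ)| := by exact_mod_cast Int.one_le_abs hk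
        have h2' : (2 : ℝ) ≤ p := by exact_mod_cast h2
        have h3 : |(s : ℝ)| ≤ 1 := by exact_mod_cast hs
        push_cast
        have h4 := abs_sub_abs_le_abs_sub ((p : ℝ) * k) (-(s : ℝ))
        rw [abs_neg, abs_mul, abs_of_pos hp0, sub_neg_eq_add, add_comm] at h4
        nlinarith
  calc ∑ x ∈ S, colWeight x ≤ ∑ x ∈ S, g ((x - s) / p).natAbs := by
        refine Finset.sum_le_sum fun x hx => ?_
        obtain ⟨⟨k, hk⟩, hxX⟩ := hS x hx
        rw [hk, Int.mul_ediv_cancel_left _ (by exact_mod_cast hp.ne')]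
        simp only [hg]
        split_ifs with hk0
        · exact colWeight_le_one x
        · have hxk : x = s + p * k := by linarith
          have hk1 : (0 : ℝ) < |(k : ℝ)| := abs_pos.mpr (by exact_mod_cast (by simpa using hk0 : k ≠ 0))
          have hna : ((k.natAbs : ℕ) : ℝ) = |(k : ℝ)| := by rw [Nat.cast_natAbs, Int.cast_abs]
          rw [hna, one_div, ← Real.sqrt_inv, ← Real.sqrt_mul (by positivity), colWeight, one_div,
            ← Real.sqrt_inv]
          apply Real.sqrt_le_sqrt
          rw [div_mul_eq_mul_div, ← div_eq_mul_inv, inv_eq_one_div,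
            div_le_div_iff₀ (lt_max_of_lt_left one_pos) hp0]
          have h5 := (hhalf k).trans (le_max_right 1 _)
          rw [← hxk] at h5
          rw [one_mul, div_mul_eq_mul_div, le_div_iff₀ hk1]
          linarith
    _ = ∑ k ∈ S.image (fun x => (x - s) / (p : ℤ)), g k.natAbs := by
        rw [Finset.sum_image]
        intro x hx y hy hxy
        obtain ⟨⟨k, hk⟩, -⟩ := hS x hx
        obtain ⟨⟨l, hl⟩, -⟩ := hS y hy
        have hp' : (p : ℤ) ≠ 0 := by exact_mod_cast hp.ne'
        simp only [hk, hl, Int.mul_ediv_cancel_left _ hp'] at hxy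
        rw [hxy] at hk
        linarith
    _ ≤ ∑ k ∈ Finset.Icc (-(N : ℤ)) N, g k.natAbs := by
        apply Finset.sum_le_sum_of_subset_of_nonneg
        · intro k hk
          obtain ⟨x, hx, rfl⟩ := Finset.mem_image.mp hk
          obtain ⟨⟨k, hk⟩, hxX⟩ := hS x hx
          rw [hk, Int.mul_ediv_cancel_left _ (by exact_mod_cast hp.ne')]
          have hxk : x = s + p * k := by linarith
          have h5 := hhalf k
          rw [← hxk] at h5
          have h6 : k.natAbs ≤ N := by
            rw [hN, Nat.le_floor_iff (by positivity), Nat.cast_natAbs, Int.cast_abs, le_div_iff₀ hp0]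
            linarith
          rw [Finset.mem_Icc]
          omega
        · intro k _ _
          simp only [hg]
          split_ifs <;> positivity
    _ = 1 + 2 * (√(2 / p) * ∑ k ∈ Finset.range N, 1 / √((k + 1 : ℕ) : ℝ)) := by
        rw [sum_Icc_natAbs]
        simp only [hg, if_true, Nat.succ_ne_zero, if_false, ← Finset.mul_sum]
    _ ≤ 1 + 2 * (√(2 / p) * (2 * √(2 * X / p))) := by
        have h1 := sum_range_one_div_sqrt_le N
        have h2 : √(N : ℝ) ≤ √(2 * X / p) := Real.sqrt_le_sqrt (Nat.floor_le (by positivity))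
        gcongr
        linarith
    _ = 1 + 8 * √X / p := by
        have : √(2 / p) * √(2 * X / p) = 2 * √X / p := by
          rw [← Real.sqrt_mul (by positivity), show 2 / (p : ℝ) * (2 * X / p) = (2 / p) ^ 2 * X by
            field_simp; try ring, Real.sqrt_mul (by positivity), Real.sqrt_sq (by positivity)]
          ring
        linear_combination 4 * this

theorem mem_Icc_ceil_of_abs_le {x : ℤ} {T : ℝ} (h : |(x : ℝ)| ≤ T) :
    x ∈ Finset.Icc (-⌈T⌉) ⌈T⌉ := by
  have h1 := h.trans (Int.le_ceil T)
  rw [Finset.mem_Icc, ← abs_le]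
  exact_mod_cast h1

theorem card_frobBall_filter_dvd_le {T : ℝ} (p : ℕ) (hp : 0 < p) (s : ℤ) (hs : |s| ≤ 1)
    (hps : s = 0 ∨ 2 ≤ p) (hpT : (p : ℝ) ≤ √T) (S : Finset SL2Z)
    (hS : ∀ γ ∈ S, γ ∈ frobBall T ∧ (p : ℤ) ∣ γ 0 0 - s ∧ (p : ℤ) ∣ γ 1 0) :
    (S.card : ℝ) ≤ 243 * T ^ 2 / p ^ 2 := by
  have hp1 : (1 : ℝ) ≤ p := by exact_mod_cast hp
  have hT1 : 1 ≤ T := by rw [← Real.one_le_sqrt]; linarith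
  have hT0 : 0 ≤ T := by linarith
  set A := (Finset.Icc (-⌈T⌉) ⌈T⌉).filter fun x : ℤ => (p : ℤ) ∣ x - s ∧ |(x : ℝ)| ≤ T with hA
  set B := (Finset.Icc (-⌈T⌉) ⌈T⌉).filter fun x : ℤ => (p : ℤ) ∣ x - 0 ∧ |(x : ℝ)| ≤ T with hB
  have h := card_le_sum_columns hT1 S A B (fun γ hγ => by
    obtain ⟨h1, h2, h3⟩ := hS γ hγ
    have h4 := abs_entry_le_of_mem h1 0 0
    have h5 := abs_entry_le_of_mem h1 1 0
    refine ⟨h1, ?_, ?_⟩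
    · rw [hA, Finset.mem_filter]
      exact ⟨mem_Icc_ceil_of_abs_le h4, h2, h4⟩
    · rw [hB, Finset.mem_filter, sub_zero]
      exact ⟨mem_Icc_ceil_of_abs_le h5, h3, h5⟩)
  have h1 := sum_colWeight_le A p hp s hs hps T hT0 (fun x hx => (Finset.mem_filter.mp hx).2)
  have h2 := sum_colWeight_le B p hp 0 (by simp) (Or.inl rfl) T hT0
    (fun x hx => (Finset.mem_filter.mp hx).2)
  have h3 : 1 + 8 * √T / p ≤ 9 * √T / p := by
    have : 1 ≤ √T / p := by rw [one_le_div (by linarith)]; exact hpT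
    calc _ ≤ √T / p + 8 * √T / p := by linarith
      _ = _ := by ring
  have h4 : 0 ≤ ∑ c ∈ B, colWeight c := Finset.sum_nonneg fun x _ => (colWeight_pos x).le
  calc (S.card : ℝ) ≤ _ := h
    _ ≤ 3 * T * ((9 * √T / p) * (9 * √T / p)) := by
      have := h1.trans h3
      have := h2.trans h3
      gcongr
    _ = 243 * T * (√T * √T) / p ^ 2 := by ring
    _ = _ := by rw [Real.mul_self_sqrt hT0]; ring

theorem card_frobBall_filter_abs_le {T X : ℝ} (hT : 1 ≤ T) (hX : 0 ≤ X) (S : Finset SL2Z)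
    (hS : ∀ γ ∈ S, γ ∈ frobBall T ∧ |(γ 1 0 : ℝ)| ≤ X) :
    (S.card : ℝ) ≤ 27 * T * √T * (1 + 8 * √X) := by
  have hT0 : 0 ≤ T := by linarith
  have hT1 : 1 ≤ √T := by rwa [Real.one_le_sqrt]
  set A := (Finset.Icc (-⌈T⌉) ⌈T⌉).filter fun x : ℤ => ((1 : ℕ) : ℤ) ∣ x - 0 ∧ |(x : ℝ)| ≤ T with hA
  set B := (Finset.Icc (-⌈X⌉) ⌈X⌉).filter fun x : ℤ => ((1 : ℕ) : ℤ) ∣ x - 0 ∧ |(x : ℝ)| ≤ X with hB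
  have h := card_le_sum_columns hT S A B (fun γ hγ => by
    obtain ⟨h1, h5⟩ := hS γ hγ
    have h4 := abs_entry_le_of_mem h1 0 0
    refine ⟨h1, ?_, ?_⟩
    · rw [hA, Finset.mem_filter]
      exact ⟨mem_Icc_ceil_of_abs_le h4, by simp, h4⟩
    · rw [hB, Finset.mem_filter]
      exact ⟨mem_Icc_ceil_of_abs_le h5, by simp, h5⟩)
  have h1 := sum_colWeight_le A 1 one_pos 0 (by simp) (Or.inl rfl) T hT0
    (fun x hx => (Finset.mem_filter.mp hx).2)
  have h2 := sum_colWeight_le B 1 one_pos 0 (by simp) (Or.inl rfl) X hX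
    (fun x hx => (Finset.mem_filter.mp hx).2)
  rw [Nat.cast_one, div_one] at h1 h2
  have h4 : 0 ≤ ∑ c ∈ B, colWeight c := Finset.sum_nonneg fun x _ => (colWeight_pos x).le
  calc (S.card : ℝ) ≤ _ := h
    _ ≤ 3 * T * ((9 * √T) * (1 + 8 * √X)) := by
      have : ∑ x ∈ A, colWeight x ≤ 9 * √T := by linarith
      gcongr
    _ = _ := by ring

theorem sum_Icc_one_div_sq_le (N : ℕ) (hN : 2 ≤ N) :
    ∑ g ∈ Finset.Icc 2 N, 1 / (g : ℝ) ^ 2 ≤ 3 / 4 - 1 / (N : ℝ) := by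
  induction N, hN using Nat.le_induction with
  | base => norm_num
  | succ n hn ih =>
    rw [Finset.sum_Icc_succ_top (by omega)]
    have hn' : (0 : ℝ) < n := by exact_mod_cast (show 0 < n by omega)
    have : 1 / ((n + 1 : ℕ) : ℝ) ^ 2 ≤ 1 / (n : ℝ) - 1 / ((n + 1 : ℕ) : ℝ) := by
      push_cast
      rw [div_sub_div _ _ hn'.ne' (by positivity), div_le_div_iff₀ (by positivity) (by positivity)]
      nlinarith
    linarith

theorem card_coprime_pairs_ge (N : ℕ) : (N : ℝ) ^ 2 / 4 ≤
    (((Finset.Ioc 0 N ×ˢ Finset.Ioc 0 N).filter fun p : ℕ × ℕ => p.1.Coprime p.2).card : ℝ) := by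
  rcases Nat.lt_or_ge N 2 with h | hN
  · interval_cases N
    · simp
    · have : ((Finset.Ioc 0 1 ×ˢ Finset.Ioc 0 1).filter fun p : ℕ × ℕ => p.1.Coprime p.2).card = 1 := by
        decide
      rw [this]; norm_num
  have hsplit := Finset.card_filter_add_card_filter_not (s := Finset.Ioc 0 N ×ˢ Finset.Ioc 0 N)
    (fun p : ℕ × ℕ => p.1.Coprime p.2)
  rw [Finset.card_product, Nat.card_Ioc, Nat.sub_zero] at hsplit
  have hsub : ((Finset.Ioc 0 N ×ˢ Finset.Ioc 0 N).filter fun p : ℕ × ℕ => ¬ p.1.Coprime p.2) ⊆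
      (Finset.Icc 2 N).biUnion fun g =>
        ((Finset.Ioc 0 N).filter fun x => g ∣ x) ×ˢ ((Finset.Ioc 0 N).filter fun x => g ∣ x) := by
    rintro ⟨a, b⟩ h
    simp only [Finset.mem_filter, Finset.mem_product, Finset.mem_Ioc, Finset.mem_biUnion,
      Finset.mem_Icc] at h ⊢
    obtain ⟨⟨⟨ha, ha'⟩, hb, hb'⟩, hab⟩ := h
    refine ⟨a.gcd b, ⟨?_, ?_⟩, ⟨⟨ha, ha'⟩, Nat.gcd_dvd_left a b⟩, ⟨hb, hb'⟩, Nat.gcd_dvd_right a b⟩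
    · have h1 := Nat.gcd_pos_of_pos_left b ha
      have h2 : a.gcd b ≠ 1 := hab
      omega
    · exact (Nat.gcd_le_left b ha).trans ha'
  have hN0 : (0 : ℝ) < N := by exact_mod_cast (show 0 < N by omega)
  have hle : ((((Finset.Ioc 0 N ×ˢ Finset.Ioc 0 N).filter
      fun p : ℕ × ℕ => ¬ p.1.Coprime p.2).card : ℕ) : ℝ) ≤ 3 / 4 * (N : ℝ) ^ 2 := by
    calc _ ≤ (((Finset.Icc 2 N).biUnion fun g => ((Finset.Ioc 0 N).filter fun x => g ∣ x) ×ˢ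
          ((Finset.Ioc 0 N).filter fun x => g ∣ x)).card : ℝ) := by
            exact_mod_cast Finset.card_le_card hsub
      _ ≤ ∑ g ∈ Finset.Icc 2 N, (N : ℝ) ^ 2 * (1 / (g : ℝ) ^ 2) := by
            refine (Nat.cast_le.mpr Finset.card_biUnion_le).trans ?_
            push_cast
            refine Finset.sum_le_sum fun g hg => ?_
            rw [Finset.card_product, Nat.Ioc_filter_dvd_card_eq_div]
            push_cast
            have : ((N / g : ℕ) : ℝ) ≤ N / g := Nat.cast_div_le
            calc _ ≤ (N / g : ℝ) * (N / g) := by gcongr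
              _ = _ := by ring
      _ ≤ (N : ℝ) ^ 2 * (3 / 4) := by
            rw [← Finset.mul_sum]
            have h1 := sum_Icc_one_div_sq_le N hN
            have : 0 < 1 / (N : ℝ) := by positivity
            gcongr
            linarith
      _ = _ := by ring
  have hs : ((((Finset.Ioc 0 N ×ˢ Finset.Ioc 0 N).filter
      fun p : ℕ × ℕ => p.1.Coprime p.2).card : ℕ) : ℝ) + (((Finset.Ioc 0 N ×ˢ Finset.Ioc 0 N).filter
      fun p : ℕ × ℕ => ¬ p.1.Coprime p.2).card : ℝ) = N ^ 2 := by
    rw [sq]; exact_mod_cast hsplit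
  linarith

theorem exists_SL2Z (a b c d : ℤ) (h : a * d - b * c = 1) :
    ∃ γ : SL2Z, γ 0 0 = a ∧ γ 0 1 = b ∧ γ 1 0 = c ∧ γ 1 1 = d :=
  ⟨⟨!![a, b; c, d], by rw [Matrix.det_fin_two_of]; exact h⟩, rfl, rfl, rfl, rfl⟩

theorem exists_completion (a c : ℕ) (ha : 0 < a) (hc : 0 < c) (h : a.Coprime c) (N : ℕ)
    (haN : a ≤ N) (hcN : c ≤ N) :
    ∃ γ : SL2Z, γ 0 0 = a ∧ γ 1 0 = c ∧ frobNorm γ ≤ 2 * N := by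
  have hc' : (0 : ℤ) < c := by exact_mod_cast hc
  have ha' : (0 : ℤ) < a := by exact_mod_cast ha
  obtain ⟨u, v, huv⟩ : IsCoprime (a : ℤ) c := Nat.isCoprime_iff_coprime.mpr h
  set d := u % c with hd
  have hd0 : 0 ≤ d := Int.emod_nonneg _ hc'.ne'
  have hdc : d < c := Int.emod_lt_of_pos _ hc'
  have hud := Int.mul_ediv_add_emod u c
  set b := -(v + a * (u / c)) with hb
  have hdet : (a : ℤ) * d - b * c = 1 := by
    rw [hb, hd]; linear_combination huv + a * hud
  have hb1 : b < a := by nlinarith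
  have hb2 : -1 ≤ b := by nlinarith [mul_nonneg ha'.le hd0]
  obtain ⟨γ, h00, h01, h10, h11⟩ := exists_SL2Z a b c d hdet
  refine ⟨γ, h00, h10, ?_⟩
  refine le_of_sq_le_sq ?_ (by positivity)
  rw [frobNorm_sq, h00, h01, h10, h11]
  have hbN : |(b : ℝ)| ≤ N := by
    rw [abs_le]
    have : (1 : ℝ) ≤ N := by exact_mod_cast ha.trans_le haN
    have h1 : (-1 : ℝ) ≤ b := by exact_mod_cast hb2
    have h2 : (b : ℝ) ≤ N := by exact_mod_cast (hb1.le.trans (by exact_mod_cast haN))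
    constructor <;> linarith
  have hdN : |(d : ℝ)| ≤ N := by
    rw [abs_le]
    have h1 : (0 : ℝ) ≤ d := by exact_mod_cast hd0
    have h2 : (d : ℝ) ≤ N := by exact_mod_cast (hdc.le.trans (by exact_mod_cast hcN))
    constructor <;> linarith
  have haN' : (a : ℝ) ^ 2 ≤ (N : ℝ) ^ 2 := by gcongr
  have hcN' : (c : ℝ) ^ 2 ≤ (N : ℝ) ^ 2 := by gcongr
  have h3 := sq_le_sq' (abs_le.mp hbN).1 (abs_le.mp hbN).2
  have h4 := sq_le_sq' (abs_le.mp hdN).1 (abs_le.mp hdN).2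
  push_cast
  nlinarith

theorem card_frobBall_ge {T : ℝ} (hT : 2 ≤ T) : T ^ 2 / 64 ≤ ((frobBall T).card : ℝ) := by
  set N := ⌊T / 2⌋₊ with hN
  have hN1 : (N : ℝ) ≤ T / 2 := Nat.floor_le (by linarith)
  have hN2 : T / 2 < N + 1 := Nat.lt_floor_add_one _
  have hN3 : 1 ≤ N := by rw [hN, Nat.one_le_floor_iff]; linarith
  have hN4 : (1 : ℝ) ≤ N := by exact_mod_cast hN3
  set P := (Finset.Ioc 0 N ×ˢ Finset.Ioc 0 N).filter fun p : ℕ × ℕ => p.1.Coprime p.2 with hP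
  have hex : ∀ p ∈ P, ∃ γ : SL2Z, γ 0 0 = p.1 ∧ γ 1 0 = p.2 ∧ frobNorm γ ≤ 2 * N := by
    intro p hp
    simp only [hP, Finset.mem_filter, Finset.mem_product, Finset.mem_Ioc] at hp
    exact exists_completion p.1 p.2 hp.1.1.1 hp.1.2.1 hp.2 N hp.1.1.2 hp.1.2.2
  choose! f hf using hex
  have hcard : P.card ≤ (frobBall T).card := by
    apply Finset.card_le_card_of_injOn f
    · intro p hp
      have := (hf p hp).2.2
      exact mem_frobBall.mpr (by linarith)
    · intro p hp q hq h
      have h1 := hf p hp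
      have h2 := hf q hq
      rw [h] at h1
      ext
      · exact_mod_cast h1.1.symm.trans h2.1
      · exact_mod_cast h1.2.1.symm.trans h2.2.1
  have h1 := card_coprime_pairs_ge N
  have h2 : (P.card : ℝ) ≤ (frobBall T).card := by exact_mod_cast hcard
  have h3 : T ≤ 4 * N := by linarith
  nlinarith

theorem card_Icc_ceil_le {T : ℝ} (hT : 1 ≤ T) :
    ((Finset.Icc (-⌈T⌉) ⌈T⌉).card : ℝ) ≤ 5 * T := by
  rw [Int.card_Icc]
  have h0 : 0 ≤ ⌈T⌉ := Int.ceil_nonneg (by linarith)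
  have h1 : ((⌈T⌉ + 1 - -⌈T⌉).toNat : ℤ) = 2 * ⌈T⌉ + 1 := by rw [Int.toNat_of_nonneg] <;> omega
  have h2 : ((⌈T⌉ + 1 - -⌈T⌉).toNat : ℝ) = 2 * ⌈T⌉ + 1 := by exact_mod_cast h1
  rw [h2]
  have := (Int.ceil_lt_add_one T).le
  linarith

theorem exists_card_trace_eq_le (ε : ℝ) (hε : 0 < ε) : ∃ C : ℝ, 0 ≤ C ∧ ∀ (T : ℝ), 1 ≤ T →
    ∀ (t : ℤ) (S : Finset SL2Z),
      (∀ γ ∈ S, γ ∈ frobBall T ∧ trZ γ = t ∧ γ 0 1 ≠ 0 ∧ γ 1 0 ≠ 0) →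
      (S.card : ℝ) ≤ C * T ^ (1 + ε) := by
  obtain ⟨C, hC1, hC⟩ := exists_card_divisors_le (ε / 2) (by linarith)
  refine ⟨10 * C, by linarith, ?_⟩
  intro T hT t S hS
  have hT0 : 0 < T := by linarith
  rw [Finset.card_eq_sum_card_fiberwise (f := fun γ : SL2Z => γ 0 0) (t := Finset.Icc (-⌈T⌉) ⌈T⌉)
    (fun γ hγ => mem_Icc_ceil_of_abs_le (abs_entry_le_of_mem (hS γ hγ).1 0 0))]
  have hfib : ∀ a ∈ Finset.Icc (-⌈T⌉) ⌈T⌉,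
      ((S.filter fun γ : SL2Z => γ 0 0 = a).card : ℝ) ≤ 2 * C * T ^ ε := by
    intro a _
    set F := S.filter fun γ : SL2Z => γ 0 0 = a with hF
    rcases F.eq_empty_or_nonempty with h | ⟨γ₀, hγ₀⟩
    · rw [h]; simp; positivity
    have hprop : ∀ γ ∈ F, γ 0 1 * γ 1 0 = a * (t - a) - 1 ∧ γ 1 1 = t - a := by
      intro γ hγ
      obtain ⟨h1, h2⟩ := Finset.mem_filter.mp hγ
      have h3 := (hS γ h1).2.1
      have hdet := SL2Z_det γ
      rw [trZ, h2] at h3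
      rw [h2] at hdet
      have h4 : γ 1 1 = t - a := by linarith
      rw [h4] at hdet
      exact ⟨by linarith, h4⟩
    set m := a * (t - a) - 1 with hm
    obtain ⟨hγS, hγa⟩ := Finset.mem_filter.mp hγ₀
    obtain ⟨hγT, -, hb0, hc0⟩ := hS γ₀ hγS
    have hm0 : m ≠ 0 := by rw [← (hprop γ₀ hγ₀).1]; exact mul_ne_zero hb0 hc0
    have hmT : (m.natAbs : ℝ) ≤ T ^ 2 := by
      rw [Nat.cast_natAbs, Int.cast_abs, ← (hprop γ₀ hγ₀).1, Int.cast_mul, abs_mul, sq]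
      have h1 := abs_entry_le_of_mem hγT 0 1
      have h2 := abs_entry_le_of_mem hγT 1 0
      gcongr
    have hcard : F.card ≤ (m.natAbs.divisors ×ˢ (Finset.univ : Finset Bool)).card := by
      apply Finset.card_le_card_of_injOn (fun γ => ((γ 0 1).natAbs, decide (0 < γ 0 1)))
      · intro γ hγ
        simp only [Finset.coe_product, Set.mem_prod, Finset.mem_coe, Nat.mem_divisors, Finset.mem_univ,
          and_true]
        refine ⟨?_, Int.natAbs_ne_zero.mpr hm0⟩
        rw [Int.natAbs_dvd_natAbs, ← (hprop γ hγ).1]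
        exact dvd_mul_right _ _
      · intro γ hγ δ hδ h
        simp only [Prod.mk.injEq, decide_eq_decide] at h
        have hb : γ 0 1 = δ 0 1 := by omega
        have h1 := hprop γ hγ
        have h2 := hprop δ hδ
        have hγb := (hS γ (Finset.mem_filter.mp hγ).1).2.2.1
        refine SL2Z_ext ?_ hb ?_ ?_
        · rw [(Finset.mem_filter.mp hγ).2, (Finset.mem_filter.mp hδ).2]
        · refine mul_left_cancel₀ hγb ?_
          rw [h1.1, hb, h2.1]
        · rw [h1.2, h2.2]
    rw [Finset.card_product, Finset.card_univ, Fintype.card_bool] at hcard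
    have h1 := hC m.natAbs (Int.natAbs_ne_zero.mpr hm0)
    have h2 : (m.natAbs : ℝ) ^ (ε / 2) ≤ T ^ ε := by
      calc _ ≤ (T ^ 2) ^ (ε / 2) := Real.rpow_le_rpow (by positivity) hmT (by linarith)
        _ = _ := by rw [← Real.rpow_natCast, ← Real.rpow_mul hT0.le]; congr 1; push_cast; ring
    calc (F.card : ℝ) ≤ m.natAbs.divisors.card * 2 := by exact_mod_cast hcard
      _ ≤ (C * T ^ ε) * 2 := by
        have : C * (m.natAbs : ℝ) ^ (ε / 2) ≤ C * T ^ ε := by gcongr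
        linarith
      _ = _ := by ring
  push_cast
  calc _ ≤ ∑ _a ∈ Finset.Icc (-⌈T⌉) ⌈T⌉, 2 * C * T ^ ε := Finset.sum_le_sum hfib
    _ = (Finset.Icc (-⌈T⌉) ⌈T⌉).card * (2 * C * T ^ ε) := by rw [Finset.sum_const, nsmul_eq_mul]
    _ ≤ 5 * T * (2 * C * T ^ ε) := by
      have := card_Icc_ceil_le hT
      gcongr
    _ = _ := by rw [Real.rpow_add hT0, Real.rpow_one]; ring

theorem card_mul_eq_zero_le {T : ℝ} (hT : 1 ≤ T) (S : Finset SL2Z)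
    (hS : ∀ γ ∈ S, γ ∈ frobBall T ∧ (γ 0 1 = 0 ∨ γ 1 0 = 0)) : (S.card : ℝ) ≤ 20 * T := by
  have hcard : S.card ≤ ((Finset.univ : Finset (Bool × Bool)) ×ˢ Finset.Icc (-⌈T⌉) ⌈T⌉).card := by
    apply Finset.card_le_card_of_injOn (fun γ => ((decide (0 < γ 0 0), decide (γ 0 1 = 0)),
      if γ 0 1 = 0 then γ 1 0 else γ 0 1))
    · intro γ hγ
      obtain ⟨h1, h2⟩ := hS γ hγ
      simp only [Finset.coe_product, Set.mem_prod, Finset.mem_coe, Finset.mem_univ, true_and]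
      split_ifs
      · exact mem_Icc_ceil_of_abs_le (abs_entry_le_of_mem h1 1 0)
      · exact mem_Icc_ceil_of_abs_le (abs_entry_le_of_mem h1 0 1)
    · have hdiag : ∀ γ ∈ S, (γ 0 0 = 1 ∧ γ 1 1 = 1) ∨ (γ 0 0 = -1 ∧ γ 1 1 = -1) := by
        intro γ hγ
        have hdet := SL2Z_det γ
        have h0 : γ 0 1 * γ 1 0 = 0 := mul_eq_zero.mpr (hS γ hγ).2
        rw [h0, sub_zero] at hdet
        exact Int.mul_eq_one_iff_eq_one_or_neg_one.mp hdet
      intro γ hγ δ hδ h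
      simp only [Prod.mk.injEq, decide_eq_decide] at h
      obtain ⟨⟨h1, h2⟩, h3⟩ := h
      have h4 := (hS γ hγ).2
      have h5 := (hS δ hδ).2
      have h6 := hdiag γ hγ
      have h7 := hdiag δ hδ
      refine SL2Z_ext ?_ ?_ ?_ ?_
      · omega
      · split_ifs at h3 <;> omega
      · split_ifs at h3 <;> omega
      · omega
  rw [Finset.card_product, Finset.card_univ] at hcard
  simp only [Fintype.card_prod, Fintype.card_bool] at hcard
  have := card_Icc_ceil_le hT
  calc (S.card : ℝ) ≤ (2 * 2) * (Finset.Icc (-⌈T⌉) ⌈T⌉).card := by exact_mod_cast hcard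
    _ ≤ (2 * 2) * (5 * T) := by gcongr
    _ = _ := by ring

theorem exists_card_abs_trace_le_two : ∃ C : ℝ, 0 ≤ C ∧ ∀ T : ℝ, 1 ≤ T → ∀ S : Finset SL2Z,
    (∀ γ ∈ S, γ ∈ frobBall T ∧ |trZ γ| ≤ 2) → (S.card : ℝ) ≤ C * T ^ (3 / 2 : ℝ) := by
  obtain ⟨C, hC0, hC⟩ := exists_card_trace_eq_le (1 / 2) (by norm_num)
  refine ⟨20 + 5 * C, by positivity, ?_⟩
  intro T hT S hS
  have hsub : S ⊆ (S.filter fun γ : SL2Z => γ 0 1 = 0 ∨ γ 1 0 = 0) ∪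
      (Finset.Icc (-2 : ℤ) 2).biUnion fun t =>
        S.filter fun γ : SL2Z => trZ γ = t ∧ γ 0 1 ≠ 0 ∧ γ 1 0 ≠ 0 := by
    intro γ hγ
    have h := abs_le.mp (hS γ hγ).2
    simp only [Finset.mem_union, Finset.mem_filter, Finset.mem_biUnion, Finset.mem_Icc]
    by_cases h0 : γ 0 1 = 0 ∨ γ 1 0 = 0
    · exact Or.inl ⟨hγ, h0⟩
    · rw [not_or] at h0
      exact Or.inr ⟨trZ γ, h, hγ, rfl, h0⟩
  have h1 : (S.card : ℝ) ≤ (S.filter fun γ : SL2Z => γ 0 1 = 0 ∨ γ 1 0 = 0).card +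
      ∑ t ∈ Finset.Icc (-2 : ℤ) 2,
        ((S.filter fun γ : SL2Z => trZ γ = t ∧ γ 0 1 ≠ 0 ∧ γ 1 0 ≠ 0).card : ℝ) := by
    exact_mod_cast (Finset.card_le_card hsub).trans ((Finset.card_union_le _ _).trans
      (Nat.add_le_add_left Finset.card_biUnion_le _))
  have h2 := card_mul_eq_zero_le hT (S.filter fun γ : SL2Z => γ 0 1 = 0 ∨ γ 1 0 = 0)
    (fun γ hγ => ⟨(hS γ (Finset.mem_filter.mp hγ).1).1, (Finset.mem_filter.mp hγ).2⟩)
  have h3 : ∀ t ∈ Finset.Icc (-2 : ℤ) 2,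
      ((S.filter fun γ : SL2Z => trZ γ = t ∧ γ 0 1 ≠ 0 ∧ γ 1 0 ≠ 0).card : ℝ)
        ≤ C * T ^ (1 + 1 / 2 : ℝ) := fun t _ => hC T hT t _
    (fun γ hγ => ⟨(hS γ (Finset.mem_filter.mp hγ).1).1, (Finset.mem_filter.mp hγ).2⟩)
  have h4 := Finset.sum_le_sum h3
  rw [Finset.sum_const, Int.card_Icc, nsmul_eq_mul] at h4
  have h5 : T ≤ T ^ (3 / 2 : ℝ) := by
    conv_lhs => rw [← Real.rpow_one T]
    exact Real.rpow_le_rpow_of_exponent_le hT (by norm_num)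
  rw [show (1 + 1 / 2 : ℝ) = 3 / 2 by norm_num] at h4
  have h6 : ((2 + 1 - -2 : ℤ).toNat : ℝ) = 5 := by
    rw [show (2 + 1 - -2 : ℤ).toNat = 5 from rfl]; norm_num
  rw [h6] at h4
  linarith

theorem eventually_mul_rpow_le (A ε s : ℝ) (hε : 0 < ε) (hs : s < 2) :
    ∀ᶠ T : ℝ in atTop, A * T ^ s ≤ ε * T ^ 2 := by
  have h1 := tendsto_rpow_neg_atTop (show 0 < 2 - s by linarith)
  have h2 : 0 < ε / (|A| + 1) := by positivity
  filter_upwards [h1.eventually (gt_mem_nhds h2), eventually_gt_atTop 0] with T hT hT0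
  have h3 : T ^ s = T ^ 2 * T ^ (-(2 - s)) := by
    rw [← Real.rpow_natCast, ← Real.rpow_add hT0]; congr 1; push_cast; ring
  rw [lt_div_iff₀ (by positivity)] at hT
  have h4 : 0 ≤ T ^ (-(2 - s)) := by positivity
  rw [h3]
  calc A * (T ^ 2 * T ^ (-(2 - s))) ≤ (|A| + 1) * (T ^ 2 * T ^ (-(2 - s))) := by
        gcongr; linarith [le_abs_self A]
    _ = T ^ 2 * (T ^ (-(2 - s)) * (|A| + 1)) := by ring
    _ ≤ T ^ 2 * ε := by gcongr
    _ = _ := by ring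

theorem card_le_card_mul_of_fibers {α β : Type*} [DecidableEq β] (S : Finset α) (f : α → β)
    (t : Finset β) (hf : ∀ x ∈ S, f x ∈ t) (B : ℝ)
    (hB : ∀ b ∈ t, ((S.filter fun x => f x = b).card : ℝ) ≤ B) : (S.card : ℝ) ≤ t.card * B := by
  rw [Finset.card_eq_sum_card_fiberwise (f := f) (t := t) hf]
  push_cast
  calc _ ≤ ∑ _b ∈ t, B := Finset.sum_le_sum hB
    _ = _ := by rw [Finset.sum_const, nsmul_eq_mul]

/-- Matrices in a ball with small lower left entry are negligible. -/
theorem exists_small_lower_left (ε R : ℝ) (hε : 0 < ε) (hR : 1 ≤ R) :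
    ∃ η : ℝ, 0 < η ∧ η ≤ 1 ∧ ∀ᶠ T : ℝ in atTop, ∀ S : Finset SL2Z,
      (∀ γ ∈ S, γ ∈ frobBall (R * T) ∧ |(γ 1 0 : ℝ)| ≤ η * T) → (S.card : ℝ) ≤ ε * T ^ 2 := by
  set K := 216 * R * √R with hK
  have hK0 : 0 < K := by positivity
  set η := min 1 ((ε / (2 * K)) ^ 2) with hη
  have hη0 : 0 < η := lt_min one_pos (by positivity)
  refine ⟨η, hη0, min_le_left _ _, ?_⟩
  filter_upwards [eventually_mul_rpow_le (27 * R * √R) (ε / 2) (3 / 2) (by linarith) (by norm_num),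
    eventually_ge_atTop 1] with T hT hT1 S hS
  have hT0 : 0 < T := by linarith
  have h1 := card_frobBall_filter_abs_le (T := R * T) (X := η * T) (by nlinarith) (by positivity) S hS
  have h2 : √η ≤ ε / (2 * K) := by
    rw [Real.sqrt_le_left (by positivity)]; exact min_le_right _ _
  have h3 : T * √T = T ^ (3 / 2 : ℝ) := by
    rw [Real.sqrt_eq_rpow, ← Real.rpow_one_add' hT0.le (by norm_num)]; norm_num
  have h4 : √T * √T = T := Real.mul_self_sqrt hT0.le
  have hR0 : 0 ≤ R := by linarith
  rw [Real.sqrt_mul hR0, Real.sqrt_mul hη0.le] at h1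
  calc (S.card : ℝ) ≤ _ := h1
    _ = 27 * R * √R * (T * √T) + K * √η * T * (√T * √T) := by rw [hK]; ring
    _ ≤ ε / 2 * T ^ 2 + K * (ε / (2 * K)) * T * T := by
        rw [h3, h4]
        gcongr
    _ = _ := by field_simp; ring

theorem frobNorm_sq_mul_sq (γ : SL2Z) : (γ 1 0 : ℝ) ^ 2 * frobNorm γ ^ 2 =
    ((γ 0 0 : ℝ) ^ 2 + (γ 1 0 : ℝ) ^ 2) * ((γ 1 0 : ℝ) ^ 2 + (γ 1 1 : ℝ) ^ 2)
      - 2 * (γ 0 0 : ℝ) * γ 1 1 + 1 := by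
  have hdet : (γ 0 0 : ℝ) * γ 1 1 - γ 0 1 * γ 1 0 = 1 := by exact_mod_cast SL2Z_det γ
  rw [frobNorm_sq]
  linear_combination (-(γ 0 0 : ℝ) * γ 1 1 + 1 - γ 0 1 * γ 1 0) * hdet

theorem abs_sq_sub_sq_le_of_shell {T κ η l a a' d d' c n n' : ℝ} (hT : 1 ≤ T) (hκ0 : 0 ≤ κ) (hκ : κ ≤ 1)
    (hη : 0 < η) (hc : η * T ≤ |c|) (ha : |a| ≤ 2 * T) (ha' : |a'| ≤ 2 * T) (hd : |d| ≤ 2 * T)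
    (hd' : |d'| ≤ 2 * T) (hc2 : |c| ≤ 2 * T) (haa : |a' - a| ≤ l) (hn : T < n) (hn2 : n ≤ (1 + κ) * T)
    (hn' : T < n') (hn2' : n' ≤ (1 + κ) * T)
    (hP : c ^ 2 * n ^ 2 = (a ^ 2 + c ^ 2) * (c ^ 2 + d ^ 2) - 2 * a * d + 1)
    (hP' : c ^ 2 * n' ^ 2 = (a' ^ 2 + c ^ 2) * (c ^ 2 + d' ^ 2) - 2 * a' * d' + 1) :
    |d ^ 2 - d' ^ 2| ≤ 3 * κ * T ^ 2 + 36 * l * T / η ^ 2 + 16 / η ^ 2 := by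
  have hT0 : 0 < T := by linarith
  have hl : 0 ≤ l := (abs_nonneg _).trans haa
  have hnn : |n ^ 2 - n' ^ 2| ≤ 3 * κ * T ^ 2 := by
    have hn0 : 0 ≤ n := by linarith
    have hn0' : 0 ≤ n' := by linarith
    have h1 : n ^ 2 ≤ ((1 + κ) * T) ^ 2 := by gcongr
    have h2 : n' ^ 2 ≤ ((1 + κ) * T) ^ 2 := by gcongr
    have h3 : T ^ 2 ≤ n ^ 2 := by gcongr
    have h4 : T ^ 2 ≤ n' ^ 2 := by gcongr
    have h5 : ((1 + κ) * T) ^ 2 ≤ T ^ 2 + 3 * κ * T ^ 2 := by nlinarith [mul_nonneg hκ0 (sq_nonneg T)]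
    rw [abs_le]; constructor <;> linarith
  have hid : (a ^ 2 + c ^ 2) * (d ^ 2 - d' ^ 2) = c ^ 2 * (n ^ 2 - n' ^ 2)
      + (a' - a) * (a' + a) * (c ^ 2 + d' ^ 2) - 2 * (a' - a) * d' + 2 * a * (d - d') := by
    linear_combination (-1 : ℝ) * hP + hP'
  have hc4 : c ^ 2 ≤ 4 * T ^ 2 := by
    rw [← sq_abs]; nlinarith [abs_nonneg c]
  have hd4 : d' ^ 2 ≤ 4 * T ^ 2 := by
    rw [← sq_abs]; nlinarith [abs_nonneg d']
  have e1 : |(a' - a) * (a' + a) * (c ^ 2 + d' ^ 2)| ≤ l * (4 * T) * (8 * T ^ 2) := by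
    rw [abs_mul, abs_mul, abs_of_nonneg (by positivity : 0 ≤ c ^ 2 + d' ^ 2)]
    have : |a' + a| ≤ 4 * T := (abs_add_le _ _).trans (by linarith)
    gcongr
    linarith
  have e2 : |2 * (a' - a) * d'| ≤ 2 * l * (2 * T) := by
    rw [abs_mul, abs_mul, abs_two]; gcongr
  have e3 : |2 * a * (d - d')| ≤ 2 * (2 * T) * (4 * T) := by
    rw [abs_mul, abs_mul, abs_two]
    have : |d - d'| ≤ 4 * T := (abs_sub _ _).trans (by linarith)
    gcongr
  have e4 : |c ^ 2 * (n ^ 2 - n' ^ 2)| ≤ c ^ 2 * (3 * κ * T ^ 2) := by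
    rw [abs_mul, abs_of_nonneg (sq_nonneg c)]; gcongr
  have e5 : (a ^ 2 + c ^ 2) * |d ^ 2 - d' ^ 2| ≤ c ^ 2 * (3 * κ * T ^ 2) + 36 * l * T ^ 3 + 16 * T ^ 2 := by
    rw [← abs_of_nonneg (by positivity : 0 ≤ a ^ 2 + c ^ 2), ← abs_mul, hid]
    have h6 : l * T ≤ l * T ^ 3 := by
      gcongr; exact le_self_pow₀ hT (by norm_num)
    have f1 := abs_add_le (c ^ 2 * (n ^ 2 - n' ^ 2) + (a' - a) * (a' + a) * (c ^ 2 + d' ^ 2)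
      - 2 * (a' - a) * d') (2 * a * (d - d'))
    have f2 := abs_sub (c ^ 2 * (n ^ 2 - n' ^ 2) + (a' - a) * (a' + a) * (c ^ 2 + d' ^ 2))
      (2 * (a' - a) * d')
    have f3 := abs_add_le (c ^ 2 * (n ^ 2 - n' ^ 2)) ((a' - a) * (a' + a) * (c ^ 2 + d' ^ 2))
    have g1 : l * (4 * T) * (8 * T ^ 2) = 32 * (l * T ^ 3) := by ring
    have g2 : 2 * l * (2 * T) = 4 * (l * T) := by ring
    have g3 : 2 * (2 * T) * (4 * T) = 16 * T ^ 2 := by ring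
    have g4 : 36 * l * T ^ 3 = 36 * (l * T ^ 3) := by ring
    linarith
  have hcη : η ^ 2 * T ^ 2 ≤ c ^ 2 := by
    rw [← sq_abs c, ← mul_pow]; gcongr
  have hcpos : 0 < c ^ 2 := lt_of_lt_of_le (by positivity) hcη
  have e6 : c ^ 2 * |d ^ 2 - d' ^ 2| ≤ c ^ 2 * (3 * κ * T ^ 2 + 36 * l * T / η ^ 2 + 16 / η ^ 2) := by
    calc c ^ 2 * |d ^ 2 - d' ^ 2| ≤ (a ^ 2 + c ^ 2) * |d ^ 2 - d' ^ 2| := by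
          gcongr; nlinarith [sq_nonneg a]
      _ ≤ _ := e5
      _ = c ^ 2 * (3 * κ * T ^ 2) + (η ^ 2 * T ^ 2) * (36 * l * T / η ^ 2 + 16 / η ^ 2) := by
          field_simp
          ring
      _ ≤ c ^ 2 * (3 * κ * T ^ 2) + c ^ 2 * (36 * l * T / η ^ 2 + 16 / η ^ 2) := by gcongr
      _ = _ := by ring
  exact le_of_mul_le_mul_left e6 hcpos

theorem card_ediv_le (J : Finset ℤ) (H : ℤ) (hH : 0 < H) (P : ℤ → Prop) (D : ℝ) (hD : 0 ≤ D)
    (hJ : ∀ j ∈ J, ∃ d, P d ∧ d / H = j)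
    (hP : ∀ d d', P d → P d' → |(d : ℝ) - d'| ≤ D) : (J.card : ℝ) ≤ D / H + 2 := by
  have hH' : (0 : ℝ) < H := by exact_mod_cast hH
  have h := card_le_of_dvd_sub_of_abs_sub_le J 1 one_pos (D / H + 1) (by positivity)
    (fun _ _ _ _ => one_dvd _) (fun x hx y hy => ?_)
  · push_cast at h; linarith
  · obtain ⟨d, hd, rfl⟩ := hJ x hx
    obtain ⟨d', hd', rfl⟩ := hJ y hy
    have h1 := hP d d' hd hd'
    have e1 := Int.mul_ediv_add_emod d H
    have e2 := Int.mul_ediv_add_emod d' H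
    have k1 := Int.emod_nonneg d hH.ne'
    have k2 := Int.emod_lt_of_pos d hH
    have k3 := Int.emod_nonneg d' hH.ne'
    have k4 := Int.emod_lt_of_pos d' hH
    have e1' : (H : ℝ) * (d / H : ℤ) + (d % H : ℤ) = d := by exact_mod_cast e1
    have e2' : (H : ℝ) * (d' / H : ℤ) + (d' % H : ℤ) = d' := by exact_mod_cast e2
    have k1' : (0 : ℝ) ≤ (d % H : ℤ) := by exact_mod_cast k1
    have k2' : ((d % H : ℤ) : ℝ) < H := by exact_mod_cast k2
    have k3' : (0 : ℝ) ≤ (d' % H : ℤ) := by exact_mod_cast k3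
    have k4' : ((d' % H : ℤ) : ℝ) < H := by exact_mod_cast k4
    have h2 := abs_le.mp h1
    have h3 : D / H * H = D := div_mul_cancel₀ _ hH'.ne'
    rw [abs_le]
    constructor
    · refine le_of_mul_le_mul_left ?_ hH'
      nlinarith
    · refine le_of_mul_le_mul_left ?_ hH'
      nlinarith

theorem card_image_ediv_le {α : Type*} (S : Finset α) (g : α → ℤ) (H : ℤ) (hH : 0 < H) (X : ℝ)
    (hX : 0 ≤ X) (hg : ∀ γ ∈ S, |(g γ : ℝ)| ≤ X) :
    ((S.image fun γ => g γ / H).card : ℝ) ≤ 2 * X / H + 2 := by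
  refine card_ediv_le _ H hH (fun a => |(a : ℝ)| ≤ X) (2 * X) (by linarith) ?_ ?_
  · intro j hj
    obtain ⟨γ, hγ, rfl⟩ := Finset.mem_image.mp hj
    exact ⟨_, hg γ hγ, rfl⟩
  · intro d d' hd hd'
    exact (abs_sub _ _).trans (by linarith)

theorem abs_sub_le_of_abs_sq_sub_sq_le {x y δ T : ℝ} (hδ : 0 ≤ δ * T) (h : |x ^ 2 - y ^ 2| ≤ (δ * T) ^ 2)
    (hxy : 0 ≤ x ∧ 0 ≤ y ∨ x < 0 ∧ y < 0) : |x - y| ≤ δ * T := by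
  refine abs_le_of_sq_le_sq ?_ hδ
  refine le_trans ?_ h
  have h1 : x ^ 2 - y ^ 2 = (x - y) * (x + y) := by ring
  rw [h1, abs_mul, ← sq_abs (x - y), sq]
  refine mul_le_mul_of_nonneg_left ?_ (abs_nonneg _)
  rcases hxy with ⟨h2, h3⟩ | ⟨h2, h3⟩
  · rw [abs_of_nonneg (by linarith : 0 ≤ x + y), abs_le]; constructor <;> linarith
  · rw [abs_of_neg (by linarith : x + y < 0), abs_le]; constructor <;> linarith

set_option maxHeartbeats 2000000 in
/-- Thin shells contain a small proportion of all matrices. -/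
theorem exists_card_shell_le (ε : ℝ) (hε : 0 < ε) : ∃ κ : ℝ, 0 < κ ∧ κ ≤ 1 ∧
    ∀ᶠ T : ℝ in atTop, ((frobBall ((1 + κ) * T) \ frobBall T).card : ℝ) ≤ ε * T ^ 2 := by
  obtain ⟨η, hη0, hη1, hη⟩ := exists_small_lower_left (ε / 2) 2 (by linarith) (by norm_num)
  obtain ⟨C, hC0, hC⟩ := exists_ncard_boxSet_le
  set δ := ε * η / 3200 with hδ
  have hδ0 : 0 < δ := by positivity
  set μ := min (min 1 η) (min δ (δ ^ 2 * η ^ 2 / 108)) with hμ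
  have hμ0 : 0 < μ := lt_min (lt_min one_pos hη0) (lt_min hδ0 (by positivity))
  have hμ1 : μ ≤ 1 := (min_le_left _ _).trans (min_le_left _ _)
  have hμη : μ ≤ η := (min_le_left _ _).trans (min_le_right _ _)
  have hμδ : μ ≤ δ := (min_le_right _ _).trans (min_le_left _ _)
  have hμδ2 : μ ≤ δ ^ 2 * η ^ 2 / 108 := (min_le_right _ _).trans (min_le_right _ _)
  set κ := min 1 (δ ^ 2 / 9) with hκ
  have hκ0 : 0 < κ := lt_min one_pos (by positivity)
  have hκ1 : κ ≤ 1 := min_le_left _ _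
  have hκ2 : κ ≤ δ ^ 2 / 9 := min_le_right _ _
  refine ⟨κ, hκ0, hκ1, ?_⟩
  have hlim : Tendsto (fun T : ℝ => T * T) atTop atTop := tendsto_id.atTop_mul_atTop₀ tendsto_id
  filter_upwards [hη, eventually_ge_atTop 1, eventually_ge_atTop (2 / μ),
    hlim.eventually_ge_atTop (48 / (η ^ 2 * δ ^ 2)),
    eventually_mul_rpow_le (10 * (10 / μ) * (4 * (δ + μ) / μ) * (C * 2 ^ (7 / 8 : ℝ))) (ε / 4) (15 / 8)
      (by linarith) (by norm_num)] with T hTη hT1 hTμ hTδ hTC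
  have hT0 : 0 < T := by linarith
  classical
  set S := frobBall ((1 + κ) * T) \ frobBall T with hS
  have hball : ∀ γ ∈ S, γ ∈ frobBall (2 * T) := by
    intro γ hγ
    exact frobBall_mono (by nlinarith) (Finset.mem_sdiff.mp hγ).1
  set S' := S.filter fun γ => η * T < |(γ 1 0 : ℝ)| with hS'
  have hsmall : ((S.filter fun γ => ¬ η * T < |(γ 1 0 : ℝ)|).card : ℝ) ≤ ε / 2 * T ^ 2 := by
    apply hTη
    intro γ hγ
    rw [Finset.mem_filter] at hγ
    exact ⟨hball γ hγ.1, not_lt.mp hγ.2⟩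
  have hsplit : (S.card : ℝ) = S'.card + (S.filter fun γ => ¬ η * T < |(γ 1 0 : ℝ)|).card := by
    rw [hS', ← Nat.cast_add, Finset.card_filter_add_card_filter_not]
  suffices hmain : (S'.card : ℝ) ≤ ε / 2 * T ^ 2 by rw [hsplit]; linarith
  set l := ⌊μ * T⌋₊ with hl
  have hμT : 2 ≤ μ * T := by rw [div_le_iff₀ hμ0] at hTμ; linarith
  have hl1 : 1 ≤ l := Nat.le_floor (by push_cast; linarith)
  have hlle : (l : ℝ) ≤ μ * T := Nat.floor_le (by positivity)
  have hlge : μ * T / 2 ≤ l := by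
    have := Nat.lt_floor_add_one (μ * T)
    rw [← hl] at this; linarith
  have hl0 : (0 : ℝ) < l := by exact_mod_cast hl1
  have hlZ : (0 : ℤ) < ((1 * l : ℕ) : ℤ) := by omega
  have hlR : (((1 * l : ℕ) : ℤ) : ℝ) = l := by push_cast; ring
  -- the fibres
  have hfib : ∀ b ∈ S'.image (fun γ : SL2Z => ((γ 1 0, γ 0 0 / ((1 * l : ℕ) : ℤ)), γ 1 1 / ((1 * l : ℕ) : ℤ))),
      ((S'.filter fun γ : SL2Z => ((γ 1 0, γ 0 0 / ((1 * l : ℕ) : ℤ)), γ 1 1 / ((1 * l : ℕ) : ℤ)) = b).card : ℝ)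
        ≤ μ ^ 2 * T / η + C * 2 ^ (7 / 8 : ℝ) * T ^ (7 / 8 : ℝ) := by
    intro b hb
    obtain ⟨γ₀, hγ₀, rfl⟩ := Finset.mem_image.mp hb
    rw [Finset.mem_filter] at hγ₀
    have hcT : ((γ₀ 1 0).natAbs : ℝ) ≤ 2 * T := by
      rw [Nat.cast_natAbs, Int.cast_abs]; exact abs_entry_le_of_mem (hball γ₀ hγ₀.1) 1 0
    have hcη : η * T < ((γ₀ 1 0).natAbs : ℝ) := by
      rw [Nat.cast_natAbs, Int.cast_abs]; exact hγ₀.2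
    have hc0 : γ₀ 1 0 ≠ 0 := by
      intro h; rw [h] at hcη; simp at hcη; nlinarith
    have hlc : l ≤ (γ₀ 1 0).natAbs := by
      have : (l : ℝ) ≤ ((γ₀ 1 0).natAbs : ℝ) := by nlinarith
      exact_mod_cast this
    have hbox := hC 1 l 0 0 (γ₀ 1 0) (γ₀ 0 0 / ((1 * l : ℕ) : ℤ)) (γ₀ 1 1 / ((1 * l : ℕ) : ℤ)) hl1 hc0
      (by simpa using isCoprime_one_right) hlc
    have hfin := (boxSet_eq_image (q := 1) hl1 0 0 (γ₀ 1 0) (γ₀ 0 0 / ((1 * l : ℕ) : ℤ))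
      (γ₀ 1 1 / ((1 * l : ℕ) : ℤ)) hc0).1
    have hsub : (S'.filter fun γ : SL2Z => ((γ 1 0, γ 0 0 / ((1 * l : ℕ) : ℤ)), γ 1 1 / ((1 * l : ℕ) : ℤ)) =
        ((γ₀ 1 0, γ₀ 0 0 / ((1 * l : ℕ) : ℤ)), γ₀ 1 1 / ((1 * l : ℕ) : ℤ))).card ≤
        (boxSet 1 ((1 * l : ℕ) : ℤ) 0 0 (γ₀ 1 0) (γ₀ 0 0 / ((1 * l : ℕ) : ℤ))
          (γ₀ 1 1 / ((1 * l : ℕ) : ℤ))).ncard := by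
      rw [← Set.ncard_coe_finset]
      apply Set.ncard_le_ncard _ hfin
      intro γ hγ
      rw [Finset.mem_coe, Finset.mem_filter] at hγ
      obtain ⟨-, h⟩ := hγ
      rw [Prod.mk.injEq, Prod.mk.injEq] at h
      exact ⟨h.1.1, h.1.2, h.2, Subsingleton.elim _ _, Subsingleton.elim _ _⟩
    calc _ ≤ ((boxSet 1 ((1 * l : ℕ) : ℤ) 0 0 (γ₀ 1 0) (γ₀ 0 0 / ((1 * l : ℕ) : ℤ))
          (γ₀ 1 1 / ((1 * l : ℕ) : ℤ))).ncard : ℝ) := by exact_mod_cast hsub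
      _ ≤ _ := hbox
      _ ≤ (μ * T) ^ 2 / (η * T) + C * (2 * T) ^ (7 / 8 : ℝ) := by gcongr
      _ = _ := by
        rw [Real.mul_rpow (by norm_num) hT0.le]; field_simp
  have hcard := card_le_card_mul_of_fibers S' _ _ (fun x hx => Finset.mem_image_of_mem _ hx) _ hfib
  -- the number of boxes
  have hI : ((S'.image fun γ : SL2Z => γ 0 0 / ((1 * l : ℕ) : ℤ)).card : ℝ) ≤ 10 / μ := by
    have h := card_image_ediv_le S' (fun γ : SL2Z => γ 0 0) ((1 * l : ℕ) : ℤ) hlZ (2 * T) (by linarith)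
      (fun γ hγ => abs_entry_le_of_mem (hball γ (Finset.mem_filter.mp hγ).1) 0 0)
    rw [hlR] at h
    refine h.trans ?_
    have h1 : 2 * (2 * T) / l ≤ 8 / μ := by
      rw [div_le_div_iff₀ hl0 hμ0]; nlinarith
    have h2 : 2 ≤ 2 / μ := by rw [le_div_iff₀ hμ0]; linarith
    calc _ ≤ 8 / μ + 2 / μ := by linarith
      _ = _ := by ring
  have hcI : ((S'.image fun γ : SL2Z => (γ 1 0, γ 0 0 / ((1 * l : ℕ) : ℤ))).card : ℝ) ≤
      10 * T * (10 / μ) := by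
    have h1 : (S'.image fun γ : SL2Z => (γ 1 0, γ 0 0 / ((1 * l : ℕ) : ℤ))) ⊆
        Finset.Icc (-⌈2 * T⌉) ⌈2 * T⌉ ×ˢ (S'.image fun γ : SL2Z => γ 0 0 / ((1 * l : ℕ) : ℤ)) := by
      intro x hx
      obtain ⟨γ, hγ, rfl⟩ := Finset.mem_image.mp hx
      rw [Finset.mem_product]
      exact ⟨mem_Icc_ceil_of_abs_le (abs_entry_le_of_mem (hball γ (Finset.mem_filter.mp hγ).1) 1 0),
        Finset.mem_image_of_mem _ hγ⟩
    calc _ ≤ ((Finset.Icc (-⌈2 * T⌉) ⌈2 * T⌉ ×ˢ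
          (S'.image fun γ : SL2Z => γ 0 0 / ((1 * l : ℕ) : ℤ))).card : ℝ) := by
          exact_mod_cast Finset.card_le_card h1
      _ ≤ _ := by
          rw [Finset.card_product, Nat.cast_mul]
          have := card_Icc_ceil_le (T := 2 * T) (by linarith)
          gcongr
          linarith
  have hdd : ∀ γ ∈ S', ∀ γ' ∈ S', γ 1 0 = γ' 1 0 → γ 0 0 / ((1 * l : ℕ) : ℤ) = γ' 0 0 / ((1 * l : ℕ) : ℤ) →
      (0 ≤ γ 1 1 ∧ 0 ≤ γ' 1 1 ∨ γ 1 1 < 0 ∧ γ' 1 1 < 0) → |(γ 1 1 : ℝ) - γ' 1 1| ≤ δ * T := by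
    intro γ hγ γ' hγ' hcc hii hsg
    rw [Finset.mem_filter] at hγ hγ'
    have b := hball γ hγ.1
    have b' := hball γ' hγ'.1
    have s := Finset.mem_sdiff.mp hγ.1
    have s' := Finset.mem_sdiff.mp hγ'.1
    rw [mem_frobBall, mem_frobBall, not_le] at s s'
    have haa : |(γ' 0 0 : ℝ) - γ 0 0| ≤ l := by
      have e1 := Int.mul_ediv_add_emod (γ 0 0) ((1 * l : ℕ) : ℤ)
      have e2 := Int.mul_ediv_add_emod (γ' 0 0) ((1 * l : ℕ) : ℤ)
      have k1 := Int.emod_nonneg (γ 0 0) hlZ.ne'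
      have k2 := Int.emod_lt_of_pos (γ 0 0) hlZ
      have k3 := Int.emod_nonneg (γ' 0 0) hlZ.ne'
      have k4 := Int.emod_lt_of_pos (γ' 0 0) hlZ
      rw [← hii] at e2
      have : |γ' 0 0 - γ 0 0| ≤ ((1 * l : ℕ) : ℤ) := by rw [abs_le]; constructor <;> linarith
      have h2 : ((|γ' 0 0 - γ 0 0| : ℤ) : ℝ) ≤ (((1 * l : ℕ) : ℤ) : ℝ) := by exact_mod_cast this
      rw [hlR] at h2; push_cast at h2; exact h2
    have hP' := frobNorm_sq_mul_sq γ'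
    rw [← hcc] at hP'
    have key := abs_sq_sub_sq_le_of_shell hT1 hκ0.le hκ1 hη0 hγ.2.le (abs_entry_le_of_mem b 0 0)
      (abs_entry_le_of_mem b' 0 0) (abs_entry_le_of_mem b 1 1) (abs_entry_le_of_mem b' 1 1)
      (abs_entry_le_of_mem b 1 0) haa s.2 s.1 s'.2 s'.1 (frobNorm_sq_mul_sq γ) hP'
    apply abs_sub_le_of_abs_sq_sub_sq_le (by positivity)
    · refine key.trans ?_
      have a1 : 3 * κ * T ^ 2 ≤ 3 * (δ ^ 2 / 9) * T ^ 2 := by gcongr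
      have a2 : 36 * (l : ℝ) * T / η ^ 2 ≤ 36 * (δ ^ 2 * η ^ 2 / 108 * T) * T / η ^ 2 := by
        gcongr
        exact hlle.trans (by gcongr)
      have a3 : 16 / η ^ 2 ≤ δ ^ 2 / 3 * T ^ 2 := by
        rw [div_le_iff₀ (by positivity)] at hTδ
        rw [div_le_iff₀ (by positivity)]
        nlinarith
      have a4 : 36 * (δ ^ 2 * η ^ 2 / 108 * T) * T / η ^ 2 = δ ^ 2 / 3 * T ^ 2 := by
        field_simp; ring
      nlinarith
    · rcases hsg with h | h
      · left; exact ⟨by exact_mod_cast h.1, by exact_mod_cast h.2⟩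
      · right; exact ⟨by exact_mod_cast h.1, by exact_mod_cast h.2⟩
  have hB2 : δ * T / l + 2 ≤ 2 * (δ + μ) / μ := by
    have h1 : δ * T / l ≤ 2 * δ / μ := by
      rw [div_le_div_iff₀ hl0 hμ0]; nlinarith
    calc _ ≤ 2 * δ / μ + 2 := by linarith
      _ = _ := by field_simp
  have hJ : ∀ e ∈ S'.image (fun γ : SL2Z => (γ 1 0, γ 0 0 / ((1 * l : ℕ) : ℤ))),
      (((S'.image (fun γ : SL2Z => ((γ 1 0, γ 0 0 / ((1 * l : ℕ) : ℤ)), γ 1 1 / ((1 * l : ℕ) : ℤ)))).filter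
        fun x => x.1 = e).card : ℝ) ≤ 4 * (δ + μ) / μ := by
    intro e he
    set F := S'.filter fun γ : SL2Z => (γ 1 0, γ 0 0 / ((1 * l : ℕ) : ℤ)) = e with hF
    have hsub : ((S'.image (fun γ : SL2Z => ((γ 1 0, γ 0 0 / ((1 * l : ℕ) : ℤ)), γ 1 1 / ((1 * l : ℕ) : ℤ)))).filter
        fun x => x.1 = e) ⊆
        (((F.filter fun γ => 0 ≤ γ 1 1).image fun γ : SL2Z => γ 1 1 / ((1 * l : ℕ) : ℤ)) ∪
        ((F.filter fun γ => γ 1 1 < 0).image fun γ : SL2Z => γ 1 1 / ((1 * l : ℕ) : ℤ))).image fun j => (e, j) := by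
      intro x hx
      rw [Finset.mem_filter, Finset.mem_image] at hx
      obtain ⟨⟨γ, hγ, rfl⟩, hx2⟩ := hx
      have hγF : γ ∈ F := Finset.mem_filter.mpr ⟨hγ, hx2⟩
      rw [Finset.mem_image]
      refine ⟨γ 1 1 / ((1 * l : ℕ) : ℤ), ?_, by rw [← hx2]⟩
      rw [Finset.mem_union]
      rcases le_or_gt 0 (γ 1 1) with h | h
      · left; exact Finset.mem_image_of_mem _ (Finset.mem_filter.mpr ⟨hγF, h⟩)
      · right; exact Finset.mem_image_of_mem _ (Finset.mem_filter.mpr ⟨hγF, h⟩)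
    have hhalf : ∀ P : ℤ → Prop, [DecidablePred P] → (∀ x y, P x → P y → (0 ≤ x ∧ 0 ≤ y ∨ x < 0 ∧ y < 0)) →
        (((F.filter fun γ => P (γ 1 1)).image fun γ : SL2Z => γ 1 1 / ((1 * l : ℕ) : ℤ)).card : ℝ) ≤
          2 * (δ + μ) / μ := by
      intro P _ hP
      refine le_trans ?_ hB2
      rw [← hlR]
      refine card_ediv_le _ _ hlZ (fun d => ∃ γ ∈ F, P (γ 1 1) ∧ γ 1 1 = d) (δ * T) (by positivity) ?_ ?_
      · intro j hj
        obtain ⟨γ, hγ, rfl⟩ := Finset.mem_image.mp hj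
        rw [Finset.mem_filter] at hγ
        exact ⟨_, ⟨γ, hγ.1, hγ.2, rfl⟩, rfl⟩
      · rintro _ _ ⟨γ, hγ, hPγ, rfl⟩ ⟨γ', hγ', hPγ', rfl⟩
        rw [hF, Finset.mem_filter] at hγ hγ'
        have h := hγ.2.trans hγ'.2.symm
        rw [Prod.mk.injEq] at h
        exact hdd γ hγ.1 γ' hγ'.1 h.1 h.2 (hP _ _ hPγ hPγ')
    have h1 := hhalf (fun d => 0 ≤ d) (fun x y hx hy => Or.inl ⟨hx, hy⟩)
    have h2 := hhalf (fun d => d < 0) (fun x y hx hy => Or.inr ⟨hx, hy⟩)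
    have h3 := (Finset.card_le_card hsub).trans (Finset.card_image_le.trans (Finset.card_union_le _ _))
    calc _ ≤ 2 * (δ + μ) / μ + 2 * (δ + μ) / μ := by
          refine le_trans (by exact_mod_cast h3) (add_le_add h1 h2)
      _ = _ := by ring
  have hboxes := card_le_card_mul_of_fibers
    (S'.image (fun γ : SL2Z => ((γ 1 0, γ 0 0 / ((1 * l : ℕ) : ℤ)), γ 1 1 / ((1 * l : ℕ) : ℤ))))
    Prod.fst (S'.image (fun γ : SL2Z => (γ 1 0, γ 0 0 / ((1 * l : ℕ) : ℤ))))
    (fun x hx => by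
      obtain ⟨γ, hγ, rfl⟩ := Finset.mem_image.mp hx
      exact Finset.mem_image_of_mem _ hγ) _ hJ
  have hT15 : T * T ^ (7 / 8 : ℝ) = T ^ (15 / 8 : ℝ) := by
    rw [← Real.rpow_one_add' hT0.le (by norm_num)]; norm_num
  calc (S'.card : ℝ) ≤ _ := hcard
    _ ≤ (10 * T * (10 / μ) * (4 * (δ + μ) / μ)) *
        (μ ^ 2 * T / η + C * 2 ^ (7 / 8 : ℝ) * T ^ (7 / 8 : ℝ)) := by
      gcongr
      exact hboxes.trans (by gcongr)
    _ = 400 * (δ + μ) / η * T ^ 2 + 10 * (10 / μ) * (4 * (δ + μ) / μ) * (C * 2 ^ (7 / 8 : ℝ)) *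
        (T * T ^ (7 / 8 : ℝ)) := by field_simp; ring
    _ ≤ 400 * (δ + δ) / η * T ^ 2 + ε / 4 * T ^ 2 := by
      rw [hT15]
      gcongr
    _ = _ := by rw [hδ]; field_simp; ring

theorem frobNorm_le_add {γ γ' : SL2Z} {E : ℝ} (hE : 0 ≤ E)
    (h : ∀ i j, |(γ i j : ℝ) - γ' i j| ≤ E) : frobNorm γ ≤ frobNorm γ' + 2 * E := by
  have hn := frobNorm_nonneg γ'
  refine abs_le_of_sq_le_sq' ?_ (by linarith) |>.2
  have hsq := frobNorm_sq γ'
  rw [frobNorm_sq]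
  have key : ∀ i j, (γ i j : ℝ) ^ 2 ≤ (γ' i j : ℝ) ^ 2 + 2 * E * |(γ' i j : ℝ)| + E ^ 2 := by
    intro i j
    have h1 : |(γ i j : ℝ)| ≤ |(γ' i j : ℝ)| + E := by
      have h2 := abs_add_le ((γ i j : ℝ) - γ' i j) (γ' i j)
      rw [sub_add_cancel] at h2
      linarith [h i j]
    have h3 : (γ i j : ℝ) ^ 2 ≤ (|(γ' i j : ℝ)| + E) ^ 2 := by
      rw [← sq_abs (γ i j : ℝ)]; gcongr
    rw [← sq_abs (γ' i j : ℝ)]; linarith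
  have hsum : |(γ' 0 0 : ℝ)| + |(γ' 0 1 : ℝ)| + |(γ' 1 0 : ℝ)| + |(γ' 1 1 : ℝ)| ≤ 2 * frobNorm γ' := by
    refine abs_le_of_sq_le_sq' ?_ (by linarith) |>.2
    rw [mul_pow, hsq, ← sq_abs (γ' 0 0 : ℝ), ← sq_abs (γ' 0 1 : ℝ), ← sq_abs (γ' 1 0 : ℝ),
      ← sq_abs (γ' 1 1 : ℝ)]
    nlinarith [sq_nonneg (|(γ' 0 0 : ℝ)| - |(γ' 0 1 : ℝ)|), sq_nonneg (|(γ' 0 0 : ℝ)| - |(γ' 1 0 : ℝ)|),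
      sq_nonneg (|(γ' 0 0 : ℝ)| - |(γ' 1 1 : ℝ)|), sq_nonneg (|(γ' 0 1 : ℝ)| - |(γ' 1 0 : ℝ)|),
      sq_nonneg (|(γ' 0 1 : ℝ)| - |(γ' 1 1 : ℝ)|), sq_nonneg (|(γ' 1 0 : ℝ)| - |(γ' 1 1 : ℝ)|)]
  nlinarith [key 0 0, key 0 1, key 1 0, key 1 1, mul_le_mul_of_nonneg_left hsum hE]

theorem SL2Z_mul_apply (γ δ : SL2Z) (i j : Fin 2) : (γ * δ) i j = γ i 0 * δ 0 j + γ i 1 * δ 1 j := by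
  rw [Matrix.SpecialLinearGroup.coe_mul, Matrix.mul_apply, Fin.sum_univ_two]

theorem abs_mul_entry_sub_le {γ₁ γ γ' : SL2Z} {R E : ℝ} (hR : ∀ i j, |(γ₁ i j : ℝ)| ≤ R)
    (h : ∀ i j, |(γ i j : ℝ) - γ' i j| ≤ E) (i j : Fin 2) :
    |((γ₁ * γ) i j : ℝ) - (γ₁ * γ') i j| ≤ 2 * R * E := by
  have hR0 : 0 ≤ R := (abs_nonneg _).trans (hR 0 0)
  rw [SL2Z_mul_apply, SL2Z_mul_apply]
  push_cast
  have h1 : (γ₁ i 0 : ℝ) * γ 0 j + γ₁ i 1 * γ 1 j - (γ₁ i 0 * γ' 0 j + γ₁ i 1 * γ' 1 j) =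
      γ₁ i 0 * (γ 0 j - γ' 0 j) + γ₁ i 1 * (γ 1 j - γ' 1 j) := by ring
  rw [h1]
  refine (abs_add_le _ _).trans ?_
  rw [abs_mul, abs_mul]
  have e1 : |(γ₁ i 0 : ℝ)| * |(γ 0 j : ℝ) - γ' 0 j| ≤ R * E := by gcongr; exacts [hR i 0, h 0 j]
  have e2 : |(γ₁ i 1 : ℝ)| * |(γ 1 j : ℝ) - γ' 1 j| ≤ R * E := by gcongr; exacts [hR i 1, h 1 j]
  linarith

theorem frobNorm_le_of_entries {γ : SL2Z} {X : ℝ} (h : ∀ i j, |(γ i j : ℝ)| ≤ X) :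
    frobNorm γ ≤ 2 * X := by
  have hX : 0 ≤ X := (abs_nonneg _).trans (h 0 0)
  refine abs_le_of_sq_le_sq' ?_ (by linarith) |>.2
  rw [frobNorm_sq]
  have key : ∀ i j, (γ i j : ℝ) ^ 2 ≤ X ^ 2 := fun i j => by
    rw [← sq_abs]; have := h i j; gcongr
  nlinarith [key 0 0, key 0 1, key 1 0, key 1 1]

theorem frobNorm_mul_le_of_entries {γ₁ γ : SL2Z} {R : ℝ} (hR : ∀ i j, |(γ₁ i j : ℝ)| ≤ R) :
    frobNorm (γ₁ * γ) ≤ 4 * R * frobNorm γ := by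
  have hR0 : 0 ≤ R := (abs_nonneg _).trans (hR 0 0)
  have : ∀ i j, |((γ₁ * γ) i j : ℝ)| ≤ 2 * R * frobNorm γ := by
    intro i j
    rw [SL2Z_mul_apply]; push_cast
    refine (abs_add_le _ _).trans ?_
    rw [abs_mul, abs_mul]
    have e1 : |(γ₁ i 0 : ℝ)| * |(γ 0 j : ℝ)| ≤ R * frobNorm γ := by
      gcongr; exacts [hR i 0, abs_entry_le_frobNorm _ _ _]
    have e2 : |(γ₁ i 1 : ℝ)| * |(γ 1 j : ℝ)| ≤ R * frobNorm γ := by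
      gcongr; exacts [hR i 1, abs_entry_le_frobNorm _ _ _]
    linarith
  refine (frobNorm_le_of_entries this).trans (by linarith)

theorem exists_entry_bound (γ : SL2Z) : ∃ R : ℝ, 1 ≤ R ∧ (∀ i j, |(γ i j : ℝ)| ≤ R) ∧
    ∀ i j, |((γ⁻¹ : SL2Z) i j : ℝ)| ≤ R :=
  ⟨1 + frobNorm γ + frobNorm γ⁻¹, by linarith [frobNorm_nonneg γ, frobNorm_nonneg γ⁻¹],
    fun i j => by linarith [abs_entry_le_frobNorm γ i j, frobNorm_nonneg γ⁻¹],
    fun i j => by linarith [abs_entry_le_frobNorm γ⁻¹ i j, frobNorm_nonneg γ]⟩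

/-- Reduction modulo `q`. -/
def redMod (q : ℕ) : SL2Z →* Matrix.SpecialLinearGroup (Fin 2) (ZMod q) :=
  Matrix.SpecialLinearGroup.map (Int.castRingHom (ZMod q))

theorem redMod_apply (q : ℕ) (γ : SL2Z) (i j : Fin 2) : redMod q γ i j = ((γ i j : ℤ) : ZMod q) := rfl

theorem redMod_eq_of_isUnit {q : ℕ} {γ : SL2Z} {g : Matrix.SpecialLinearGroup (Fin 2) (ZMod q)}
    (hu : IsUnit (g 1 0)) (h00 : ((γ 0 0 : ℤ) : ZMod q) = g 0 0) (h10 : ((γ 1 0 : ℤ) : ZMod q) = g 1 0)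
    (h11 : ((γ 1 1 : ℤ) : ZMod q) = g 1 1) : redMod q γ = g := by
  have hg : g 0 0 * g 1 1 - g 0 1 * g 1 0 = 1 := by
    have := g.det_coe; rwa [Matrix.det_fin_two] at this
  have hγ : ((γ 0 0 : ℤ) : ZMod q) * ((γ 1 1 : ℤ) : ZMod q) - ((γ 0 1 : ℤ) : ZMod q) * ((γ 1 0 : ℤ) : ZMod q) = 1 := by
    exact_mod_cast congrArg (Int.cast (R := ZMod q)) (SL2Z_det γ)
  have h01 : ((γ 0 1 : ℤ) : ZMod q) = g 0 1 := by
    rw [h00, h10, h11] at hγ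
    apply hu.mul_right_cancel
    linear_combination hg - hγ
  apply Subtype.ext
  ext i j
  fin_cases i <;> fin_cases j
  · exact h00
  · exact h01
  · exact h10
  · exact h11

/-- The matrices in the ball of radius `T` reducing to `g` modulo `q`. -/
def congBall (q : ℕ) (T : ℝ) (g : Matrix.SpecialLinearGroup (Fin 2) (ZMod q)) : Finset SL2Z := by
  classical exact (frobBall T).filter fun γ => redMod q γ = g

theorem mem_congBall {q : ℕ} {T : ℝ} {g : Matrix.SpecialLinearGroup (Fin 2) (ZMod q)} {γ : SL2Z} :
    γ ∈ congBall q T g ↔ frobNorm γ ≤ T ∧ redMod q γ = g := by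
  rw [congBall, Finset.mem_filter, mem_frobBall]

/-- The matrices `γ` with `γ₁ γ` in the ball of radius `T` reducing to `g` modulo `q`. -/
def shiftBall (q : ℕ) (γ₁ : SL2Z) (T : ℝ) (g : Matrix.SpecialLinearGroup (Fin 2) (ZMod q)) :
    Finset SL2Z :=
  (congBall q T (redMod q γ₁ * g)).map (mulLeftEmbedding γ₁⁻¹)

theorem card_shiftBall {q : ℕ} (γ₁ : SL2Z) (T : ℝ) (g : Matrix.SpecialLinearGroup (Fin 2) (ZMod q)) :
    (shiftBall q γ₁ T g).card = (congBall q T (redMod q γ₁ * g)).card := Finset.card_map _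

theorem mem_shiftBall {q : ℕ} {γ₁ : SL2Z} {T : ℝ} {g : Matrix.SpecialLinearGroup (Fin 2) (ZMod q)}
    {γ : SL2Z} : γ ∈ shiftBall q γ₁ T g ↔ frobNorm (γ₁ * γ) ≤ T ∧ redMod q γ = g := by
  rw [shiftBall, Finset.mem_map]
  constructor
  · rintro ⟨δ, hδ, rfl⟩
    rw [mem_congBall] at hδ
    rw [mulLeftEmbedding_apply, mul_inv_cancel_left, map_mul, map_inv, hδ.2, inv_mul_cancel_left]
    exact ⟨hδ.1, rfl⟩
  · rintro ⟨h1, h2⟩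
    refine ⟨γ₁ * γ, ?_, by rw [mulLeftEmbedding_apply, inv_mul_cancel_left]⟩
    rw [mem_congBall, map_mul, h2]
    exact ⟨h1, rfl⟩

theorem abs_sub_le_of_ediv_eq {a a' H : ℤ} (hH : 0 < H) (h : a / H = a' / H) :
    |(a : ℝ) - a'| ≤ H := by
  have e1 := Int.mul_ediv_add_emod a H
  have e2 := Int.mul_ediv_add_emod a' H
  have k1 := Int.emod_nonneg a hH.ne'
  have k2 := Int.emod_lt_of_pos a hH
  have k3 := Int.emod_nonneg a' hH.ne'
  have k4 := Int.emod_lt_of_pos a' hH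
  rw [← h] at e2
  have : |a - a'| ≤ H := by rw [abs_le]; constructor <;> linarith
  exact_mod_cast this

theorem abs_entry_sub_le_of_box {γ γ₀ : SL2Z} {X Y c₀ : ℝ} (hc : γ 1 0 = γ₀ 1 0)
    (hc₀ : 0 < c₀) (hc₀' : c₀ ≤ |(γ₀ 1 0 : ℝ)|) (hYX : Y ≤ X) (hX : ∀ i j, |(γ₀ i j : ℝ)| ≤ X)
    (ha : |(γ 0 0 : ℝ) - γ₀ 0 0| ≤ Y) (hd : |(γ 1 1 : ℝ) - γ₀ 1 1| ≤ Y) (i j : Fin 2) :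
    |(γ i j : ℝ) - γ₀ i j| ≤ 3 * X * Y / c₀ := by
  have hY0 : 0 ≤ Y := (abs_nonneg _).trans ha
  have hX0 : 0 ≤ X := hY0.trans hYX
  have hcX : c₀ ≤ X := hc₀'.trans (hX 1 0)
  have hY3 : Y ≤ 3 * X * Y / c₀ := by
    rw [le_div_iff₀ hc₀]; nlinarith [mul_nonneg hX0 hY0]
  have hdet : (γ 0 0 : ℝ) * γ 1 1 - γ 0 1 * γ 1 0 = 1 := by exact_mod_cast SL2Z_det γ
  have hdet₀ : (γ₀ 0 0 : ℝ) * γ₀ 1 1 - γ₀ 0 1 * γ₀ 1 0 = 1 := by exact_mod_cast SL2Z_det γ₀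
  have hb : |(γ 0 1 : ℝ) - γ₀ 0 1| ≤ 3 * X * Y / c₀ := by
    rw [le_div_iff₀ hc₀]
    have h1 : ((γ 0 1 : ℝ) - γ₀ 0 1) * γ₀ 1 0 =
        (γ 0 0 - γ₀ 0 0) * γ 1 1 + γ₀ 0 0 * (γ 1 1 - γ₀ 1 1) := by
      rw [hc] at hdet; linear_combination hdet₀ - hdet
    have hd2 : |(γ 1 1 : ℝ)| ≤ 2 * X := by
      have h2 := abs_add_le ((γ 1 1 : ℝ) - γ₀ 1 1) (γ₀ 1 1)
      rw [sub_add_cancel] at h2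
      linarith [hX 1 1]
    calc |(γ 0 1 : ℝ) - γ₀ 0 1| * c₀ ≤ |(γ 0 1 : ℝ) - γ₀ 0 1| * |(γ₀ 1 0 : ℝ)| := by gcongr
      _ = |((γ 0 0 : ℝ) - γ₀ 0 0) * γ 1 1 + γ₀ 0 0 * (γ 1 1 - γ₀ 1 1)| := by rw [← abs_mul, h1]
      _ ≤ |(γ 0 0 : ℝ) - γ₀ 0 0| * |(γ 1 1 : ℝ)| + |(γ₀ 0 0 : ℝ)| * |(γ 1 1 : ℝ) - γ₀ 1 1| := by
          rw [← abs_mul, ← abs_mul]; exact abs_add_le _ _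
      _ ≤ Y * (2 * X) + X * Y := by gcongr; exact hX 0 0
      _ = _ := by ring
  fin_cases i <;> fin_cases j
  · exact ha.trans hY3
  · exact hb
  · show |(γ 1 0 : ℝ) - γ₀ 1 0| ≤ _
    rw [hc, sub_self, abs_zero]; positivity
  · exact hd.trans hY3

set_option maxHeartbeats 2000000 in
theorem eventually_card_shiftBall_le {q : ℕ} [NeZero q] (γ₁ : SL2Z)
    (g g' : Matrix.SpecialLinearGroup (Fin 2) (ZMod q)) (hgg : g 1 0 = g' 1 0) (hu : IsUnit (g 1 0))
    (ε κ : ℝ) (hε : 0 < ε) (hκ : 0 < κ) :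
    ∀ᶠ T : ℝ in atTop, ((shiftBall q γ₁ T g).card : ℝ) ≤
      (shiftBall q γ₁ ((1 + κ) * T) g').card + ε * T ^ 2 := by
  classical
  obtain ⟨R, hR1, hR, hRi⟩ := exists_entry_bound γ₁
  obtain ⟨η, hη0, hη1, hη⟩ := exists_small_lower_left (ε / 2) (4 * R) (by linarith) (by linarith)
  obtain ⟨C, hC0, hC⟩ := exists_ncard_boxSet_sub_le
  have hR0 : 0 < R := by linarith
  set μ := min η (κ * η / (48 * R ^ 2)) with hμ
  have hμ0 : 0 < μ := lt_min hη0 (by positivity)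
  have hμη : μ ≤ η := min_le_left _ _
  have hμκ : μ ≤ κ * η / (48 * R ^ 2) := min_le_right _ _
  have hq0 : (0 : ℝ) < q := by exact_mod_cast Nat.pos_of_neZero q
  have hq1 : (1 : ℝ) ≤ q := by exact_mod_cast Nat.pos_of_neZero q
  filter_upwards [hη, eventually_ge_atTop 1, eventually_ge_atTop (2 * q / μ),
    eventually_mul_rpow_le (20 * R * (16 * R / μ + 2) ^ 2 * (2 * C * (4 * R) ^ (7 / 8 : ℝ))) (ε / 2)
      (15 / 8) (by linarith) (by norm_num)] with T hTη hT1 hTμ hTC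
  have hT0 : 0 < T := by linarith
  set S := shiftBall q γ₁ T g with hS
  set U := shiftBall q γ₁ ((1 + κ) * T) g' with hU
  have hball : ∀ γ ∈ S, γ ∈ frobBall (4 * R * T) := by
    intro γ hγ
    rw [mem_frobBall]
    have h := frobNorm_mul_le_of_entries (γ := γ₁ * γ) hRi
    rw [inv_mul_cancel_left] at h
    refine h.trans ?_
    have := (mem_shiftBall.mp hγ).1
    gcongr
  set S' := S.filter fun γ => η * T < |(γ 1 0 : ℝ)| with hS'
  have hsmall : ((S.filter fun γ => ¬ η * T < |(γ 1 0 : ℝ)|).card : ℝ) ≤ ε / 2 * T ^ 2 := by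
    apply hTη
    intro γ hγ
    rw [Finset.mem_filter] at hγ
    exact ⟨hball γ hγ.1, not_lt.mp hγ.2⟩
  have hsplit : (S.card : ℝ) = S'.card + (S.filter fun γ => ¬ η * T < |(γ 1 0 : ℝ)|).card := by
    rw [hS', ← Nat.cast_add, Finset.card_filter_add_card_filter_not]
  suffices hmain : (S'.card : ℝ) ≤ U.card + ε / 2 * T ^ 2 by rw [hsplit]; linarith
  set l := ⌊μ * T / q⌋₊ with hl
  have hμT : 2 ≤ μ * T / q := by
    rw [div_le_iff₀ hμ0] at hTμ; rw [le_div_iff₀ hq0]; linarith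
  have hl1 : 1 ≤ l := Nat.le_floor (by push_cast; linarith)
  have hlle : (l : ℝ) ≤ μ * T / q := Nat.floor_le (by positivity)
  have hlge : μ * T / q / 2 ≤ l := by
    have := Nat.lt_floor_add_one (μ * T / q)
    rw [← hl] at this; linarith
  have hl0 : (0 : ℝ) < l := by exact_mod_cast hl1
  set H : ℤ := ((q * l : ℕ) : ℤ) with hH
  have hHZ : 0 < H := by
    rw [hH]; exact_mod_cast Nat.mul_pos (Nat.pos_of_neZero q) hl1
  have hHR : (H : ℝ) = q * l := by rw [hH]; push_cast; ring
  have hHle : (H : ℝ) ≤ μ * T := by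
    rw [hHR]; rw [le_div_iff₀ hq0] at hlle; linarith
  have hHge : μ * T / 2 ≤ H := by
    rw [hHR]
    calc μ * T / 2 = q * (μ * T / q / 2) := by field_simp
      _ ≤ _ := by gcongr
  have hH0 : (0 : ℝ) < H := by exact_mod_cast hHZ
  set f : SL2Z → ℤ × ℤ × ℤ := fun γ => (γ 1 0, γ 0 0 / H, γ 1 1 / H) with hf
  set B := S'.image f with hB
  have hfib : ∀ b ∈ B, ((S'.filter fun γ => f γ = b).card : ℝ) ≤
      (U.filter fun γ => f γ = b).card + 2 * C * (4 * R) ^ (7 / 8 : ℝ) * T ^ (7 / 8 : ℝ) := by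
    intro b hb
    obtain ⟨γ₀, hγ₀', rfl⟩ := Finset.mem_image.mp hb
    obtain ⟨hγ₀, hcη⟩ := Finset.mem_filter.mp hγ₀'
    have hb₀ := hball γ₀ hγ₀
    have hsh := mem_shiftBall.mp hγ₀
    have hcT : ((γ₀ 1 0).natAbs : ℝ) ≤ 4 * R * T := by
      rw [Nat.cast_natAbs, Int.cast_abs]; exact abs_entry_le_of_mem hb₀ 1 0
    have hcη' : η * T < ((γ₀ 1 0).natAbs : ℝ) := by
      rw [Nat.cast_natAbs, Int.cast_abs]; exact hcη
    have hc0 : γ₀ 1 0 ≠ 0 := by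
      intro h; rw [h] at hcη'; simp at hcη'; nlinarith
    have hlc : l ≤ (γ₀ 1 0).natAbs := by
      have : (l : ℝ) ≤ ((γ₀ 1 0).natAbs : ℝ) := by
        have : (l : ℝ) ≤ H := by rw [hHR]; nlinarith
        nlinarith
      exact_mod_cast this
    have hcg : ((γ₀ 1 0 : ℤ) : ZMod q) = g 1 0 := by rw [← redMod_apply, hsh.2]
    have hcop : IsCoprime (γ₀ 1 0) (q : ℤ) := by
      rw [← hcg] at hu
      exact (ZMod.coe_int_isUnit_iff_isCoprime (γ₀ 1 0) q).mp hu |>.symm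
    have h1 := hC q l (g 0 0) (g 1 1) (γ₀ 1 0) (γ₀ 0 0 / H) (γ₀ 1 1 / H) hl1 hc0 hcop hlc
    have h2 := hC q l (g' 0 0) (g' 1 1) (γ₀ 1 0) (γ₀ 0 0 / H) (γ₀ 1 1 / H) hl1 hc0 hcop hlc
    rw [← hH] at h1 h2
    have hfin := (boxSet_eq_image hl1 (g 0 0) (g 1 1) (γ₀ 1 0) (γ₀ 0 0 / H) (γ₀ 1 1 / H) hc0).1
    rw [← hH] at hfin
    have hsub : (S'.filter fun γ => f γ = f γ₀).card ≤
        (boxSet q H (g 0 0) (g 1 1) (γ₀ 1 0) (γ₀ 0 0 / H) (γ₀ 1 1 / H)).ncard := by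
      rw [← Set.ncard_coe_finset]
      apply Set.ncard_le_ncard _ hfin
      intro γ hγ
      rw [Finset.mem_coe, Finset.mem_filter, Finset.mem_filter] at hγ
      obtain ⟨⟨hγS, -⟩, h⟩ := hγ
      rw [hf, Prod.mk.injEq, Prod.mk.injEq] at h
      have hγr := (mem_shiftBall.mp hγS).2
      refine ⟨h.1, h.2.1, h.2.2, ?_, ?_⟩
      · rw [← redMod_apply, hγr]
      · rw [← redMod_apply, hγr]
    have hsup : (boxSet q H (g' 0 0) (g' 1 1) (γ₀ 1 0) (γ₀ 0 0 / H) (γ₀ 1 1 / H)).ncard ≤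
        (U.filter fun γ => f γ = f γ₀).card := by
      rw [← Set.ncard_coe_finset]
      apply Set.ncard_le_ncard _ (Finset.finite_toSet _)
      rintro γ ⟨hc, hi, hj, hr, hs⟩
      rw [Finset.mem_coe, Finset.mem_filter]
      refine ⟨?_, by rw [hf]; simp only; rw [hc, hi, hj]⟩
      rw [hU, mem_shiftBall]
      constructor
      · have hE := abs_entry_sub_le_of_box (X := 4 * R * T) (Y := μ * T) hc (by positivity) hcη.le
          (by nlinarith) (abs_entry_le_of_mem hb₀) ((abs_sub_le_of_ediv_eq hHZ hi).trans hHle)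
          ((abs_sub_le_of_ediv_eq hHZ hj).trans hHle)
        have hE2 := abs_mul_entry_sub_le hR hE
        refine (frobNorm_le_add (by positivity) hE2).trans ?_
        have h3 : 2 * (2 * R * (3 * (4 * R * T) * (μ * T) / (η * T))) = 48 * R ^ 2 / η * μ * T := by
          field_simp; ring
        have h4 : 48 * R ^ 2 / η * μ ≤ κ := by
          calc 48 * R ^ 2 / η * μ ≤ 48 * R ^ 2 / η * (κ * η / (48 * R ^ 2)) := by gcongr
            _ = κ := by field_simp
        rw [h3]
        nlinarith [hsh.1]
      · exact redMod_eq_of_isUnit (hgg ▸ hu) hr (by rw [hc, hcg, hgg]) hs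
    have hcpow : C * ((γ₀ 1 0).natAbs : ℝ) ^ (7 / 8 : ℝ) ≤ C * ((4 * R) ^ (7 / 8 : ℝ) * T ^ (7 / 8 : ℝ)) := by
      rw [← Real.mul_rpow (by positivity) hT0.le]; gcongr
    have hsub' : ((S'.filter fun γ => f γ = f γ₀).card : ℝ) ≤ _ := Nat.cast_le.mpr hsub
    have hsup' := (Nat.cast_le (α := ℝ)).mpr hsup
    have k1 := (abs_le.mp h1).2
    have k2 := (abs_le.mp h2).1
    linarith
  have hBcard : (B.card : ℝ) ≤ 20 * R * T * (16 * R / μ + 2) ^ 2 := by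
    have hcount : ∀ i : Fin 2, ((S'.image fun γ : SL2Z => γ i i / H).card : ℝ) ≤ 16 * R / μ + 2 := by
      intro i
      have h := card_image_ediv_le S' (fun γ : SL2Z => γ i i) H hHZ (4 * R * T) (by positivity)
        (fun γ hγ => abs_entry_le_of_mem (hball γ (Finset.mem_filter.mp hγ).1) i i)
      refine h.trans ?_
      gcongr ?_ + _
      rw [div_le_div_iff₀ hH0 hμ0]
      nlinarith
    have h1 : B ⊆ Finset.Icc (-⌈4 * R * T⌉) ⌈4 * R * T⌉ ×ˢ (S'.image fun γ : SL2Z => γ 0 0 / H) ×ˢ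
        (S'.image fun γ : SL2Z => γ 1 1 / H) := by
      intro x hx
      obtain ⟨γ, hγ, rfl⟩ := Finset.mem_image.mp hx
      rw [Finset.mem_product, Finset.mem_product]
      exact ⟨mem_Icc_ceil_of_abs_le (abs_entry_le_of_mem (hball γ (Finset.mem_filter.mp hγ).1) 1 0),
        Finset.mem_image_of_mem (fun γ : SL2Z => γ 0 0 / H) hγ,
        Finset.mem_image_of_mem (fun γ : SL2Z => γ 1 1 / H) hγ⟩
    have h2 := Finset.card_le_card h1
    rw [Finset.card_product, Finset.card_product] at h2
    have h3 := card_Icc_ceil_le (T := 4 * R * T) (by nlinarith)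
    calc (B.card : ℝ) ≤ _ := Nat.cast_le.mpr h2
      _ = _ := by rw [Nat.cast_mul, Nat.cast_mul]
      _ ≤ (5 * (4 * R * T)) * ((16 * R / μ + 2) * (16 * R / μ + 2)) := by
          gcongr
          exacts [hcount 0, hcount 1]
      _ = _ := by ring
  have hUsum : (∑ b ∈ B, ((U.filter fun γ => f γ = b).card : ℝ)) ≤ U.card := by
    have h1 : ∑ b ∈ B, (U.filter fun γ => f γ = b).card ≤ U.card := by
      rw [← Finset.card_biUnion]
      · apply Finset.card_le_card
        intro γ hγ
        obtain ⟨b, -, hb⟩ := Finset.mem_biUnion.mp hγ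
        exact (Finset.mem_filter.mp hb).1
      · intro b _ b' _ hbb
        rw [Function.onFun, Finset.disjoint_left]
        intro γ h1 h2
        exact hbb ((Finset.mem_filter.mp h1).2.symm.trans (Finset.mem_filter.mp h2).2)
    exact_mod_cast h1
  have hT15 : T * T ^ (7 / 8 : ℝ) = T ^ (15 / 8 : ℝ) := by
    rw [← Real.rpow_one_add' hT0.le (by norm_num)]; norm_num
  have hScard : (S'.card : ℝ) = ∑ b ∈ B, ((S'.filter fun γ => f γ = b).card : ℝ) := by
    rw [Finset.card_eq_sum_card_fiberwise (f := f) (t := B) (fun x hx => Finset.mem_image_of_mem _ hx)]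
    push_cast; rfl
  rw [hScard]
  refine (Finset.sum_le_sum hfib).trans ?_
  rw [Finset.sum_add_distrib, Finset.sum_const, nsmul_eq_mul]
  have hfinal : (B.card : ℝ) * (2 * C * (4 * R) ^ (7 / 8 : ℝ) * T ^ (7 / 8 : ℝ)) ≤ ε / 2 * T ^ 2 := by
    calc _ ≤ 20 * R * T * (16 * R / μ + 2) ^ 2 * (2 * C * (4 * R) ^ (7 / 8 : ℝ) * T ^ (7 / 8 : ℝ)) := by
          gcongr
      _ = 20 * R * (16 * R / μ + 2) ^ 2 * (2 * C * (4 * R) ^ (7 / 8 : ℝ)) * (T * T ^ (7 / 8 : ℝ)) := by ring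
      _ ≤ _ := by rw [hT15]; exact hTC
  linarith

theorem exists_isUnit_add_mul {q : ℕ} [NeZero q] (a c b d : ZMod q) (h : a * d - b * c = 1) :
    ∃ j : ℤ, IsUnit (c + (j : ZMod q) * a) := by
  set j := ∏ p ∈ q.primeFactors.filter (fun p => ¬ p ∣ c.val), p with hj
  refine ⟨j, ?_⟩
  have h1 : c + ((j : ℤ) : ZMod q) * a = ((c.val + j * a.val : ℕ) : ZMod q) := by
    push_cast [ZMod.natCast_zmod_val]; rfl
  rw [h1, ZMod.isUnit_iff_coprime]
  refine Nat.coprime_of_dvd fun p hp hpd hpq => ?_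
  have hpF : p ∈ q.primeFactors := Nat.mem_primeFactors.mpr ⟨hp, hpq, NeZero.ne q⟩
  by_cases hc : p ∣ c.val
  · have hja : p ∣ j * a.val := (Nat.dvd_add_right hc).mp hpd
    rcases (Nat.Prime.dvd_mul hp).mp hja with hpj | hpa
    · obtain ⟨r, hr, hpr⟩ := (hp.prime.dvd_finsetProd_iff _).mp hpj
      rw [Finset.mem_filter, Nat.mem_primeFactors] at hr
      rw [Nat.prime_dvd_prime_iff_eq hp hr.1.1] at hpr
      exact hr.2 (hpr ▸ hc)
    · have := congrArg (ZMod.castHom hpq (ZMod p)) h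
      rw [map_sub, map_mul, map_mul, map_one] at this
      have ha0 : ZMod.castHom hpq (ZMod p) a = 0 := by
        rw [← ZMod.natCast_zmod_val a, map_natCast]
        exact (ZMod.natCast_eq_zero_iff _ _).mpr hpa
      have hc0 : ZMod.castHom hpq (ZMod p) c = 0 := by
        rw [← ZMod.natCast_zmod_val c, map_natCast]
        exact (ZMod.natCast_eq_zero_iff _ _).mpr hc
      rw [ha0, hc0, zero_mul, mul_zero, sub_zero] at this
      have := Fact.mk hp
      exact zero_ne_one ‹_›
  · have hpj : p ∣ j := Finset.dvd_prod_of_mem _ (Finset.mem_filter.mpr ⟨hpF, hc⟩)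
    exact hc ((Nat.dvd_add_left (hpj.mul_right _)).mp hpd)

section Congruence

variable {q : ℕ}

/-- The asymptotic comparison of the counting functions of two residue classes. -/
def CongDominated (g g' : Matrix.SpecialLinearGroup (Fin 2) (ZMod q)) : Prop :=
  ∀ ε κ : ℝ, 0 < ε → 0 < κ → ∀ᶠ T : ℝ in atTop,
    ((congBall q T g).card : ℝ) ≤ (congBall q ((1 + κ) * T) g').card + ε * T ^ 2

theorem CongDominated.trans {g g' g'' : Matrix.SpecialLinearGroup (Fin 2) (ZMod q)}
    (h : CongDominated g g') (h' : CongDominated g' g'') : CongDominated g g'' := by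
  intro ε κ hε hκ
  set κ₁ := min 1 (κ / 3) with hκ₁
  have h0 : 0 < κ₁ := lt_min one_pos (by positivity)
  have h1 : κ₁ ≤ 1 := min_le_left _ _
  have h3 : κ₁ ≤ κ / 3 := min_le_right _ _
  have hlim : Tendsto (fun T : ℝ => (1 + κ₁) * T) atTop atTop :=
    tendsto_id.const_mul_atTop (by linarith)
  filter_upwards [h (ε / 5) κ₁ (by linarith) h0, hlim.eventually (h' (ε / 5) κ₁ (by linarith) h0),
    eventually_gt_atTop 0] with T hT hT' hT0
  have hmono : ((congBall q ((1 + κ₁) * ((1 + κ₁) * T)) g'').card : ℝ) ≤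
      (congBall q ((1 + κ) * T) g'').card := by
    refine Nat.cast_le.mpr (Finset.card_le_card fun γ hγ => ?_)
    rw [mem_congBall] at hγ ⊢
    refine ⟨hγ.1.trans ?_, hγ.2⟩
    rw [← mul_assoc]
    gcongr
    nlinarith
  have h4 : ((1 + κ₁) * T) ^ 2 ≤ 4 * T ^ 2 := by
    rw [mul_pow]; gcongr; nlinarith
  nlinarith

theorem congDominated_mul [NeZero q] (γ₁ : SL2Z) {g g' : Matrix.SpecialLinearGroup (Fin 2) (ZMod q)}
    (hgg : g 1 0 = g' 1 0) (hu : IsUnit (g 1 0)) :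
    CongDominated (redMod q γ₁ * g) (redMod q γ₁ * g') := by
  intro ε κ hε hκ
  filter_upwards [eventually_card_shiftBall_le γ₁ g g' hgg hu ε κ hε hκ] with T hT
  rwa [card_shiftBall, card_shiftBall] at hT

theorem exists_SL_of_isUnit (x u : ZMod q) (hu : IsUnit u) :
    ∃ g : Matrix.SpecialLinearGroup (Fin 2) (ZMod q), g 0 0 = x ∧ g 1 0 = u := by
  obtain ⟨v, hv⟩ := hu.exists_right_inv
  refine ⟨⟨!![x, -v; u, 0], ?_⟩, rfl, rfl⟩
  rw [Matrix.det_fin_two_of]; linear_combination hv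

theorem SL_mul_apply {R : Type*} [CommRing R] (g h : Matrix.SpecialLinearGroup (Fin 2) R) (i j : Fin 2) :
    (g * h) i j = g i 0 * h 0 j + g i 1 * h 1 j := by
  rw [Matrix.SpecialLinearGroup.coe_mul, Matrix.mul_apply, Fin.sum_univ_two]

theorem exists_lower_unipotent (j : ℤ) : ∃ n : SL2Z, n 0 0 = 1 ∧ n 0 1 = 0 ∧ n 1 0 = j ∧ n 1 1 = 1 :=
  exists_SL2Z 1 0 j 1 (by ring)

theorem congDominated_both_of_unit [NeZero q] {g h : Matrix.SpecialLinearGroup (Fin 2) (ZMod q)}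
    (hgg : g 1 0 = h 1 0) (hu : IsUnit (g 1 0)) : CongDominated g h ∧ CongDominated h g := by
  have h1 := congDominated_mul (1 : SL2Z) hgg hu
  have h2 := congDominated_mul (1 : SL2Z) hgg.symm (hgg ▸ hu)
  rw [map_one, one_mul, one_mul] at h1 h2
  exact ⟨h1, h2⟩

theorem congDominated_unipotent [NeZero q] {g h : Matrix.SpecialLinearGroup (Fin 2) (ZMod q)} (j : ℤ)
    (hg : g 1 0 + j * g 0 0 = h 1 0 + j * h 0 0) (hu : IsUnit (g 1 0 + j * g 0 0)) :
    CongDominated g h := by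
  obtain ⟨n, h00, h01, h10, h11⟩ := exists_lower_unipotent j
  have hn : ∀ k : Matrix.SpecialLinearGroup (Fin 2) (ZMod q), (redMod q n * k) 1 0 = k 1 0 + j * k 0 0 := by
    intro k
    rw [SL_mul_apply, redMod_apply, redMod_apply, h10, h11]; push_cast; ring
  have := congDominated_mul (q := q) n⁻¹ (g := redMod q n * g) (g' := redMod q n * h)
    (by rw [hn, hn, hg]) (by rw [hn]; exact hu)
  rwa [map_inv, inv_mul_cancel_left, inv_mul_cancel_left] at this

theorem congDominated_unit_unit [NeZero q] {g h : Matrix.SpecialLinearGroup (Fin 2) (ZMod q)}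
    (hg : IsUnit (g 1 0)) (hh : IsUnit (h 1 0)) : CongDominated g h := by
  obtain ⟨g₁, e1, e2⟩ := exists_SL_of_isUnit 1 (g 1 0) hg
  obtain ⟨g₂, e3, e4⟩ := exists_SL_of_isUnit 0 (h 1 0) hh
  refine (congDominated_both_of_unit e2.symm hg).1.trans
    (CongDominated.trans (congDominated_unipotent (h 1 0 - g 1 0).val (g := g₁) (h := g₂) ?_ ?_)
    (congDominated_both_of_unit e4 (by rwa [e4])).1)
  · rw [e1, e2, e3, e4]; push_cast [ZMod.natCast_zmod_val]; ring
  · rw [e1, e2]; push_cast [ZMod.natCast_zmod_val]; ring_nf; exact hh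

/-- All residue classes modulo `q` are comparable. -/
theorem congDominated_all [NeZero q] (g h : Matrix.SpecialLinearGroup (Fin 2) (ZMod q)) :
    CongDominated g h := by
  have hex : ∀ g : Matrix.SpecialLinearGroup (Fin 2) (ZMod q), ∃ k : Matrix.SpecialLinearGroup (Fin 2) (ZMod q),
      IsUnit (k 1 0) ∧ CongDominated g k ∧ CongDominated k g := by
    intro g
    have hdet : g 0 0 * g 1 1 - g 0 1 * g 1 0 = 1 := by
      have := g.det_coe; rwa [Matrix.det_fin_two] at this
    obtain ⟨j, hj⟩ := exists_isUnit_add_mul _ _ _ _ hdet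
    obtain ⟨k, e1, e2⟩ := exists_SL_of_isUnit 0 _ hj
    exact ⟨k, e2 ▸ hj, congDominated_unipotent j (by rw [e1, e2]; ring) hj,
      congDominated_unipotent j (by rw [e1, e2]; ring) (by rw [e1, e2]; simpa using hj)⟩
  obtain ⟨k, hk, h1, -⟩ := hex g
  obtain ⟨k', hk', -, h2⟩ := hex h
  exact h1.trans ((congDominated_unit_unit hk hk').trans h2)

theorem sum_card_congBall [NeZero q] [Fintype (Matrix.SpecialLinearGroup (Fin 2) (ZMod q))] (T : ℝ) :
    ∑ g : Matrix.SpecialLinearGroup (Fin 2) (ZMod q), ((congBall q T g).card : ℝ) = (frobBall T).card := by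
  classical
  rw [Finset.card_eq_sum_card_fiberwise (f := redMod q) (t := Finset.univ) (fun _ _ => Finset.mem_coe.mpr (Finset.mem_univ _))]
  push_cast
  refine Finset.sum_congr rfl fun g _ => ?_
  rw [congBall]

theorem eventually_abs_card_congBall_sub_le [NeZero q] (g : Matrix.SpecialLinearGroup (Fin 2) (ZMod q))
    (ε : ℝ) (hε : 0 < ε) : ∀ᶠ T : ℝ in atTop,
      |(Nat.card (Matrix.SpecialLinearGroup (Fin 2) (ZMod q)) : ℝ) * (congBall q T g).card
        - (frobBall T).card| ≤ ε * T ^ 2 := by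
  have : Finite (Matrix.SpecialLinearGroup (Fin 2) (ZMod q)) := Subtype.finite
  have := Fintype.ofFinite (Matrix.SpecialLinearGroup (Fin 2) (ZMod q))
  set N := (Nat.card (Matrix.SpecialLinearGroup (Fin 2) (ZMod q)) : ℝ) with hN
  have hNc : N = (Finset.univ : Finset (Matrix.SpecialLinearGroup (Fin 2) (ZMod q))).card := by
    rw [hN, Nat.card_eq_fintype_card, Finset.card_univ]
  have hN0 : 0 < N := by rw [hN]; exact_mod_cast Nat.card_pos
  obtain ⟨κ, hκ0, hκ1, hκ⟩ := exists_card_shell_le (ε / 2) (by linarith)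
  have hshell : ∀ᶠ T : ℝ in atTop, ((frobBall ((1 + κ) * T)).card : ℝ) ≤ (frobBall T).card + ε / 2 * T ^ 2 := by
    filter_upwards [hκ, eventually_ge_atTop 0] with T hT hT0
    have h := Finset.card_sdiff_add_card_eq_card (frobBall_mono (S := T) (T := (1 + κ) * T) (by nlinarith))
    have h2 : ((frobBall ((1 + κ) * T) \ frobBall T).card : ℝ) + (frobBall T).card =
      (frobBall ((1 + κ) * T)).card := by exact_mod_cast h
    linarith
  have hlim : Tendsto (fun T : ℝ => (1 + κ)⁻¹ * T) atTop atTop :=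
    tendsto_id.const_mul_atTop (by positivity)
  have hup : ∀ᶠ T : ℝ in atTop, ∀ g' : Matrix.SpecialLinearGroup (Fin 2) (ZMod q),
      ((congBall q T g).card : ℝ) ≤ (congBall q ((1 + κ) * T) g').card + ε / (2 * N) * T ^ 2 :=
    eventually_all.mpr fun g' => congDominated_all g g' _ κ (by positivity) hκ0
  have hlo : ∀ᶠ T : ℝ in atTop, ∀ g' : Matrix.SpecialLinearGroup (Fin 2) (ZMod q),
      ((congBall q T g').card : ℝ) ≤ (congBall q ((1 + κ) * T) g).card + ε / (2 * N) * T ^ 2 :=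
    eventually_all.mpr fun g' => congDominated_all g' g _ κ (by positivity) hκ0
  filter_upwards [hshell, hlim.eventually hshell, hup, hlim.eventually hlo] with T h1 h2 h3 h4
  have hk : (1 + κ) * ((1 + κ)⁻¹ * T) = T := by rw [mul_inv_cancel_left₀ (by positivity)]
  rw [hk] at h2 h4
  have h5 : ((1 + κ)⁻¹ * T) ^ 2 ≤ T ^ 2 := by
    rw [mul_pow]
    have : (1 + κ)⁻¹ ^ 2 ≤ 1 := pow_le_one₀ (by positivity) (inv_le_one_of_one_le₀ (by linarith))
    nlinarith [sq_nonneg T]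
  have hs1 : N * (congBall q T g).card ≤ (frobBall ((1 + κ) * T)).card + ε / 2 * T ^ 2 := by
    have := Finset.sum_le_sum fun g' (_ : g' ∈ Finset.univ) => h3 g'
    rw [Finset.sum_const, Finset.sum_add_distrib, sum_card_congBall, Finset.sum_const, nsmul_eq_mul,
      nsmul_eq_mul, ← hNc] at this
    refine this.trans (le_of_eq ?_)
    field_simp
  have hs2 : ((frobBall ((1 + κ)⁻¹ * T)).card : ℝ) ≤ N * (congBall q T g).card + ε / 2 * ((1 + κ)⁻¹ * T) ^ 2 := by
    have := Finset.sum_le_sum fun g' (_ : g' ∈ Finset.univ) => h4 g'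
    rw [sum_card_congBall, Finset.sum_const, nsmul_eq_mul, ← hNc] at this
    refine this.trans (le_of_eq ?_)
    field_simp
  rw [abs_le]
  constructor <;> nlinarith

/-- Equidistribution of the matrices of bounded norm modulo `q`. -/
theorem tendsto_card_congBall_div [NeZero q] (g : Matrix.SpecialLinearGroup (Fin 2) (ZMod q)) :
    Tendsto (fun T : ℝ => ((congBall q T g).card : ℝ) / (frobBall T).card) atTop
      (𝓝 (1 / (Nat.card (Matrix.SpecialLinearGroup (Fin 2) (ZMod q)) : ℝ))) := by
  have : Finite (Matrix.SpecialLinearGroup (Fin 2) (ZMod q)) := Subtype.finite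
  set N := (Nat.card (Matrix.SpecialLinearGroup (Fin 2) (ZMod q)) : ℝ) with hN
  have hN1 : 1 ≤ N := by
    rw [hN]; exact_mod_cast Nat.card_pos (α := Matrix.SpecialLinearGroup (Fin 2) (ZMod q))
  rw [Metric.tendsto_nhds]
  intro ε hε
  filter_upwards [eventually_abs_card_congBall_sub_le g (ε / 128) (by linarith), eventually_ge_atTop 2]
    with T hT hT2
  have hM := card_frobBall_ge hT2
  have hM0 : 0 < ((frobBall T).card : ℝ) := by nlinarith
  rw [Real.dist_eq, div_sub_div _ _ hM0.ne' (by positivity), abs_div, abs_of_pos (by positivity :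
    0 < ((frobBall T).card : ℝ) * N), div_lt_iff₀ (by positivity), mul_comm _ N, mul_one]
  refine hT.trans_lt ?_
  nlinarith [mul_le_mul_of_nonneg_left hN1 (mul_nonneg hε.le hM0.le)]

end Congruence

theorem sum_inv_natAbs_le (N : ℕ) (X : ℝ) (hX : 0 < X) (hXN : X ≤ N) :
    ∑ c ∈ (Finset.Icc (-(N : ℤ)) N).filter (fun c : ℤ => X ≤ |(c : ℝ)|), 1 / |(c : ℝ)| ≤
      2 * (1 + Real.log (N / X)) := by
  have hN0 : (0 : ℝ) < N := hX.trans_le hXN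
  rw [Finset.sum_filter]
  have h1 : ∀ c ∈ Finset.Icc (-(N : ℤ)) N, (if X ≤ |(c : ℝ)| then 1 / |(c : ℝ)| else 0) =
      (fun n : ℕ => if X ≤ (n : ℝ) then 1 / (n : ℝ) else 0) c.natAbs := by
    intro c _
    simp only
    rw [Nat.cast_natAbs, Int.cast_abs]
  rw [Finset.sum_congr rfl h1, sum_Icc_natAbs (fun n : ℕ => if X ≤ (n : ℝ) then 1 / (n : ℝ) else 0)]
  rw [Nat.cast_zero, div_zero, ite_self, zero_add]
  gcongr
  set m := ⌈X⌉₊ - 1 with hm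
  have hm1 : m + 1 = ⌈X⌉₊ := Nat.sub_add_cancel (Nat.ceil_pos.mpr hX)
  have hmN : m ≤ N := by have := Nat.ceil_le.mpr hXN; omega
  have h2 : ∑ k ∈ Finset.range N, (if X ≤ ((k + 1 : ℕ) : ℝ) then 1 / ((k + 1 : ℕ) : ℝ) else 0) =
      ∑ k ∈ Finset.Ico m N, ((k + 1 : ℕ) : ℝ)⁻¹ := by
    rw [← Finset.sum_filter]
    refine Finset.sum_congr ?_ fun k _ => one_div _
    ext k
    rw [Finset.mem_filter, Finset.mem_range, Finset.mem_Ico, ← Nat.ceil_le, ← hm1]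
    omega
  have hh : ∀ n, ((harmonic n : ℚ) : ℝ) = ∑ k ∈ Finset.range n, ((k + 1 : ℕ) : ℝ)⁻¹ := by
    intro n; rw [harmonic]; push_cast; rfl
  rw [h2, Finset.sum_Ico_eq_sub _ hmN, ← hh, ← hh]
  have e1 := harmonic_le_one_add_log N
  have e2 := log_add_one_le_harmonic m
  have e3 : Real.log X ≤ Real.log ((m + 1 : ℕ) : ℝ) := Real.log_le_log hX (by rw [hm1]; exact Nat.le_ceil X)
  rw [Real.log_div hN0.ne' hX.ne']
  linarith

theorem sq_dvd_sub_two_or {p : ℕ} (hp : p.Prime) (hp2 : p ≠ 2) {t : ℤ} (h : (p : ℤ) ^ 2 ∣ t ^ 2 - 4) :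
    (p : ℤ) ^ 2 ∣ t - 2 ∨ (p : ℤ) ^ 2 ∣ t + 2 := by
  have hpZ : Prime (p : ℤ) := Nat.prime_iff_prime_int.mp hp
  have h1 : t ^ 2 - 4 = (t - 2) * (t + 2) := by ring
  rw [h1] at h
  by_cases hd : (p : ℤ) ∣ t - 2
  · left
    refine (IsCoprime.pow_left ?_).dvd_of_dvd_mul_right h
    refine (hpZ.coprime_iff_not_dvd).mpr fun h2 => hp2 ?_
    have h4 : (p : ℤ) ∣ 2 * 2 := by have := dvd_sub h2 hd; ring_nf at this; exact this
    have h5 : (p : ℤ) ∣ 2 := (hpZ.dvd_or_dvd h4).elim id id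
    exact (Nat.prime_dvd_prime_iff_eq hp Nat.prime_two).mp (by exact_mod_cast h5)
  · right
    exact (IsCoprime.pow_left ((hpZ.coprime_iff_not_dvd).mpr hd)).dvd_of_dvd_mul_left h

/-- The tail bound in the range of large primes. -/
theorem exists_card_sq_dvd_large_le : ∃ C : ℝ, 0 ≤ C ∧ ∀ (T : ℝ), 1 ≤ T → ∀ p : ℕ, p.Prime → p ≠ 2 →
    T ≤ (p : ℝ) ^ 100 → ∀ S : Finset SL2Z,
    (∀ γ ∈ S, γ ∈ frobBall T ∧ 2 < |trZ γ| ∧ (p : ℤ) ^ 2 ∣ trZ γ ^ 2 - 4) →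
      (S.card : ℝ) ≤ C * T ^ 2 * (p : ℝ) ^ (-(5 / 4) : ℝ) := by
  obtain ⟨C, hC0, hC⟩ := exists_card_trace_eq_le (1 / 200) (by norm_num)
  refine ⟨16 * C, by positivity, fun T hT1 p hp hp2 hTp S hS => ?_⟩
  have hT0 : 0 < T := by linarith
  have hp0 : (0 : ℝ) < p := by exact_mod_cast hp.pos
  have hp1 : (1 : ℝ) ≤ p := by exact_mod_cast hp.one_le
  have hpp : (((p : ℤ) ^ 2 : ℤ) : ℝ) = (p : ℝ) ^ 2 := by push_cast; ring
  have htr : ∀ γ ∈ S, |(trZ γ : ℝ)| ≤ 2 * T := by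
    intro γ hγ
    have h0 := abs_entry_le_of_mem (hS γ hγ).1 0 0
    have h1 := abs_entry_le_of_mem (hS γ hγ).1 1 1
    rw [trZ]; push_cast
    exact (abs_add_le _ _).trans (by linarith)
  have hhalf : ∀ s : ℤ, |s| = 2 → ((((S.filter fun γ => (p : ℤ) ^ 2 ∣ trZ γ - s)).image trZ).card : ℝ) ≤
      8 * T / p ^ 2 := by
    intro s hs
    have hsR : |(s : ℝ)| = 2 := by exact_mod_cast hs
    rcases ((S.filter fun γ => (p : ℤ) ^ 2 ∣ trZ γ - s)).eq_empty_or_nonempty with h | ⟨γ, hγ⟩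
    · rw [h]; simp; positivity
    have hpT : (p : ℝ) ^ 2 ≤ 4 * T := by
      rw [Finset.mem_filter] at hγ
      have hne : trZ γ - s ≠ 0 := by
        intro h0
        have h2 := (hS γ hγ.1).2.1
        rw [show trZ γ = s by linarith, hs] at h2
        exact lt_irrefl _ h2
      have h3 := Int.le_of_dvd (abs_pos.mpr hne) ((dvd_abs _ _).mpr hγ.2)
      have h4 : (p : ℝ) ^ 2 ≤ |(trZ γ : ℝ) - s| := by exact_mod_cast h3
      have h5 := abs_sub (trZ γ : ℝ) s
      have := htr γ hγ.1
      linarith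
    have h := card_le_of_dvd_sub_of_abs_sub_le (((S.filter fun γ => (p : ℤ) ^ 2 ∣ trZ γ - s)).image trZ)
      ((p : ℤ) ^ 2) (by have := hp.pos; positivity) (4 * T) (by positivity) ?_ ?_
    · rw [hpp] at h
      refine h.trans ?_
      have : 1 ≤ 4 * T / p ^ 2 := by rw [le_div_iff₀ (by positivity)]; linarith
      calc _ ≤ 4 * T / p ^ 2 + 4 * T / p ^ 2 := by linarith
        _ = _ := by ring
    · intro x hx y hy
      obtain ⟨γ, hγ, rfl⟩ := Finset.mem_image.mp hx
      obtain ⟨γ', hγ', rfl⟩ := Finset.mem_image.mp hy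
      have := dvd_sub (Finset.mem_filter.mp hγ).2 (Finset.mem_filter.mp hγ').2
      rwa [sub_sub_sub_cancel_right] at this
    · intro x hx y hy
      obtain ⟨γ, hγ, rfl⟩ := Finset.mem_image.mp hx
      obtain ⟨γ', hγ', rfl⟩ := Finset.mem_image.mp hy
      have e1 := htr _ (Finset.mem_filter.mp hγ).1
      have e2 := htr _ (Finset.mem_filter.mp hγ').1
      exact (abs_sub _ _).trans (by linarith)
  have himg : ((S.image trZ).card : ℝ) ≤ 16 * T / p ^ 2 := by
    have h1 : S.image trZ ⊆ ((S.filter fun γ => (p : ℤ) ^ 2 ∣ trZ γ - 2)).image trZ ∪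
        ((S.filter fun γ => (p : ℤ) ^ 2 ∣ trZ γ - (-2))).image trZ := by
      intro x hx
      obtain ⟨γ, hγ, rfl⟩ := Finset.mem_image.mp hx
      rw [Finset.mem_union]
      rcases sq_dvd_sub_two_or hp hp2 (hS γ hγ).2.2 with h | h
      · left; exact Finset.mem_image_of_mem _ (Finset.mem_filter.mpr ⟨hγ, h⟩)
      · right; exact Finset.mem_image_of_mem _ (Finset.mem_filter.mpr ⟨hγ, by rwa [sub_neg_eq_add]⟩)
    have h2 := (Finset.card_le_card h1).trans (Finset.card_union_le _ _)
    calc ((S.image trZ).card : ℝ) ≤ 8 * T / p ^ 2 + 8 * T / p ^ 2 :=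
          le_trans (by exact_mod_cast h2) (add_le_add (hhalf 2 rfl) (hhalf (-2) rfl))
      _ = _ := by ring
  have hfib := card_le_card_mul_of_fibers S trZ (S.image trZ) (fun x hx => Finset.mem_image_of_mem _ hx)
    (C * T ^ (1 + 1 / 200 : ℝ)) (fun t _ => hC T hT1 t _ (fun γ hγ => by
      rw [Finset.mem_filter] at hγ
      obtain ⟨h1, h2, -⟩ := hS γ hγ.1
      have hdet := SL2Z_det γ
      have hbc : γ 0 1 * γ 1 0 ≠ 0 := by
        intro h0
        rw [h0, sub_zero] at hdet
        rw [trZ] at h2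
        rcases Int.mul_eq_one_iff_eq_one_or_neg_one.mp hdet with ⟨e1, e2⟩ | ⟨e1, e2⟩ <;>
          rw [e1, e2] at h2 <;> norm_num at h2
      exact ⟨h1, hγ.2, left_ne_zero_of_mul hbc, right_ne_zero_of_mul hbc⟩))
  refine hfib.trans ?_
  have hTe : T ^ (1 + 1 / 200 : ℝ) ≤ T * (p : ℝ) ^ (1 / 2 : ℝ) := by
    rw [Real.rpow_add hT0, Real.rpow_one]
    gcongr
    calc T ^ (1 / 200 : ℝ) ≤ ((p : ℝ) ^ 100) ^ (1 / 200 : ℝ) := by gcongr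
      _ = _ := by rw [← Real.rpow_natCast, ← Real.rpow_mul hp0.le]; norm_num
  have hpe : (p : ℝ) ^ (1 / 2 : ℝ) / p ^ 2 ≤ (p : ℝ) ^ (-(5 / 4) : ℝ) := by
    rw [← Real.rpow_natCast, ← Real.rpow_sub hp0]
    exact Real.rpow_le_rpow_of_exponent_le hp1 (by norm_num)
  calc _ ≤ (16 * T / p ^ 2) * (C * (T * (p : ℝ) ^ (1 / 2 : ℝ))) := by gcongr
    _ = 16 * C * T ^ 2 * ((p : ℝ) ^ (1 / 2 : ℝ) / p ^ 2) := by field_simp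
    _ ≤ _ := by gcongr

/-- The contribution of one lower left entry to the tail bound for small primes. -/
theorem exists_card_column_sq_dvd_le : ∃ C : ℝ, 0 ≤ C ∧ ∀ (T : ℝ) (p : ℕ), p.Prime → p ≠ 2 →
    (p : ℝ) ^ 3 ≤ T → ∀ c : ℤ, ¬ (p : ℤ) ∣ c → 2 * T * (p : ℝ) ^ (-(5 / 2) : ℝ) ≤ |(c : ℝ)| →
    |(c : ℝ)| ≤ T → ∀ S : Finset SL2Z,
    (∀ γ ∈ S, γ ∈ frobBall T ∧ γ 1 0 = c ∧ (p : ℤ) ^ 2 ∣ trZ γ ^ 2 - 4) →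
      (S.card : ℝ) ≤ 128 * T ^ 2 / p ^ 2 * (1 / |(c : ℝ)|) + C * (p : ℝ) ^ 4 * T ^ (7 / 8 : ℝ) := by
  classical
  obtain ⟨C, hC0, hC⟩ := exists_ncard_boxSet_le
  refine ⟨32 * C, by positivity, fun T p hp hp2 hpT c hpc hcX hcT S hS => ?_⟩
  have hp0 : (0 : ℝ) < p := by exact_mod_cast hp.pos
  have hp1 : (1 : ℝ) ≤ p := by exact_mod_cast hp.one_le
  have hT0 : 0 < T := lt_of_lt_of_le (by positivity) hpT
  have hneq : NeZero (p ^ 2) := ⟨pow_ne_zero _ hp.ne_zero⟩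
  set l := ⌈T / (p : ℝ) ^ 3⌉₊ with hl
  have hTp : 1 ≤ T / (p : ℝ) ^ 3 := by rwa [one_le_div (by positivity)]
  have hlge : T / (p : ℝ) ^ 3 ≤ l := Nat.le_ceil _
  have hlle : (l : ℝ) ≤ 2 * T / (p : ℝ) ^ 3 := by
    have := Nat.ceil_lt_add_one (show 0 ≤ T / (p : ℝ) ^ 3 by positivity)
    rw [← hl] at this
    calc (l : ℝ) ≤ T / (p : ℝ) ^ 3 + T / (p : ℝ) ^ 3 := by linarith
      _ = _ := by ring
  have hl1 : 0 < l := by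
    have : (0 : ℝ) < l := by linarith
    exact_mod_cast this
  set H : ℤ := ((p ^ 2 * l : ℕ) : ℤ) with hH
  have hHZ : 0 < H := by rw [hH]; exact_mod_cast Nat.mul_pos (pow_pos hp.pos 2) hl1
  have hHR : (H : ℝ) = p ^ 2 * l := by rw [hH]; push_cast; ring
  have hHge : T / p ≤ H := by
    rw [hHR]
    calc T / p = p ^ 2 * (T / (p : ℝ) ^ 3) := by field_simp
      _ ≤ _ := by gcongr
  have hc0 : c ≠ 0 := by rintro rfl; exact hpc (dvd_zero _)
  have hcR : ((c.natAbs : ℕ) : ℝ) = |(c : ℝ)| := by rw [Nat.cast_natAbs, Int.cast_abs]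
  have hcpos : 0 < |(c : ℝ)| := abs_pos.mpr (by exact_mod_cast hc0)
  have hlc : l ≤ c.natAbs := by
    have h1 : 2 * T / (p : ℝ) ^ 3 ≤ 2 * T * (p : ℝ) ^ (-(5 / 2) : ℝ) := by
      rw [div_eq_mul_inv, ← Real.rpow_natCast, ← Real.rpow_neg hp0.le]
      exact mul_le_mul_of_nonneg_left
        (Real.rpow_le_rpow_of_exponent_le hp1 (by norm_num)) (by positivity)
    have : (l : ℝ) ≤ (c.natAbs : ℝ) := by rw [hcR]; linarith
    exact_mod_cast this
  have hcop : IsCoprime c ((p ^ 2 : ℕ) : ℤ) := by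
    push_cast
    exact (IsCoprime.pow_left (((Nat.prime_iff_prime_int.mp hp).coprime_iff_not_dvd).mpr hpc)).symm
  set f : SL2Z → (ℤ × ℤ) × (ZMod (p ^ 2) × ZMod (p ^ 2)) := fun γ =>
    ((γ 0 0 / H, γ 1 1 / H), (((γ 0 0 : ℤ) : ZMod (p ^ 2)), ((γ 1 1 : ℤ) : ZMod (p ^ 2)))) with hf
  set W : Finset (ZMod (p ^ 2) × ZMod (p ^ 2)) :=
    Finset.univ.image (fun r : ZMod (p ^ 2) => (r, 2 - r)) ∪
      Finset.univ.image (fun r : ZMod (p ^ 2) => (r, -2 - r)) with hW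
  have hWcard : (W.card : ℝ) ≤ 2 * p ^ 2 := by
    have h1 : W.card ≤ p ^ 2 + p ^ 2 := by
      refine (Finset.card_union_le _ _).trans (Nat.add_le_add ?_ ?_) <;>
      · refine Finset.card_image_le.trans ?_
        rw [Finset.card_univ, ZMod.card]
    have h2 : (W.card : ℝ) ≤ (p ^ 2 + p ^ 2 : ℕ) := by exact_mod_cast h1
    push_cast at h2; linarith
  have hmem : ∀ γ ∈ S, f γ ∈ ((S.image fun γ : SL2Z => γ 0 0 / H) ×ˢ (S.image fun γ : SL2Z => γ 1 1 / H)) ×ˢ W := by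
    intro γ hγ
    rw [Finset.mem_product, Finset.mem_product]
    refine ⟨⟨Finset.mem_image_of_mem (fun γ : SL2Z => γ 0 0 / H) hγ,
      Finset.mem_image_of_mem (fun γ : SL2Z => γ 1 1 / H) hγ⟩, ?_⟩
    rw [hW, Finset.mem_union, Finset.mem_image, Finset.mem_image]
    rcases sq_dvd_sub_two_or hp hp2 (hS γ hγ).2.2 with h | h
    · left
      refine ⟨_, Finset.mem_univ ((γ 0 0 : ℤ) : ZMod (p ^ 2)), ?_⟩
      rw [hf, Prod.mk.injEq]
      refine ⟨rfl, ?_⟩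
      have h1 : ((trZ γ - 2 : ℤ) : ZMod (p ^ 2)) = 0 := by
        rw [ZMod.intCast_zmod_eq_zero_iff_dvd]; push_cast; exact h
      rw [trZ] at h1; push_cast at h1
      linear_combination -h1
    · right
      refine ⟨_, Finset.mem_univ ((γ 0 0 : ℤ) : ZMod (p ^ 2)), ?_⟩
      rw [hf, Prod.mk.injEq]
      refine ⟨rfl, ?_⟩
      have h1 : ((trZ γ + 2 : ℤ) : ZMod (p ^ 2)) = 0 := by
        rw [ZMod.intCast_zmod_eq_zero_iff_dvd]; push_cast; exact h
      rw [trZ] at h1; push_cast at h1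
      linear_combination -h1
  have hcount : ∀ i : Fin 2, ((S.image fun γ : SL2Z => γ i i / H).card : ℝ) ≤ 4 * p := by
    intro i
    have h := card_image_ediv_le S (fun γ : SL2Z => γ i i) H hHZ T hT0.le
      (fun γ hγ => abs_entry_le_of_mem (hS γ hγ).1 i i)
    refine h.trans ?_
    have h2 : 2 * T / H ≤ 2 * p := by
      rw [div_le_iff₀ (by exact_mod_cast hHZ)]
      rw [div_le_iff₀ hp0] at hHge
      linarith
    linarith
  have hfib := card_le_card_mul_of_fibers S f _ hmem
    ((2 * T / (p : ℝ) ^ 3) ^ 2 / |(c : ℝ)| + C * T ^ (7 / 8 : ℝ)) (by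
    rintro ⟨⟨i, j⟩, ⟨r, s⟩⟩ _
    have hfin := (boxSet_eq_image (q := p ^ 2) hl1 r s c i j hc0).1
    have hbox := hC (p ^ 2) l r s c i j hl1 hc0 hcop hlc
    rw [← hH] at hfin hbox
    have hsub : (S.filter fun γ => f γ = ((i, j), (r, s))).card ≤ (boxSet (p ^ 2) H r s c i j).ncard := by
      rw [← Set.ncard_coe_finset]
      apply Set.ncard_le_ncard _ hfin
      intro γ hγ
      rw [Finset.mem_coe, Finset.mem_filter] at hγ
      obtain ⟨hγS, h⟩ := hγ
      rw [hf, Prod.mk.injEq, Prod.mk.injEq, Prod.mk.injEq] at h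
      exact ⟨(hS γ hγS).2.1, h.1.1, h.1.2, h.2.1, h.2.2⟩
    rw [hcR] at hbox
    calc _ ≤ ((boxSet (p ^ 2) H r s c i j).ncard : ℝ) := by exact_mod_cast hsub
      _ ≤ _ := hbox
      _ ≤ _ := by gcongr)
  refine hfib.trans ?_
  rw [Finset.card_product, Finset.card_product, Nat.cast_mul, Nat.cast_mul]
  calc _ ≤ (4 * (p : ℝ)) * (4 * p) * (2 * p ^ 2) *
        ((2 * T / (p : ℝ) ^ 3) ^ 2 / |(c : ℝ)| + C * T ^ (7 / 8 : ℝ)) := by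
        gcongr
        exacts [hcount 0, hcount 1]
    _ = _ := by field_simp; ring

/-- The tail bound in the range of small primes. -/
theorem exists_card_sq_dvd_small_le : ∃ C : ℝ, 0 ≤ C ∧ ∀ (T : ℝ) (p : ℕ), p.Prime → p ≠ 2 →
    (p : ℝ) ^ 100 ≤ T → ∀ S : Finset SL2Z,
    (∀ γ ∈ S, γ ∈ frobBall T ∧ (p : ℤ) ^ 2 ∣ trZ γ ^ 2 - 4) →
      (S.card : ℝ) ≤ C * T ^ 2 * (p : ℝ) ^ (-(5 / 4) : ℝ) := by
  classical
  obtain ⟨C, hC0, hC⟩ := exists_card_column_sq_dvd_le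
  refine ⟨486 + (27 + 432) + (1536 + 5 * C), by positivity, fun T p hp hp2 hpT S hS => ?_⟩
  have hp0 : (0 : ℝ) < p := by exact_mod_cast hp.pos
  have hp1 : (1 : ℝ) ≤ p := by exact_mod_cast hp.one_le
  have hp100 : (1 : ℝ) ≤ (p : ℝ) ^ 100 := one_le_pow₀ hp1
  have hT1 : 1 ≤ T := hp100.trans hpT
  have hT0 : 0 < T := by linarith
  have hpZ := Nat.prime_iff_prime_int.mp hp
  have hpow : ∀ e : ℝ, 0 ≤ e → (p : ℝ) ^ (100 * e) ≤ T ^ e := by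
    intro e he
    rw [Real.rpow_mul hp0.le]
    have : (p : ℝ) ^ (100 : ℝ) = (p : ℝ) ^ 100 := by rw [← Real.rpow_natCast]; norm_num
    rw [this]; gcongr
  have hpexp : ∀ e e' : ℝ, e ≤ e' → (p : ℝ) ^ e ≤ (p : ℝ) ^ e' := fun e e' h =>
    Real.rpow_le_rpow_of_exponent_le hp1 h
  set P := (p : ℝ) ^ (-(5 / 4) : ℝ) with hP
  have hP0 : 0 < P := by positivity
  set X := 2 * T * (p : ℝ) ^ (-(5 / 2) : ℝ) with hX
  have hX0 : 0 < X := by positivity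
  set S₁ := S.filter fun γ => (p : ℤ) ∣ γ 1 0 with hS₁
  set S₂ := (S.filter fun γ => ¬ (p : ℤ) ∣ γ 1 0).filter fun γ => ¬ X ≤ |(γ 1 0 : ℝ)| with hS₂
  set S₃ := (S.filter fun γ => ¬ (p : ℤ) ∣ γ 1 0).filter fun γ => X ≤ |(γ 1 0 : ℝ)| with hS₃
  have hsplit : (S.card : ℝ) = S₁.card + S₂.card + S₃.card := by
    have h1 : S₁.card + (S.filter fun γ => ¬ (p : ℤ) ∣ γ 1 0).card = S.card :=
      Finset.card_filter_add_card_filter_not (s := S) (fun γ => (p : ℤ) ∣ γ 1 0)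
    have h2 : S₃.card + S₂.card = (S.filter fun γ => ¬ (p : ℤ) ∣ γ 1 0).card :=
      Finset.card_filter_add_card_filter_not (s := S.filter fun γ => ¬ (p : ℤ) ∣ γ 1 0)
        (fun γ => X ≤ |(γ 1 0 : ℝ)|)
    have : S.card = S₁.card + S₂.card + S₃.card := by rw [← h1, ← h2]; ring
    exact_mod_cast this
  have hps : (p : ℝ) ≤ √T := by
    rw [Real.sqrt_eq_rpow]
    refine le_trans ?_ (hpow (1 / 2) (by norm_num))
    nth_rewrite 1 [← Real.rpow_one (p : ℝ)]
    exact hpexp _ _ (by norm_num)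
  have hp2P : 1 / (p : ℝ) ^ 2 ≤ P := by
    rw [one_div, ← Real.rpow_natCast, ← Real.rpow_neg hp0.le]
    exact hpexp _ _ (by norm_num)
  have b1 : (S₁.card : ℝ) ≤ 486 * T ^ 2 * P := by
    have hsub : S₁ ⊆ (S₁.filter fun γ => (p : ℤ) ∣ γ 0 0 - 1) ∪ (S₁.filter fun γ => (p : ℤ) ∣ γ 0 0 - (-1)) := by
      intro γ hγ
      rw [Finset.mem_union]
      obtain ⟨hγS, hpc⟩ := Finset.mem_filter.mp hγ
      have hdet := SL2Z_det γ
      rcases sq_dvd_sub_two_or hp hp2 (hS γ hγS).2 with h | h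
      · left
        refine Finset.mem_filter.mpr ⟨hγ, hpZ.dvd_of_dvd_pow (n := 2) ?_⟩
        have e : (γ 0 0 - 1) ^ 2 = γ 0 0 * (trZ γ - 2) - γ 0 1 * γ 1 0 := by
          rw [trZ]; linear_combination -hdet
        rw [e]
        exact dvd_sub (((dvd_pow_self _ two_ne_zero).trans h).mul_left _) (hpc.mul_left _)
      · right
        refine Finset.mem_filter.mpr ⟨hγ, hpZ.dvd_of_dvd_pow (n := 2) ?_⟩
        have e : (γ 0 0 - (-1)) ^ 2 = γ 0 0 * (trZ γ + 2) - γ 0 1 * γ 1 0 := by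
          rw [trZ]; linear_combination -hdet
        rw [e]
        exact dvd_sub (((dvd_pow_self _ two_ne_zero).trans h).mul_left _) (hpc.mul_left _)
    have hh : ∀ s : ℤ, |s| ≤ 1 → ((S₁.filter fun γ => (p : ℤ) ∣ γ 0 0 - s).card : ℝ) ≤ 243 * T ^ 2 / p ^ 2 := by
      intro s hs
      refine card_frobBall_filter_dvd_le p hp.pos s hs (Or.inr hp.two_le) hps _ fun γ hγ => ?_
      rw [Finset.mem_filter, Finset.mem_filter] at hγ
      exact ⟨(hS γ hγ.1.1).1, hγ.2, hγ.1.2⟩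
    have h2 := (Finset.card_le_card hsub).trans (Finset.card_union_le _ _)
    calc (S₁.card : ℝ) ≤ 243 * T ^ 2 / p ^ 2 + 243 * T ^ 2 / p ^ 2 :=
          le_trans (by exact_mod_cast h2) (add_le_add (hh 1 (by norm_num)) (hh (-1) (by norm_num)))
      _ = 486 * T ^ 2 * (1 / (p : ℝ) ^ 2) := by ring
      _ ≤ _ := by gcongr
  have b2 : (S₂.card : ℝ) ≤ (27 + 432) * T ^ 2 * P := by
    have h := card_frobBall_filter_abs_le hT1 hX0.le S₂ fun γ hγ => by
      rw [hS₂, Finset.mem_filter, Finset.mem_filter] at hγ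
      exact ⟨(hS γ hγ.1.1).1, (not_le.mp hγ.2).le⟩
    have e1 : √X ≤ 2 * √T * P := by
      refine Real.sqrt_le_iff.mpr ⟨by positivity, ?_⟩
      rw [mul_pow, mul_pow, Real.sq_sqrt hT0.le, hP, ← Real.rpow_natCast, ← Real.rpow_natCast,
        ← Real.rpow_mul hp0.le]
      norm_num
      rw [hX]; norm_num
      have : 0 < T * (p : ℝ) ^ (-(5 / 2) : ℝ) := by positivity
      linarith
    have e2 : 1 ≤ √T * P := by
      have h3 : (p : ℝ) ^ (5 / 4 : ℝ) ≤ √T := by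
        rw [Real.sqrt_eq_rpow]
        exact (hpexp _ _ (by norm_num)).trans (hpow (1 / 2) (by norm_num))
      calc 1 = (p : ℝ) ^ (5 / 4 : ℝ) * P := by rw [hP, ← Real.rpow_add hp0]; norm_num
        _ ≤ _ := by gcongr
    refine h.trans ?_
    have e3 : √T * √T = T := Real.mul_self_sqrt hT0.le
    calc 27 * T * √T * (1 + 8 * √X) ≤ 27 * T * √T * (√T * P + 8 * (2 * √T * P)) := by gcongr
      _ = 27 * 17 * T * (√T * √T) * P := by ring
      _ = _ := by rw [e3]; ring
  have b3 : (S₃.card : ℝ) ≤ (1536 + 5 * C) * T ^ 2 * P := by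
    set N := ⌈T⌉₊ with hN
    have hNT : (N : ℝ) ≤ 2 * T := by
      have := Nat.ceil_lt_add_one hT0.le; rw [← hN] at this; linarith
    have hTN : T ≤ N := Nat.le_ceil T
    by_cases hXN : X ≤ N
    swap
    · have : S₃ = ∅ := by
        rw [Finset.eq_empty_iff_forall_notMem]
        intro γ hγ
        rw [hS₃, Finset.mem_filter, Finset.mem_filter] at hγ
        have := abs_entry_le_of_mem (hS γ hγ.1.1).1 1 0
        exact hXN (hγ.2.trans (this.trans hTN))
      rw [this]; simp; positivity
    set F := ((Finset.Icc (-(N : ℤ)) N).filter (fun c : ℤ => X ≤ |(c : ℝ)|)) with hF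
    have hmem : ∀ γ ∈ S₃, γ 1 0 ∈ F := by
      intro γ hγ
      rw [hS₃, Finset.mem_filter, Finset.mem_filter] at hγ
      have h1 := (abs_entry_le_of_mem (hS γ hγ.1.1).1 1 0).trans hTN
      rw [abs_le] at h1
      rw [hF, Finset.mem_filter, Finset.mem_Icc]
      exact ⟨⟨by exact_mod_cast h1.1, by exact_mod_cast h1.2⟩, hγ.2⟩
    have hfibers : ∀ c ∈ F, ((S₃.filter fun γ => γ 1 0 = c).card : ℝ) ≤
        128 * T ^ 2 / p ^ 2 * (1 / |(c : ℝ)|) + C * (p : ℝ) ^ 4 * T ^ (7 / 8 : ℝ) := by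
      intro c _
      rcases (S₃.filter fun γ => γ 1 0 = c).eq_empty_or_nonempty with h | ⟨γ, hγ⟩
      · rw [h]; simp; positivity
      obtain ⟨hγ3, rfl⟩ := Finset.mem_filter.mp hγ
      have hγ' := hγ3
      rw [hS₃, Finset.mem_filter, Finset.mem_filter] at hγ'
      refine hC T p hp hp2 ((pow_le_pow_right₀ hp1 (by norm_num)).trans hpT) _ hγ'.1.2 hγ'.2
        (abs_entry_le_of_mem (hS γ hγ'.1.1).1 1 0) _ fun δ hδ => ?_
      rw [Finset.mem_filter, hS₃, Finset.mem_filter, Finset.mem_filter] at hδ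
      exact ⟨(hS δ hδ.1.1.1).1, hδ.2, (hS δ hδ.1.1.1).2⟩
    have hFcard : (F.card : ℝ) ≤ 5 * T := by
      have h1 : F.card ≤ 2 * N + 1 := by
        refine (Finset.card_filter_le _ _).trans ?_
        rw [Int.card_Icc]; omega
      have h2 : (F.card : ℝ) ≤ 2 * N + 1 := by exact_mod_cast h1
      linarith
    have hlog : 2 * (1 + Real.log (N / X)) ≤ 12 * (p : ℝ) ^ (1 / 2 : ℝ) := by
      have h1 : (N : ℝ) / X ≤ (p : ℝ) ^ (5 / 2 : ℝ) := by
        rw [div_le_iff₀ hX0, hX]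
        calc (N : ℝ) ≤ 2 * T * ((p : ℝ) ^ (5 / 2 : ℝ) * (p : ℝ) ^ (-(5 / 2) : ℝ)) := by
              rw [← Real.rpow_add hp0]; norm_num; exact hNT
          _ = _ := by ring
      have h2 : Real.log (N / X) ≤ 5 / 2 * Real.log p := by
        rw [← Real.log_rpow hp0]
        exact Real.log_le_log (div_pos (hT0.trans_le hTN) hX0) h1
      have h3 := Real.log_le_rpow_div hp0.le (show (0 : ℝ) < 1 / 2 by norm_num)
      have h4 : (1 : ℝ) ≤ (p : ℝ) ^ (1 / 2 : ℝ) := Real.one_le_rpow hp1 (by norm_num)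
      have h5 : (p : ℝ) ^ (1 / 2 : ℝ) / (1 / 2) = 2 * (p : ℝ) ^ (1 / 2 : ℝ) := by ring
      rw [h5] at h3
      linarith
    rw [Finset.card_eq_sum_card_fiberwise (f := fun γ : SL2Z => γ 1 0) (t := F) hmem]
    push_cast
    refine (Finset.sum_le_sum hfibers).trans ?_
    rw [Finset.sum_add_distrib, ← Finset.mul_sum, Finset.sum_const, nsmul_eq_mul]
    have hsum := (sum_inv_natAbs_le N X hX0 hXN).trans hlog
    have g1 : (p : ℝ) ^ (1 / 2 : ℝ) / p ^ 2 ≤ P := by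
      rw [← Real.rpow_natCast, ← Real.rpow_sub hp0]
      exact hpexp _ _ (by norm_num)
    have g2 : (p : ℝ) ^ 4 * T ^ (7 / 8 : ℝ) ≤ T * P := by
      have h1 : (p : ℝ) ^ (21 / 4 : ℝ) ≤ T ^ (1 / 8 : ℝ) :=
        (hpexp _ _ (by norm_num)).trans (hpow (1 / 8) (by norm_num))
      calc (p : ℝ) ^ 4 * T ^ (7 / 8 : ℝ) = (p : ℝ) ^ (21 / 4 : ℝ) * P * T ^ (7 / 8 : ℝ) := by
            rw [hP, ← Real.rpow_add hp0, ← Real.rpow_natCast]; norm_num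
        _ ≤ T ^ (1 / 8 : ℝ) * P * T ^ (7 / 8 : ℝ) := by gcongr
        _ = T ^ (1 / 8 : ℝ) * T ^ (7 / 8 : ℝ) * P := by ring
        _ = T * P := by rw [← Real.rpow_add hT0]; norm_num
    calc _ ≤ 128 * T ^ 2 / p ^ 2 * (12 * (p : ℝ) ^ (1 / 2 : ℝ)) +
          5 * T * (C * ((p : ℝ) ^ 4 * T ^ (7 / 8 : ℝ))) := by
          rw [mul_assoc C]
          gcongr
      _ = 1536 * T ^ 2 * ((p : ℝ) ^ (1 / 2 : ℝ) / p ^ 2) + 5 * C * T * ((p : ℝ) ^ 4 * T ^ (7 / 8 : ℝ)) := by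
          ring
      _ ≤ 1536 * T ^ 2 * P + 5 * C * T * (T * P) := by gcongr
      _ = _ := by ring
  rw [hsplit]
  linarith

/-- A uniform bound for the number of matrices with discriminant divisible by `p ^ 2`. -/
theorem exists_card_sq_dvd_le : ∃ C : ℝ, 0 ≤ C ∧ ∀ (T : ℝ), 1 ≤ T → ∀ p : ℕ, p.Prime → p ≠ 2 →
    ∀ S : Finset SL2Z,
    (∀ γ ∈ S, γ ∈ frobBall T ∧ 2 < |trZ γ| ∧ (p : ℤ) ^ 2 ∣ trZ γ ^ 2 - 4) →
      (S.card : ℝ) ≤ C * T ^ 2 * (p : ℝ) ^ (-(5 / 4) : ℝ) := by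
  obtain ⟨C, hC0, hC⟩ := exists_card_sq_dvd_large_le
  obtain ⟨C', hC0', hC'⟩ := exists_card_sq_dvd_small_le
  refine ⟨max C C', le_max_of_le_left hC0, fun T hT p hp hp2 S hS => ?_⟩
  rcases le_total T ((p : ℝ) ^ 100) with h | h
  · refine (hC T hT p hp hp2 h S hS).trans ?_
    gcongr; exact le_max_left _ _
  · refine (hC' T p hp hp2 h S fun γ hγ => ⟨(hS γ hγ).1, (hS γ hγ).2.2⟩).trans ?_
    gcongr; exact le_max_right _ _

theorem squarefree_int_of_forall_prime {D : ℤ}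
    (h : ∀ p : ℕ, p.Prime → ¬ (p : ℤ) ^ 2 ∣ D) : Squarefree D := by
  rw [← Int.squarefree_natAbs, Nat.squarefree_iff_prime_squarefree]
  intro p hp hd
  refine h p hp ?_
  rw [sq]
  exact_mod_cast Int.natCast_dvd.mpr hd

theorem not_sq_dvd_of_squarefree {D : ℤ} (h : Squarefree D) {p : ℕ} (hp : p.Prime) :
    ¬ (p : ℤ) ^ 2 ∣ D := fun hd =>
  (Nat.prime_iff_prime_int.mp hp).not_isUnit (h _ (by rwa [← sq]))

theorem trZ_sq_sub_four (γ : SL2Z) :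
    trZ γ ^ 2 - 4 = (γ 1 1 - γ 0 0) ^ 2 + 4 * (γ 0 1 * γ 1 0) := by
  have h := SL2Z_det γ
  rw [trZ]; linear_combination 4 * h

theorem emod_four_ne_two_of_isMaximal {γ : SL2Z} (h : IsMaximalZGamma γ) : trZ γ % 4 ≠ 2 := by
  obtain ⟨-, m, D, -, -, hD, hm, hif⟩ := h
  intro h2
  obtain ⟨k, hk⟩ : ∃ k, trZ γ = 4 * k + 2 := ⟨trZ γ / 4, by omega⟩
  have h4 : trZ γ ^ 2 - 4 = 16 * (k * (k + 1)) := by rw [hk]; ring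
  split_ifs at hif with hmod
  · subst hif; omega
  · subst hif
    exact not_sq_dvd_of_squarefree hD Nat.prime_two (Dvd.intro (k * (k + 1)) (by push_cast; linarith))

theorem not_sq_dvd_of_isMaximal {γ : SL2Z} (h : IsMaximalZGamma γ) {p : ℕ} (hp : p.Prime)
    (hp2 : p ≠ 2) : ¬ (p : ℤ) ^ 2 ∣ trZ γ ^ 2 - 4 := by
  obtain ⟨-, m, D, -, -, hD, hm, hif⟩ := h
  intro hd
  refine not_sq_dvd_of_squarefree hD hp ?_
  rw [hm] at hd
  refine IsCoprime.dvd_of_dvd_mul_left (IsCoprime.pow ?_) hd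
  split_ifs at hif with hmod
  · rw [hif]; exact isCoprime_one_right
  · rw [hif]
    exact_mod_cast Nat.isCoprime_iff_coprime.mpr ((Nat.coprime_primes hp Nat.prime_two).mpr hp2)

theorem uGamma_eq_one {γ : SL2Z} (h2 : trZ γ % 4 ≠ 2)
    (h : ∀ p : ℕ, p.Prime → p ≠ 2 → ¬ (p : ℤ) ^ 2 ∣ trZ γ ^ 2 - 4) : uGamma γ = 1 := by
  by_contra hne
  obtain ⟨p, hp, hpu⟩ := Nat.exists_prime_and_dvd hne
  have hpuZ : (p : ℤ) ∣ (uGamma γ : ℤ) := by exact_mod_cast hpu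
  rw [uGamma] at hpuZ
  have hc := hpuZ.trans (Int.gcd_dvd_left _ _)
  have hg := hpuZ.trans (Int.gcd_dvd_right _ _)
  have hda := hg.trans (Int.gcd_dvd_left _ _)
  have hb := hg.trans (Int.gcd_dvd_right _ _)
  have ht := trZ_sq_sub_four γ
  by_cases hp2 : p = 2
  · subst hp2
    obtain ⟨c, hc⟩ := hc
    obtain ⟨b, hb⟩ := hb
    obtain ⟨e, he⟩ := hda
    have htr : trZ γ = 2 * (γ 0 0 + e) := by rw [trZ]; push_cast at he; linarith
    rw [hc, hb, he] at ht
    obtain ⟨k, hk⟩ : ∃ k, trZ γ = 4 * k := ⟨trZ γ / 4, by omega⟩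
    rw [hk] at ht
    push_cast at ht
    have h1 : e ^ 2 = 4 * (k ^ 2 - b * c) - 1 := by linarith
    rcases Int.even_or_odd' e with ⟨f, rfl | rfl⟩
    · have : 4 * (f ^ 2) = 4 * (k ^ 2 - b * c) - 1 := by linarith
      omega
    · have : 4 * (f ^ 2 + f) + 1 = 4 * (k ^ 2 - b * c) - 1 := by linarith
      omega
  · refine h p hp hp2 ?_
    rw [ht]
    refine dvd_add (pow_dvd_pow_of_dvd hda 2) (Dvd.dvd.mul_left ?_ _)
    rw [sq]; exact mul_dvd_mul hb hc

/-- For hyperbolic `γ`, maximality of `ℤ[γ]` is a condition on the trace. -/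
theorem isMaximalZGamma_iff {γ : SL2Z} (hγ : 2 < |trZ γ|) :
    IsMaximalZGamma γ ↔
      trZ γ % 4 ≠ 2 ∧ ∀ p : ℕ, p.Prime → p ≠ 2 → ¬ (p : ℤ) ^ 2 ∣ trZ γ ^ 2 - 4 := by
  refine ⟨fun h => ⟨emod_four_ne_two_of_isMaximal h, fun p hp hp2 => not_sq_dvd_of_isMaximal h hp hp2⟩,
    fun ⟨h2, h⟩ => ⟨uGamma_eq_one h2 h, ?_⟩⟩
  have h9 : 9 ≤ trZ γ ^ 2 := by
    rw [← sq_abs]; nlinarith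
  rcases Int.even_or_odd' (trZ γ) with ⟨s, hs | hs⟩
  · obtain ⟨k, hk⟩ : ∃ k, s = 2 * k := ⟨s / 2, by omega⟩
    have hD : trZ γ ^ 2 - 4 = 2 ^ 2 * (s ^ 2 - 1) := by rw [hs]; ring
    have hDk : s ^ 2 - 1 = 4 * k ^ 2 - 1 := by rw [hk]; ring
    refine ⟨2, s ^ 2 - 1, by norm_num, by omega, ?_, hD, ?_⟩
    · refine squarefree_int_of_forall_prime fun p hp hd => ?_
      by_cases hp2 : p = 2
      · subst hp2; push_cast at hd; omega
      · exact h p hp hp2 (hD ▸ hd.mul_left _)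
    · rw [if_neg (by omega)]
  · have hDk : trZ γ ^ 2 - 4 = 4 * (s ^ 2 + s - 1) + 1 := by rw [hs]; ring
    refine ⟨1, trZ γ ^ 2 - 4, le_rfl, by omega, ?_, by ring, ?_⟩
    · refine squarefree_int_of_forall_prime fun p hp hd => ?_
      by_cases hp2 : p = 2
      · subst hp2; push_cast at hd; omega
      · exact h p hp hp2 hd
    · rw [if_pos (by omega)]

open Classical in
theorem card_isUnit_entry (R : Type*) [CommRing R] [Fintype R] [DecidableEq R] :
    (Finset.univ.filter fun g : SpecialLinearGroup (Fin 2) R => IsUnit (g 0 1)).card =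
      Fintype.card R * (Fintype.card R * (Finset.univ.filter fun x : R => IsUnit x).card) := by
  rw [← Finset.card_univ, ← Finset.card_product, ← Finset.card_product]
  refine Finset.card_bij (fun g _ => (g 0 0, g 1 1, g 0 1)) ?_ ?_ ?_
  · intro g hg
    rw [Finset.mem_filter] at hg
    simpa using hg.2
  · intro g hg g' hg' h
    rw [Finset.mem_filter] at hg
    rw [Prod.mk.injEq, Prod.mk.injEq] at h
    obtain ⟨h1, h2, h3⟩ := h
    have d := g.det_coe
    have d' := g'.det_coe
    rw [Matrix.det_fin_two] at d d'
    have h4 : g 1 0 = g' 1 0 := by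
      refine hg.2.mul_left_cancel ?_
      rw [← h1, ← h2, ← h3] at d'
      linear_combination d' - d
    ext i j
    fin_cases i <;> fin_cases j
    exacts [h1, h3, h4, h2]
  · rintro ⟨a, d, b⟩ h
    rw [Finset.mem_product, Finset.mem_product, Finset.mem_filter] at h
    obtain ⟨u, hu⟩ := h.2.2.2
    change (u : R) = b at hu
    refine ⟨⟨!![a, b; (a * d - 1) * ((u⁻¹ : Rˣ) : R), d], ?_⟩, ?_, rfl⟩
    · rw [Matrix.det_fin_two_of, ← hu]
      linear_combination -(a * d - 1) * u.mul_inv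
    · exact Finset.mem_filter.mpr ⟨Finset.mem_univ _, u, hu⟩

theorem isUnit_of_mul_eq_one_add {R : Type*} [CommRing R] (h : ∀ x y : R, ¬ IsUnit x → ¬ IsUnit y → x * y = 0)
    {b : R} (hb : ¬ IsUnit b) (a d c : R) (hdet : a * d = 1 + b * c) : IsUnit a := by
  have hbc : ¬ IsUnit (b * c) := fun hu => hb (isUnit_of_mul_isUnit_left hu)
  refine IsUnit.of_mul_eq_one (d * (1 - b * c)) ?_
  linear_combination (1 - b * c) * hdet - h _ _ hbc hbc

open Classical in
theorem card_not_isUnit_entry (R : Type*) [CommRing R] [Fintype R] [DecidableEq R]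
    (h : ∀ x y : R, ¬ IsUnit x → ¬ IsUnit y → x * y = 0) :
    (Finset.univ.filter fun g : SpecialLinearGroup (Fin 2) R => ¬ IsUnit (g 0 1)).card =
      (Finset.univ.filter fun x : R => IsUnit x).card *
        ((Finset.univ.filter fun x : R => ¬ IsUnit x).card * Fintype.card R) := by
  rw [← Finset.card_univ, ← Finset.card_product, ← Finset.card_product]
  refine Finset.card_bij (fun g _ => (g 0 0, g 0 1, g 1 0)) ?_ ?_ ?_
  · intro g hg
    rw [Finset.mem_filter] at hg
    have d := g.det_coe
    rw [Matrix.det_fin_two] at d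
    have := isUnit_of_mul_eq_one_add h hg.2 (g 0 0) (g 1 1) (g 1 0) (by linear_combination d)
    simpa using ⟨this, hg.2⟩
  · intro g hg g' hg' h'
    rw [Finset.mem_filter] at hg
    rw [Prod.mk.injEq, Prod.mk.injEq] at h'
    obtain ⟨h1, h2, h3⟩ := h'
    have d := g.det_coe
    have d' := g'.det_coe
    rw [Matrix.det_fin_two] at d d'
    have hu := isUnit_of_mul_eq_one_add h hg.2 (g 0 0) (g 1 1) (g 1 0) (by linear_combination d)
    have h4 : g 1 1 = g' 1 1 := by
      refine hu.mul_left_cancel ?_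
      rw [← h1, ← h2, ← h3] at d'
      linear_combination d - d'
    ext i j
    fin_cases i <;> fin_cases j
    exacts [h1, h2, h3, h4]
  · rintro ⟨a, b, c⟩ h'
    rw [Finset.mem_product, Finset.mem_product, Finset.mem_filter, Finset.mem_filter] at h'
    obtain ⟨u, hu⟩ := h'.1.2
    change (u : R) = a at hu
    refine ⟨⟨!![a, b; c, (1 + b * c) * ((u⁻¹ : Rˣ) : R)], ?_⟩, ?_, rfl⟩
    · rw [Matrix.det_fin_two_of, ← hu]
      linear_combination (1 + b * c) * u.mul_inv
    · exact Finset.mem_filter.mpr ⟨Finset.mem_univ _, h'.2.1.2⟩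

open Classical in
theorem card_trace_two_isUnit_entry (R : Type*) [CommRing R] [Fintype R] [DecidableEq R] :
    (Finset.univ.filter fun g : SpecialLinearGroup (Fin 2) R =>
      g 0 0 + g 1 1 = 2 ∧ IsUnit (g 0 1)).card =
      Fintype.card R * (Finset.univ.filter fun x : R => IsUnit x).card := by
  rw [← Finset.card_univ, ← Finset.card_product]
  refine Finset.card_bij (fun g _ => (g 0 0, g 0 1)) ?_ ?_ ?_
  · intro g hg
    rw [Finset.mem_filter] at hg
    simpa using hg.2.2
  · intro g hg g' hg' h
    rw [Finset.mem_filter] at hg hg'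
    rw [Prod.mk.injEq] at h
    obtain ⟨h1, h3⟩ := h
    have d := g.det_coe
    have d' := g'.det_coe
    rw [Matrix.det_fin_two] at d d'
    have h2 : g 1 1 = g' 1 1 := by linear_combination hg.2.1 - hg'.2.1 - h1
    have h4 : g 1 0 = g' 1 0 := by
      refine hg.2.2.mul_left_cancel ?_
      rw [← h1, ← h2, ← h3] at d'
      linear_combination d' - d
    ext i j
    fin_cases i <;> fin_cases j
    exacts [h1, h3, h4, h2]
  · rintro ⟨a, b⟩ h
    rw [Finset.mem_product, Finset.mem_filter] at h
    obtain ⟨u, hu⟩ := h.2.2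
    change (u : R) = b at hu
    refine ⟨⟨!![a, b; (a * (2 - a) - 1) * ((u⁻¹ : Rˣ) : R), 2 - a], ?_⟩, ?_, rfl⟩
    · rw [Matrix.det_fin_two_of, ← hu]
      linear_combination -(a * (2 - a) - 1) * u.mul_inv
    · exact Finset.mem_filter.mpr ⟨Finset.mem_univ _, add_sub_cancel a 2, u, hu⟩

open Classical in
theorem card_trace_two_not_isUnit_entry (R : Type*) [CommRing R] [Fintype R] [DecidableEq R] [Nontrivial R]
    (h : ∀ x y : R, ¬ IsUnit x → ¬ IsUnit y → x * y = 0) :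
    (Finset.univ.filter fun g : SpecialLinearGroup (Fin 2) R =>
      g 0 0 + g 1 1 = 2 ∧ ¬ IsUnit (g 0 1)).card =
      (Finset.univ.filter fun x : R => ¬ IsUnit x).card *
        (Fintype.card R + ((Finset.univ.filter fun x : R => ¬ IsUnit x).card - 1) *
          (Finset.univ.filter fun x : R => ¬ IsUnit x).card) := by
  set N := Finset.univ.filter fun x : R => ¬ IsUnit x with hN
  have h0 : (0 : R) ∈ N := by rw [hN, Finset.mem_filter]; exact ⟨Finset.mem_univ _, not_isUnit_zero⟩
  have hcard : (N ×ˢ (({(0 : R)} ×ˢ Finset.univ) ∪ ((N.erase 0) ×ˢ N))).card =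
      N.card * (Fintype.card R + (N.card - 1) * N.card) := by
    rw [Finset.card_product, Finset.card_union_of_disjoint, Finset.card_product, Finset.card_product,
      Finset.card_singleton, one_mul, Finset.card_univ, Finset.card_erase_of_mem h0]
    rw [Finset.disjoint_left]
    rintro ⟨b, c⟩ h1 h2
    rw [Finset.mem_product, Finset.mem_singleton] at h1
    rw [Finset.mem_product, Finset.mem_erase] at h2
    exact h2.1.1 h1.1
  rw [← hcard]
  refine Finset.card_bij (fun g _ => (g 0 0 - 1, g 0 1, g 1 0)) ?_ ?_ ?_
  · intro g hg
    rw [Finset.mem_filter] at hg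
    obtain ⟨-, ht, hb⟩ := hg
    have d := g.det_coe
    rw [Matrix.det_fin_two] at d
    have hx : (g 0 0 - 1) * (g 0 0 - 1) = - (g 0 1 * g 1 0) := by
      linear_combination g 0 0 * ht - d
    have hxN : ¬ IsUnit (g 0 0 - 1) := fun hu => hb (by
      have h1 := hu.mul hu
      rw [hx, IsUnit.neg_iff] at h1
      exact isUnit_of_mul_isUnit_left h1)
    rw [h _ _ hxN hxN] at hx
    rw [Finset.mem_product, Finset.mem_union, Finset.mem_product, Finset.mem_product,
      Finset.mem_singleton, Finset.mem_erase, hN, Finset.mem_filter, Finset.mem_filter, Finset.mem_filter]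
    refine ⟨⟨Finset.mem_univ _, hxN⟩, ?_⟩
    by_cases hb0 : g 0 1 = 0
    · exact Or.inl ⟨hb0, Finset.mem_univ _⟩
    · refine Or.inr ⟨⟨hb0, Finset.mem_univ _, hb⟩, Finset.mem_univ _, fun hu => hb0 ?_⟩
      refine hu.mul_right_cancel ?_
      linear_combination hx
  · intro g hg g' hg' h'
    rw [Finset.mem_filter] at hg hg'
    rw [Prod.mk.injEq, Prod.mk.injEq] at h'
    obtain ⟨h1, h2, h3⟩ := h'
    have h1 : g 0 0 = g' 0 0 := by linear_combination h1
    have h4 : g 1 1 = g' 1 1 := by linear_combination hg.2.1 - hg'.2.1 - h1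
    ext i j
    fin_cases i <;> fin_cases j
    exacts [h1, h2, h3, h4]
  · rintro ⟨x, b, c⟩ h'
    rw [Finset.mem_product, Finset.mem_union, Finset.mem_product, Finset.mem_product,
      Finset.mem_singleton, Finset.mem_erase, hN, Finset.mem_filter, Finset.mem_filter,
      Finset.mem_filter] at h'
    obtain ⟨⟨-, hx⟩, h'⟩ := h'
    change ¬ IsUnit x at hx
    have hb : ¬ IsUnit b ∧ b * c = 0 := by
      rcases h' with ⟨h1, -⟩ | ⟨⟨-, -, h1⟩, -, h2⟩
      · change b = 0 at h1
        rw [h1]; exact ⟨not_isUnit_zero, zero_mul _⟩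
      · exact ⟨h1, h _ _ h1 h2⟩
    refine ⟨⟨!![1 + x, b; c, 1 - x], ?_⟩, ?_, ?_⟩
    · rw [Matrix.det_fin_two_of]
      linear_combination -hb.2 - h x x hx hx
    · refine Finset.mem_filter.mpr ⟨Finset.mem_univ _, ?_, hb.1⟩
      change 1 + x + (1 - x) = 2
      ring
    · rw [Prod.mk.injEq]
      refine ⟨?_, rfl⟩
      change 1 + x - 1 = x
      ring

open Classical in
theorem card_SL_of_mul_eq_zero (R : Type*) [CommRing R] [Fintype R] [DecidableEq R]
    (h : ∀ x y : R, ¬ IsUnit x → ¬ IsUnit y → x * y = 0) (n u k : ℕ) (hn : Fintype.card R = n)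
    (hu : (Finset.univ.filter fun x : R => IsUnit x).card = u)
    (hk : (Finset.univ.filter fun x : R => ¬ IsUnit x).card = k) :
    Fintype.card (SpecialLinearGroup (Fin 2) R) = n * (n * u) + u * (k * n) := by
  have h1 := Finset.card_filter_add_card_filter_not (s := Finset.univ)
    (fun g : SpecialLinearGroup (Fin 2) R => IsUnit (g 0 1))
  rw [card_isUnit_entry, card_not_isUnit_entry R h, hn, hu, hk, Finset.card_univ] at h1
  exact h1.symm

open Classical in
theorem card_trace_eq_two (R : Type*) [CommRing R] [Fintype R] [DecidableEq R] [Nontrivial R]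
    (h : ∀ x y : R, ¬ IsUnit x → ¬ IsUnit y → x * y = 0) (n u k : ℕ) (hn : Fintype.card R = n)
    (hu : (Finset.univ.filter fun x : R => IsUnit x).card = u)
    (hk : (Finset.univ.filter fun x : R => ¬ IsUnit x).card = k) :
    (Finset.univ.filter fun g : SpecialLinearGroup (Fin 2) R => g 0 0 + g 1 1 = 2).card =
      n * u + k * (n + (k - 1) * k) := by
  have h1 := Finset.card_filter_add_card_filter_not
    (s := Finset.univ.filter fun g : SpecialLinearGroup (Fin 2) R => g 0 0 + g 1 1 = 2)
    (fun g : SpecialLinearGroup (Fin 2) R => IsUnit (g 0 1))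
  rw [Finset.filter_filter, Finset.filter_filter, card_trace_two_isUnit_entry,
    card_trace_two_not_isUnit_entry R h, hn, hu, hk] at h1
  exact h1.symm

open Classical in
theorem card_trace_eq_neg_two (R : Type*) [CommRing R] [Fintype R] [DecidableEq R] :
    (Finset.univ.filter fun g : SpecialLinearGroup (Fin 2) R => g 0 0 + g 1 1 = -2).card =
    (Finset.univ.filter fun g : SpecialLinearGroup (Fin 2) R => g 0 0 + g 1 1 = 2).card := by
  have hneg : ∀ (g : SpecialLinearGroup (Fin 2) R) (i j : Fin 2), (-g) i j = -(g i j) := fun _ _ _ => rfl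
  refine Finset.card_nbij' (fun g => -g) (fun g => -g) ?_ ?_ ?_ ?_
  · intro g hg
    have := (Finset.mem_filter.mp hg).2
    refine Finset.mem_filter.mpr ⟨Finset.mem_univ _, ?_⟩
    rw [hneg, hneg]; linear_combination -this
  · intro g hg
    have := (Finset.mem_filter.mp hg).2
    refine Finset.mem_filter.mpr ⟨Finset.mem_univ _, ?_⟩
    rw [hneg, hneg]; linear_combination -this
  · exact fun g _ => neg_neg g
  · exact fun g _ => neg_neg g

theorem ZMod_sq_mul_eq_zero {p : ℕ} (hp : p.Prime) (x y : ZMod (p ^ 2)) (hx : ¬ IsUnit x)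
    (hy : ¬ IsUnit y) : x * y = 0 := by
  have hneq : NeZero (p ^ 2) := ⟨pow_ne_zero _ hp.ne_zero⟩
  have key : ∀ z : ZMod (p ^ 2), ¬ IsUnit z → ∃ k : ℕ, z = (p : ZMod (p ^ 2)) * (k : ZMod (p ^ 2)) := by
    intro z hz
    rw [← ZMod.natCast_zmod_val z, ZMod.isUnit_iff_coprime, Nat.coprime_pow_right_iff two_pos,
      Nat.coprime_comm, hp.coprime_iff_not_dvd, not_not] at hz
    obtain ⟨k, hk⟩ := hz
    exact ⟨k, by rw [← ZMod.natCast_zmod_val z, hk]; push_cast; rfl⟩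
  obtain ⟨k, rfl⟩ := key x hx
  obtain ⟨l, rfl⟩ := key y hy
  have : ((p ^ 2 : ℕ) : ZMod (p ^ 2)) = 0 := ZMod.natCast_self _
  push_cast at this
  linear_combination (k : ZMod (p ^ 2)) * l * this

open Classical in
theorem card_isUnit_ZMod_sq {p : ℕ} (hp : p.Prime) [NeZero (p ^ 2)] :
    (Finset.univ.filter fun x : ZMod (p ^ 2) => IsUnit x).card = p * (p - 1) := by
  have h1 := ZMod.card_units_eq_totient (p ^ 2)
  rw [Nat.totient_prime_pow hp two_pos, show 2 - 1 = 1 from rfl, pow_one] at h1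
  rw [← h1, ← Finset.card_univ]
  symm
  refine Finset.card_bij (fun u _ => (u : ZMod (p ^ 2))) ?_ ?_ ?_
  · intro u _; exact Finset.mem_filter.mpr ⟨Finset.mem_univ _, u.isUnit⟩
  · intro u _ v _ h; exact Units.ext h
  · intro x hx
    obtain ⟨u, hu⟩ := (Finset.mem_filter.mp hx).2
    exact ⟨u, Finset.mem_univ _, hu⟩

open Classical in
theorem card_not_isUnit_ZMod_sq {p : ℕ} (hp : p.Prime) [NeZero (p ^ 2)] :
    (Finset.univ.filter fun x : ZMod (p ^ 2) => ¬ IsUnit x).card = p := by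
  have h := Finset.card_filter_add_card_filter_not (s := Finset.univ) (fun x : ZMod (p ^ 2) => IsUnit x)
  rw [card_isUnit_ZMod_sq hp, Finset.card_univ, ZMod.card] at h
  obtain ⟨m, rfl⟩ : ∃ m, p = m + 1 := ⟨p - 1, (Nat.sub_add_cancel hp.one_le).symm⟩
  rw [Nat.add_sub_cancel] at h
  have e : (m + 1) ^ 2 = (m + 1) * m + (m + 1) := by ring
  exact Nat.add_left_cancel (h.trans e)

/-- The matrices modulo `q` with trace different from `2` and `-2`. -/
def goodTrace (q : ℕ) : Set (SpecialLinearGroup (Fin 2) (ZMod q)) :=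
  {g | g 0 0 + g 1 1 ≠ 2 ∧ g 0 0 + g 1 1 ≠ -2}

/-- The proportion of matrices modulo `p ^ 2` with trace different from `2` and `-2`. -/
def localDensity (p : ℕ) : ℝ :=
  if p = 2 then 7 / 12 else
    1 - 2 * ((p : ℝ) ^ 2 + p - 1) / ((p : ℝ) ^ 2 * ((p : ℝ) ^ 2 - 1))

theorem card_goodTrace {p : ℕ} (hp : p.Prime) :
    ((goodTrace (p ^ 2)).ncard : ℝ) =
      localDensity p * Nat.card (SpecialLinearGroup (Fin 2) (ZMod (p ^ 2))) := by
  classical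
  have hneq : NeZero (p ^ 2) := ⟨pow_ne_zero _ hp.ne_zero⟩
  have hnt : Nontrivial (ZMod (p ^ 2)) :=
    ZMod.nontrivial_iff.mpr (by have := Nat.one_lt_pow two_ne_zero hp.one_lt; omega)
  have hp0 : (0 : ℝ) < p := by exact_mod_cast hp.pos
  have hp1 : (1 : ℝ) < p := by exact_mod_cast hp.one_lt
  have hzero := ZMod_sq_mul_eq_zero hp
  have hcast : ((p - 1 : ℕ) : ℝ) = p - 1 := by rw [Nat.cast_sub hp.one_le, Nat.cast_one]
  have hG := card_SL_of_mul_eq_zero (ZMod (p ^ 2)) hzero _ _ _ (ZMod.card _)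
    (card_isUnit_ZMod_sq hp) (card_not_isUnit_ZMod_sq hp)
  have hT := card_trace_eq_two (ZMod (p ^ 2)) hzero _ _ _ (ZMod.card _)
    (card_isUnit_ZMod_sq hp) (card_not_isUnit_ZMod_sq hp)
  have hT' := card_trace_eq_neg_two (ZMod (p ^ 2))
  rw [hT] at hT'
  set G := SpecialLinearGroup (Fin 2) (ZMod (p ^ 2)) with hGdef
  set A := Finset.univ.filter fun g : G => g 0 0 + g 1 1 = 2 with hA
  set B := Finset.univ.filter fun g : G => g 0 0 + g 1 1 = -2 with hB
  have hgood : (goodTrace (p ^ 2)) = ((A ∪ B)ᶜ : Finset G) := by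
    ext g
    rw [Finset.coe_compl, Set.mem_compl_iff, Finset.mem_coe, Finset.mem_union, hA, hB,
      Finset.mem_filter, Finset.mem_filter, not_or]
    simp [goodTrace]
  have hcompl := Finset.card_compl_add_card (A ∪ B)
  rw [hgood, Set.ncard_coe_finset, Nat.card_eq_fintype_card]
  have hcomplR : (((A ∪ B)ᶜ : Finset G).card : ℝ) = Fintype.card G - (A ∪ B).card := by
    rw [← hcompl]; push_cast; ring
  rw [hcomplR, hG]
  by_cases hp2 : p = 2
  · subst hp2
    have hAB : A = B := by
      rw [hA, hB]
      congr 1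
    rw [← hAB, Finset.union_self, hT, localDensity, if_pos rfl]
    norm_num
  · have hdisj : Disjoint A B := by
      rw [Finset.disjoint_left]
      intro g h1 h2
      have h3 := (Finset.mem_filter.mp h1).2.symm.trans (Finset.mem_filter.mp h2).2
      have h4 : ((4 : ℕ) : ZMod (p ^ 2)) = 0 := by push_cast; linear_combination h3
      rw [ZMod.natCast_eq_zero_iff] at h4
      have h5 : p ∣ 2 ^ 2 := (dvd_pow_self p two_ne_zero).trans h4
      exact hp2 ((Nat.prime_dvd_prime_iff_eq hp Nat.prime_two).mp (hp.dvd_of_dvd_pow h5))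
    rw [Finset.card_union_of_disjoint hdisj, hT, hT', localDensity, if_neg hp2]
    have h1 : (p : ℝ) ^ 2 - 1 ≠ 0 := by nlinarith
    push_cast
    rw [hcast]
    field_simp
    ring

section ChineseRemainder

variable {m n : ℕ}

/-- The Chinese remainder homomorphism on special linear groups. -/
def crtSL (h : m.Coprime n) : SpecialLinearGroup (Fin 2) (ZMod (m * n)) →*
    SpecialLinearGroup (Fin 2) (ZMod m) × SpecialLinearGroup (Fin 2) (ZMod n) :=
  (SpecialLinearGroup.map ((RingHom.fst _ _).comp (ZMod.chineseRemainder h).toRingHom)).prod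
    (SpecialLinearGroup.map ((RingHom.snd _ _).comp (ZMod.chineseRemainder h).toRingHom))

theorem crtSL_fst_apply (h : m.Coprime n) (g : SpecialLinearGroup (Fin 2) (ZMod (m * n))) (i j : Fin 2) :
    (crtSL h g).1 i j = (ZMod.chineseRemainder h (g i j)).1 := rfl

theorem crtSL_snd_apply (h : m.Coprime n) (g : SpecialLinearGroup (Fin 2) (ZMod (m * n))) (i j : Fin 2) :
    (crtSL h g).2 i j = (ZMod.chineseRemainder h (g i j)).2 := rfl

theorem crtSL_redMod (h : m.Coprime n) (γ : SL2Z) :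
    crtSL h (redMod (m * n) γ) = (redMod m γ, redMod n γ) := by
  refine Prod.ext ?_ ?_
  · ext i j
    rw [crtSL_fst_apply, redMod_apply, map_intCast]; rfl
  · ext i j
    rw [crtSL_snd_apply, redMod_apply, map_intCast]; rfl

theorem crtSL_bijective (h : m.Coprime n) : Function.Bijective (crtSL h) := by
  constructor
  · intro g g' hg
    ext i j
    refine (ZMod.chineseRemainder h).injective (Prod.ext ?_ ?_)
    · rw [← crtSL_fst_apply, ← crtSL_fst_apply, hg]
    · rw [← crtSL_snd_apply, ← crtSL_snd_apply, hg]
  · rintro ⟨a, b⟩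
    set e := ZMod.chineseRemainder h with he
    have hdet : (Matrix.of fun i j : Fin 2 => e.symm (a i j, b i j)).det = 1 := by
      refine e.injective ?_
      rw [Matrix.det_fin_two]
      simp only [Matrix.of_apply, map_sub, map_mul, map_one, RingEquiv.apply_symm_apply]
      have da := a.det_coe
      have db := b.det_coe
      rw [Matrix.det_fin_two] at da db
      exact Prod.ext da db
    refine ⟨⟨_, hdet⟩, ?_⟩
    refine Prod.ext ?_ ?_
    · ext i j
      change (e (e.symm (a i j, b i j))).1 = _
      rw [RingEquiv.apply_symm_apply]
    · ext i j
      change (e (e.symm (a i j, b i j))).2 = _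
      rw [RingEquiv.apply_symm_apply]

theorem card_SL_mul (h : m.Coprime n) : Nat.card (SpecialLinearGroup (Fin 2) (ZMod (m * n))) =
    Nat.card (SpecialLinearGroup (Fin 2) (ZMod m)) * Nat.card (SpecialLinearGroup (Fin 2) (ZMod n)) := by
  rw [← Nat.card_prod]
  exact Nat.card_congr (Equiv.ofBijective _ (crtSL_bijective h))

theorem ncard_crtSL_preimage (h : m.Coprime n) (A : Set (SpecialLinearGroup (Fin 2) (ZMod m)))
    (B : Set (SpecialLinearGroup (Fin 2) (ZMod n))) :
    (crtSL h ⁻¹' (A ×ˢ B)).ncard = A.ncard * B.ncard := by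
  rw [Set.ncard_preimage_of_injective_subset_range (crtSL_bijective h).1, Set.ncard_prod]
  rw [(crtSL_bijective h).2.range_eq]
  exact Set.subset_univ _

end ChineseRemainder

/-- Finitely many trace conditions modulo squares of primes amount to one congruence condition. -/
theorem exists_modulus (P : Finset ℕ) (hP : ∀ p ∈ P, p.Prime) :
    ∃ q : ℕ, 0 < q ∧ (∀ l : ℕ, l.Prime → l ∉ P → l.Coprime q) ∧
      ∃ A : Set (SpecialLinearGroup (Fin 2) (ZMod q)),
        (∀ γ : SL2Z, redMod q γ ∈ A ↔ ∀ p ∈ P, redMod (p ^ 2) γ ∈ goodTrace (p ^ 2)) ∧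
        (A.ncard : ℝ) = (∏ p ∈ P, localDensity p) *
          Nat.card (SpecialLinearGroup (Fin 2) (ZMod q)) := by
  classical
  induction P using Finset.induction_on with
  | empty =>
    refine ⟨1, one_pos, fun l _ _ => Nat.coprime_one_right l, Set.univ, fun γ => ?_, ?_⟩
    · simp
    · rw [Set.ncard_univ, Finset.prod_empty, one_mul]
  | insert p P hpP ih =>
    obtain ⟨q, hq, hcop, A, hA, hcard⟩ := ih fun l hl => hP l (Finset.mem_insert_of_mem hl)
    have hp := hP p (Finset.mem_insert_self p P)
    have hpq : (p ^ 2).Coprime q := Nat.Coprime.pow_left 2 (hcop p hp hpP)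
    refine ⟨p ^ 2 * q, Nat.mul_pos (pow_pos hp.pos 2) hq, fun l hl hlP => ?_,
      crtSL hpq ⁻¹' (goodTrace (p ^ 2) ×ˢ A), fun γ => ?_, ?_⟩
    · rw [Finset.mem_insert, not_or] at hlP
      exact Nat.Coprime.mul_right (Nat.Coprime.pow_right 2 ((Nat.coprime_primes hl hp).mpr hlP.1))
        (hcop l hl hlP.2)
    · rw [Set.mem_preimage, crtSL_redMod, Set.mem_prod, hA, Finset.forall_mem_insert]
    · rw [ncard_crtSL_preimage, card_SL_mul hpq, Nat.cast_mul, Nat.cast_mul, hcard, card_goodTrace hp,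
        Finset.prod_insert hpP]
      ring

/-- The density of matrices satisfying finitely many trace conditions. -/
theorem tendsto_card_good_div (P : Finset ℕ) (hP : ∀ p ∈ P, p.Prime) (F : ℝ → Finset SL2Z)
    (hF : ∀ T γ, γ ∈ F T ↔ γ ∈ frobBall T ∧ ∀ p ∈ P, redMod (p ^ 2) γ ∈ goodTrace (p ^ 2)) :
    Tendsto (fun T : ℝ => ((F T).card : ℝ) / (frobBall T).card) atTop
      (𝓝 (∏ p ∈ P, localDensity p)) := by
  classical
  obtain ⟨q, hq, -, A, hA, hcard⟩ := exists_modulus P hP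
  have hneq : NeZero q := ⟨hq.ne'⟩
  have hfin : Finite (SpecialLinearGroup (Fin 2) (ZMod q)) := Subtype.finite
  have hcpos : (0 : ℝ) < Nat.card (SpecialLinearGroup (Fin 2) (ZMod q)) := by
    exact_mod_cast Nat.card_pos
  have hAfin : A.Finite := Set.toFinite A
  have hsum : ∀ T, ((F T).card : ℝ) / (frobBall T).card =
      ∑ g ∈ hAfin.toFinset, ((congBall q T g).card : ℝ) / (frobBall T).card := by
    intro T
    rw [← Finset.sum_div]
    congr 1
    have hmaps : ∀ γ ∈ F T, redMod q γ ∈ hAfin.toFinset := by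
      intro γ hγ
      rw [Set.Finite.mem_toFinset, hA]
      exact ((hF T γ).mp hγ).2
    rw [Finset.card_eq_sum_card_fiberwise hmaps]
    push_cast
    refine Finset.sum_congr rfl fun g hg => ?_
    congr 2
    ext γ
    rw [Set.Finite.mem_toFinset] at hg
    rw [Finset.mem_filter, hF, mem_congBall, mem_frobBall, ← hA]
    constructor
    · rintro ⟨⟨h1, -⟩, h2⟩; exact ⟨h1, h2⟩
    · rintro ⟨h1, h2⟩; exact ⟨⟨h1, h2 ▸ hg⟩, h2⟩
  have hlim : ∏ p ∈ P, localDensity p =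
      ∑ g ∈ hAfin.toFinset, (1 / (Nat.card (SpecialLinearGroup (Fin 2) (ZMod q)) : ℝ)) := by
    rw [Finset.sum_const, nsmul_eq_mul, ← Set.ncard_eq_toFinset_card A hAfin, hcard, mul_one_div,
      mul_div_cancel_right₀ _ hcpos.ne']
  rw [hlim]
  refine Tendsto.congr (fun T => (hsum T).symm) ?_
  exact tendsto_finsetSum _ fun g _ => tendsto_card_congBall_div g

theorem redMod_mem_goodTrace_iff {q : ℕ} {γ : SL2Z} :
    redMod q γ ∈ goodTrace q ↔ ¬ (q : ℤ) ∣ trZ γ - 2 ∧ ¬ (q : ℤ) ∣ trZ γ + 2 := by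
  have h1 : redMod q γ 0 0 + redMod q γ 1 1 = ((trZ γ : ℤ) : ZMod q) := by
    rw [redMod_apply, redMod_apply, trZ, Int.cast_add]
  rw [← ZMod.intCast_zmod_eq_zero_iff_dvd, ← ZMod.intCast_zmod_eq_zero_iff_dvd, goodTrace]
  change redMod q γ 0 0 + redMod q γ 1 1 ≠ 2 ∧ redMod q γ 0 0 + redMod q γ 1 1 ≠ -2 ↔ _
  rw [h1, Int.cast_sub, Int.cast_add, Int.cast_ofNat, sub_eq_zero, add_eq_zero_iff_eq_neg]

theorem redMod_prime_sq_mem_goodTrace_iff {p : ℕ} (hp : p.Prime) (hp2 : p ≠ 2) {γ : SL2Z} :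
    redMod (p ^ 2) γ ∈ goodTrace (p ^ 2) ↔ ¬ (p : ℤ) ^ 2 ∣ trZ γ ^ 2 - 4 := by
  rw [redMod_mem_goodTrace_iff, ← not_or, not_iff_not]
  push_cast
  refine ⟨?_, sq_dvd_sub_two_or hp hp2⟩
  have e : trZ γ ^ 2 - 4 = (trZ γ - 2) * (trZ γ + 2) := by ring
  rw [e]
  rintro (h | h)
  · exact h.mul_right _
  · exact h.mul_left _

theorem redMod_four_mem_goodTrace_iff {γ : SL2Z} :
    redMod (2 ^ 2) γ ∈ goodTrace (2 ^ 2) ↔ trZ γ % 4 ≠ 2 := by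
  rw [redMod_mem_goodTrace_iff]
  push_cast
  omega

theorem isMaximalZGamma_iff_forall_goodTrace {γ : SL2Z} (hγ : 2 < |trZ γ|) :
    IsMaximalZGamma γ ↔ ∀ p : ℕ, p.Prime → redMod (p ^ 2) γ ∈ goodTrace (p ^ 2) := by
  rw [isMaximalZGamma_iff hγ]
  constructor
  · rintro ⟨h2, h⟩ p hp
    by_cases hp2 : p = 2
    · subst hp2; exact redMod_four_mem_goodTrace_iff.mpr h2
    · exact (redMod_prime_sq_mem_goodTrace_iff hp hp2).mpr (h p hp hp2)
  · intro h
    exact ⟨redMod_four_mem_goodTrace_iff.mp (h 2 Nat.prime_two),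
      fun p hp hp2 => (redMod_prime_sq_mem_goodTrace_iff hp hp2).mp (h p hp)⟩

/-- The matrices in the ball satisfying the trace conditions at all primes below `z`. -/
def sievedBall (z : ℕ) (T : ℝ) : Finset SL2Z := by
  classical exact (frobBall T).filter fun γ =>
    ∀ p ∈ (Finset.range z).filter Nat.Prime, redMod (p ^ 2) γ ∈ goodTrace (p ^ 2)

theorem mem_sievedBall {z : ℕ} {T : ℝ} {γ : SL2Z} : γ ∈ sievedBall z T ↔ γ ∈ frobBall T ∧
    ∀ p ∈ (Finset.range z).filter Nat.Prime, redMod (p ^ 2) γ ∈ goodTrace (p ^ 2) := by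
  classical exact Finset.mem_filter

/-- The matrices in the ball which are hyperbolic and maximal. -/
def maximalBall (T : ℝ) : Finset SL2Z := by
  classical exact (frobBall T).filter fun γ => 2 < |trZ γ| ∧ IsMaximalZGamma γ

theorem mem_maximalBall {T : ℝ} {γ : SL2Z} :
    γ ∈ maximalBall T ↔ γ ∈ frobBall T ∧ 2 < |trZ γ| ∧ IsMaximalZGamma γ := by
  classical exact Finset.mem_filter

theorem maximalBall_subset_sievedBall (z : ℕ) (T : ℝ) : maximalBall T ⊆ sievedBall z T := by
  intro γ hγ
  rw [mem_maximalBall] at hγ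
  exact mem_sievedBall.mpr ⟨hγ.1, fun p hp =>
    (isMaximalZGamma_iff_forall_goodTrace hγ.2.1).mp hγ.2.2 p (Finset.mem_filter.mp hp).2⟩

/-- The sieve error is small, uniformly in the radius, when the sieving level is large. -/
theorem exists_level_card_sub_le (ε : ℝ) (hε : 0 < ε) : ∃ z₀ : ℕ, ∀ z ≥ z₀, ∀ᶠ T : ℝ in atTop,
    ((sievedBall z T).card : ℝ) ≤ (maximalBall T).card + ε * T ^ 2 := by
  classical
  obtain ⟨C₁, hC₁, h₁⟩ := exists_card_abs_trace_le_two
  obtain ⟨C₂, hC₂, h₂⟩ := exists_card_sq_dvd_le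
  have hsum : Summable fun n : ℕ => (n : ℝ) ^ (-(5 / 4) : ℝ) :=
    Real.summable_nat_rpow.mpr (by norm_num)
  obtain ⟨s, hs⟩ := summable_iff_vanishing_norm.mp hsum (ε / (2 * (C₂ + 1))) (by positivity)
  refine ⟨s.sup id + 3, fun z hz => ?_⟩
  filter_upwards [eventually_mul_rpow_le C₁ (ε / 2) (3 / 2) (half_pos hε) (by norm_num),
    eventually_ge_atTop 1] with T hT hT1
  set N := (frobBall T).sup fun γ => (trZ γ ^ 2 - 4).natAbs with hN
  set P := (Finset.range (N + 1)).filter fun p => p.Prime ∧ z ≤ p with hP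
  set E : ℕ → Finset SL2Z := fun p =>
    (frobBall T).filter fun γ => 2 < |trZ γ| ∧ (p : ℤ) ^ 2 ∣ trZ γ ^ 2 - 4 with hE
  have hcover : sievedBall z T ⊆
      maximalBall T ∪ ((frobBall T).filter (fun γ => |trZ γ| ≤ 2) ∪ P.biUnion E) := by
    intro γ hγ
    obtain ⟨hγT, hγz⟩ := mem_sievedBall.mp hγ
    rw [Finset.mem_union, Finset.mem_union, Finset.mem_biUnion, mem_maximalBall, Finset.mem_filter]
    by_cases htr : |trZ γ| ≤ 2
    · exact Or.inr (Or.inl ⟨hγT, htr⟩)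
    rw [not_le] at htr
    by_cases hmax : IsMaximalZGamma γ
    · exact Or.inl ⟨hγT, htr, hmax⟩
    rw [isMaximalZGamma_iff_forall_goodTrace htr] at hmax
    push Not at hmax
    obtain ⟨p, hp, hpγ⟩ := hmax
    have hzp : z ≤ p := by
      by_contra hlt
      exact hpγ (hγz p (Finset.mem_filter.mpr ⟨Finset.mem_range.mpr (not_le.mp hlt), hp⟩))
    have hp2 : p ≠ 2 := by omega
    rw [redMod_prime_sq_mem_goodTrace_iff hp hp2, not_not] at hpγ
    refine Or.inr (Or.inr ⟨p, ?_, Finset.mem_filter.mpr ⟨hγT, htr, hpγ⟩⟩)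
    rw [hP, Finset.mem_filter, Finset.mem_range, Nat.lt_succ_iff]
    refine ⟨?_, hp, hzp⟩
    have h9 : 9 ≤ trZ γ ^ 2 := by rw [← sq_abs]; nlinarith
    have h3 : p ^ 2 ∣ (trZ γ ^ 2 - 4).natAbs := by
      have := Int.natAbs_dvd_natAbs.mpr hpγ
      rwa [Int.natAbs_pow, Int.natAbs_natCast] at this
    have h4 : p ^ 2 ≤ (trZ γ ^ 2 - 4).natAbs := Nat.le_of_dvd (by omega) h3
    exact (Nat.le_self_pow two_ne_zero p).trans
      (h4.trans (Finset.le_sup (f := fun γ : SL2Z => (trZ γ ^ 2 - 4).natAbs) hγT))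
  have hcard : (sievedBall z T).card ≤ (maximalBall T).card +
      (((frobBall T).filter (fun γ => |trZ γ| ≤ 2)).card + ∑ p ∈ P, (E p).card) :=
    (Finset.card_le_card hcover).trans ((Finset.card_union_le _ _).trans (Nat.add_le_add_left
      ((Finset.card_union_le _ _).trans (Nat.add_le_add_left Finset.card_biUnion_le _)) _))
  have hcardR : ((sievedBall z T).card : ℝ) ≤ (maximalBall T).card +
      (((frobBall T).filter (fun γ => |trZ γ| ≤ 2)).card + ∑ p ∈ P, ((E p).card : ℝ)) := by
    exact_mod_cast hcard
  have e1 := h₁ T hT1 ((frobBall T).filter (fun γ => |trZ γ| ≤ 2)) fun γ hγ => Finset.mem_filter.mp hγ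
  have e2 : ∑ p ∈ P, ((E p).card : ℝ) ≤ ε / 2 * T ^ 2 := by
    have hdisj : Disjoint P s := by
      rw [Finset.disjoint_left]
      intro p hpP hps
      have h3 := Finset.le_sup (f := id) hps
      rw [id] at h3
      have h4 := (Finset.mem_filter.mp hpP).2.2
      omega
    have h5 := (le_abs_self _).trans (hs P hdisj).le
    calc ∑ p ∈ P, ((E p).card : ℝ) ≤ ∑ p ∈ P, C₂ * T ^ 2 * (p : ℝ) ^ (-(5 / 4) : ℝ) := by
          refine Finset.sum_le_sum fun p hp => ?_
          obtain ⟨hpp, hzp⟩ := (Finset.mem_filter.mp hp).2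
          exact h₂ T hT1 p hpp (by omega) _ fun γ hγ => Finset.mem_filter.mp hγ
      _ = C₂ * T ^ 2 * ∑ p ∈ P, (p : ℝ) ^ (-(5 / 4) : ℝ) := by rw [Finset.mul_sum]
      _ ≤ (C₂ + 1) * T ^ 2 * (ε / (2 * (C₂ + 1))) := by gcongr; linarith
      _ = ε / 2 * T ^ 2 := by field_simp
  linarith

theorem multipliable_localDensity : Multipliable fun p : {p : ℕ // p.Prime ∧ p ≠ 2} =>
    (1 - 2 * ((p.1 : ℝ) ^ 2 + (p.1 : ℝ) - 1) / ((p.1 : ℝ) ^ 2 * ((p.1 : ℝ) ^ 2 - 1))) := by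
  have hs : Summable fun n : ℕ => 4 * (1 / (n : ℝ) ^ 2) :=
    (Real.summable_one_div_nat_pow.mpr one_lt_two).mul_left 4
  have hs' : Summable fun p : {p : ℕ // p.Prime ∧ p ≠ 2} => 4 * (1 / (p.1 : ℝ) ^ 2) :=
    hs.comp_injective Subtype.val_injective
  have h : Summable fun p : {p : ℕ // p.Prime ∧ p ≠ 2} =>
      -(2 * ((p.1 : ℝ) ^ 2 + (p.1 : ℝ) - 1) / ((p.1 : ℝ) ^ 2 * ((p.1 : ℝ) ^ 2 - 1))) := by
    refine hs'.of_norm_bounded fun p => ?_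
    have hp : (2 : ℝ) ≤ p.1 := by exact_mod_cast p.2.1.two_le
    have h1 : 0 < (p.1 : ℝ) ^ 2 - 1 := by nlinarith
    have h0 : 0 < (p.1 : ℝ) := by linarith
    rw [norm_neg, Real.norm_eq_abs, abs_of_nonneg
      (div_nonneg (by nlinarith) (by positivity)), div_le_iff₀ (by positivity)]
    have e : 4 * (1 / (p.1 : ℝ) ^ 2) * ((p.1 : ℝ) ^ 2 * ((p.1 : ℝ) ^ 2 - 1)) =
        4 * ((p.1 : ℝ) ^ 2 - 1) := by field_simp
    rw [e]
    nlinarith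
  simpa only [sub_eq_add_neg] using Real.multipliable_one_add_of_summable h

theorem tendsto_prod_localDensity :
    Tendsto (fun z : ℕ => ∏ p ∈ (Finset.range z).filter Nat.Prime, localDensity p) atTop
      (𝓝 ((7 / 12) * ∏' p : {p : ℕ // p.Prime ∧ p ≠ 2},
        (1 - 2 * ((p.1 : ℝ) ^ 2 + (p.1 : ℝ) - 1) /
          ((p.1 : ℝ) ^ 2 * ((p.1 : ℝ) ^ 2 - 1))))) := by
  set f : ℕ → ℝ := fun n => 1 - 2 * ((n : ℝ) ^ 2 + n - 1) / ((n : ℝ) ^ 2 * ((n : ℝ) ^ 2 - 1)) with hf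
  set s : Set ℕ := {p : ℕ | p.Prime ∧ p ≠ 2} with hs
  have h1 : HasProd (f ∘ ((↑) : s → ℕ)) (∏' p : {p : ℕ // p.Prime ∧ p ≠ 2}, f p.1) :=
    multipliable_localDensity.hasProd
  rw [hasProd_subtype_iff_mulIndicator] at h1
  refine ((h1.tendsto_prod_nat).const_mul (7 / 12)).congr' ?_
  filter_upwards [eventually_ge_atTop 3] with z hz
  have h2 : ∀ n ∈ Finset.range z, (if n.Prime then localDensity n else 1) =
      (if n = 2 then (7 / 12 : ℝ) else 1) * s.mulIndicator f n := by
    intro n _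
    by_cases hn2 : n = 2
    · rw [if_pos hn2, Set.mulIndicator_of_notMem (fun h => h.2 hn2), mul_one, hn2,
        if_pos Nat.prime_two, localDensity, if_pos rfl]
    · rw [if_neg hn2, one_mul]
      by_cases hn : n.Prime
      · rw [if_pos hn, Set.mulIndicator_of_mem (show n ∈ s from ⟨hn, hn2⟩), localDensity, if_neg hn2]
      · rw [if_neg hn, Set.mulIndicator_of_notMem (fun h => hn h.1)]
  rw [Finset.prod_filter, Finset.prod_congr rfl h2, Finset.prod_mul_distrib, Finset.prod_ite_eq',
    if_pos (Finset.mem_range.mpr (by omega))]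

theorem tendsto_card_maximalBall_div :
    Tendsto (fun T : ℝ => ((maximalBall T).card : ℝ) / (frobBall T).card) atTop
      (𝓝 ((7 / 12) * ∏' p : {p : ℕ // p.Prime ∧ p ≠ 2},
        (1 - 2 * ((p.1 : ℝ) ^ 2 + (p.1 : ℝ) - 1) /
          ((p.1 : ℝ) ^ 2 * ((p.1 : ℝ) ^ 2 - 1))))) := by
  have hprod := tendsto_prod_localDensity
  set L := (7 / 12) * ∏' p : {p : ℕ // p.Prime ∧ p ≠ 2},
    (1 - 2 * ((p.1 : ℝ) ^ 2 + (p.1 : ℝ) - 1) / ((p.1 : ℝ) ^ 2 * ((p.1 : ℝ) ^ 2 - 1))) with hL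
  rw [Metric.tendsto_nhds]
  intro ε hε
  obtain ⟨z₀, hz₀⟩ := exists_level_card_sub_le (ε / 256) (by positivity)
  obtain ⟨z, hzL, hz⟩ := ((Metric.tendsto_nhds.mp hprod (ε / 4) (by positivity)).and
    (eventually_ge_atTop z₀)).exists
  have hsieve := tendsto_card_good_div ((Finset.range z).filter Nat.Prime)
    (fun p hp => (Finset.mem_filter.mp hp).2) (sievedBall z) (fun T γ => mem_sievedBall)
  filter_upwards [hz₀ z hz, Metric.tendsto_nhds.mp hsieve (ε / 4) (by positivity),
    eventually_ge_atTop 2] with T h1 h2 hT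
  have hball := card_frobBall_ge hT
  have hpos : (0 : ℝ) < (frobBall T).card := lt_of_lt_of_le (by positivity) hball
  have hle : ((maximalBall T).card : ℝ) / (frobBall T).card ≤
      ((sievedBall z T).card : ℝ) / (frobBall T).card := by
    gcongr
    exact maximalBall_subset_sievedBall z T
  have hge : ((sievedBall z T).card : ℝ) / (frobBall T).card ≤
      ((maximalBall T).card : ℝ) / (frobBall T).card + ε / 4 := by
    rw [div_le_iff₀ hpos, add_mul, div_mul_cancel₀ _ hpos.ne']
    nlinarith
  rw [Real.dist_eq, abs_lt] at *
  constructor <;> linarith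

/-- The proportion of `γ ∈ Γ_T` which are hyperbolic with `u_γ = f_γ = 1` (i.e. `ℤ[γ]`
is the ring of integers of `ℚ(√(Tr(γ)²-4))`, hence Dedekind) converges to
`(7/12)·∏_{p odd prime} (1 - 2(p²+p-1)/(p²(p²-1)))`. -/
theorem statement10 :
    Tendsto (fun T : ℝ =>
        (Nat.card {γ : SL2Z // frobNorm γ ≤ T ∧ 2 < |trZ γ| ∧ IsMaximalZGamma γ} : ℝ) /
          (Nat.card {γ : SL2Z // frobNorm γ ≤ T} : ℝ))
      atTop
      (𝓝 ((7 / 12) * ∏' p : {p : ℕ // p.Prime ∧ p ≠ 2},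
        (1 - 2 * ((p.1 : ℝ) ^ 2 + (p.1 : ℝ) - 1) /
          ((p.1 : ℝ) ^ 2 * ((p.1 : ℝ) ^ 2 - 1))))) := by
  refine tendsto_card_maximalBall_div.congr fun T => ?_
  rw [Nat.subtype_card (maximalBall T) (fun γ => by rw [mem_maximalBall, mem_frobBall]),
    Nat.subtype_card (frobBall T) (fun γ => mem_frobBall)]
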